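/- Let n, m ≥ 1, and let ω : (0,∞) → [0,∞) be non-decreasing, doubling (ω(2t) ≤ D·ω(t) for all t > 0 for some D > 0), and satisfy the log-Dini(1/(2m)) condition. Let K be an m-linear Calderón–Zygmund kernel of ω type with constant C₀ > 0 on ℝⁿ and T an m-linear operator on m-tuples of integrable functions with kernel representation by K. Let b₁,…,b_m be locally integrable with finite BMO seminorms, and define the iterated commutator T_{Πb}(f⃗) = ∑_{S ⊆ {1,…,m}} (−1)^{|S|} (∏_{j ∉ S} b_j)·T(g₁^S,…,g_m^S), where g_j^S = b_j f_j if j ∈ S and g_j^S = f_j otherwise. Assume C₁′, C₂ > 0 satisfy: |{x : |T_{Πb}(f⃗)(x)| > λ}| ≤ (C₁′∏_j‖f_j‖_{L²}/λ)^{2/m} for all bounded compactly supported f_j and λ > 0, and |{x : |T(f⃗)(x)| > λ}| ≤ (C₂∏_j‖f_j‖_{L¹}/λ)^{1/m} for all f_j ∈ L¹(ℝⁿ), λ > 0. Then there is C, depending only on n, m, ω, D and ‖b₁‖_*,…,‖b_m‖_*, such that for every λ > 0 and all f₁,…,f_m that are finite sums of (1,∞,0)-atoms supported on dyadic cubes with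 coefficient ℓ¹-sums at most 1, |{x ∈ ℝⁿ : |T_{Πb}(f⃗)(x)| > λ}| ≤ C·(C₀+C₁′+C₂)^{1/m}·λ^{−1/m}. -/

import Mathlib

open MeasureTheory Set
open scoped ENNReal

noncomputable section

/-- Euclidean space `ℝⁿ`. -/
abbrev Rn (n : ℕ) : Type := EuclideanSpace ℝ (Fin n)

/-- A dyadic cube `∏ [2^k mᵢ, 2^k (mᵢ+1))` in `ℝⁿ`. -/
def IsDyadicCube {n : ℕ} (Q : Set (Rn n)) : Prop :=
  ∃ (k : ℤ) (m : Fin n → ℤ),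
    Q = {x : Rn n | ∀ i, (2:ℝ) ^ k * (m i : ℝ) ≤ x i ∧ x i < (2:ℝ) ^ k * ((m i : ℝ) + 1)}

/-- The (closed) axis-parallel cube with center `c` and side length `l`. -/
def cube {n : ℕ} (c : Rn n) (l : ℝ) : Set (Rn n) :=
  {x : Rn n | ∀ i, |x i - c i| ≤ l / 2}

/-- The average `b_Q = |Q|⁻¹ ∫_Q b`. -/
def avgOn {n : ℕ} (b : Rn n → ℝ) (Q : Set (Rn n)) : ℝ := ⨍ x in Q, b x

/-- `b` has mean oscillation at most `M` on every cube; i.e. `‖b‖_* ≤ M`. -/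
def OscBound {n : ℕ} (b : Rn n → ℝ) (M : ℝ) : Prop :=
  ∀ (c : Rn n) (l : ℝ), 0 < l →
    ⨍ x in cube c l, |b x - avgOn b (cube c l)| ≤ M

/-- A `(1,∞,0)`-atom supported on the set `Q`. -/
def IsH1Atom {n : ℕ} (Q : Set (Rn n)) (a : Rn n → ℝ) : Prop :=
  Measurable a ∧ (∀ x, x ∉ Q → a x = 0) ∧
    (∀ᵐ x ∂volume, |a x| ≤ ((volume Q).toReal)⁻¹) ∧ (∫ x, a x) = 0

/-- The `L¹` norm. -/
def l1norm {n : ℕ} (f : Rn n → ℝ) : ℝ := ∫ x, |f x|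

/-- The `L²` norm. -/
def l2norm {n : ℕ} (f : Rn n → ℝ) : ℝ := (∫ x, (f x) ^ 2) ^ ((1:ℝ)/2)

/-- A finite sum `∑ λ_k a_k` of `(1,∞,0)`-atoms on dyadic cubes with `∑ |λ_k| ≤ 1`. -/
def FiniteAtomicSum {n : ℕ} (f : Rn n → ℝ) : Prop :=
  ∃ (N : ℕ) (Q : Fin N → Set (Rn n)) (a : Fin N → Rn n → ℝ) (lam : Fin N → ℝ),
    (∀ k, IsDyadicCube (Q k)) ∧ (∀ k, IsH1Atom (Q k) (a k)) ∧
    (∑ k, |lam k|) ≤ 1 ∧ ∀ x, f x = ∑ k, lam k * a k x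

/-- An `m`-linear Calderón–Zygmund kernel of `ω` type with constant `C₀` on `ℝⁿ`.
The condition `|u| ≤ (1/2)·max_j |x - y_j|` is phrased as `∃ j, |u| ≤ (1/2)·|x - y_j|`. -/
def IsCZKernelM {n m : ℕ} (C₀ : ℝ) (ω : ℝ → ℝ)
    (K : Rn n → (Fin m → Rn n) → ℝ) : Prop :=
  (∀ (x : Rn n) (y : Fin m → Rn n), (¬ ∀ j, y j = x) →
      |K x y| ≤ C₀ / (∑ j, ‖x - y j‖) ^ (m * n)) ∧
  (∀ (x x' : Rn n) (y : Fin m → Rn n), (¬ ∀ j, y j = x) →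
      (∃ j, ‖x - x'‖ ≤ (1/2) * ‖x - y j‖) →
      |K x y - K x' y| ≤
        C₀ / (∑ j, ‖x - y j‖) ^ (m * n) * ω (‖x - x'‖ / ∑ j, ‖x - y j‖)) ∧
  (∀ (x : Rn n) (y : Fin m → Rn n) (i : Fin m) (y' : Rn n), (¬ ∀ j, y j = x) →
      (∃ j, ‖y i - y'‖ ≤ (1/2) * ‖x - y j‖) →
      |K x y - K x (Function.update y i y')| ≤
        C₀ / (∑ j, ‖x - y j‖) ^ (m * n) * ω (‖y i - y'‖ / ∑ j, ‖x - y j‖))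

/-- `T` is additive and homogeneous in each of its `m` entries (on integrable functions). -/
def MultilinM {n m : ℕ} (T : (Fin m → Rn n → ℝ) → Rn n → ℝ) : Prop :=
  (∀ (f : Fin m → Rn n → ℝ) (j : Fin m) (g g' : Rn n → ℝ),
      (∀ k, Integrable (f k)) → Integrable g → Integrable g' → ∀ x,
      T (Function.update f j (fun y => g y + g' y)) x =
        T (Function.update f j g) x + T (Function.update f j g') x) ∧
  (∀ (f : Fin m → Rn n → ℝ) (j : Fin m) (r : ℝ) (g : Rn n → ℝ),
      (∀ k, Integrable (f k)) → Integrable g → ∀ x,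
      T (Function.update f j (fun y => r * g y)) x = r * T (Function.update f j g) x)

/-- `T` is represented by the kernel `K` off the supports of the arguments. -/
def KernelRepM {n m : ℕ} (K : Rn n → (Fin m → Rn n) → ℝ)
    (T : (Fin m → Rn n → ℝ) → Rn n → ℝ) : Prop :=
  ∀ f : Fin m → Rn n → ℝ, (∀ j, Integrable (f j)) → (∀ j, HasCompactSupport (f j)) →
    ∀ᵐ x ∂volume, x ∉ ⋂ j, tsupport (f j) →
      T f x = ∫ y : Fin m → Rn n, K x y * ∏ j, f j (y j)

/-- The iterated commutator
`T_{Πb}(f⃗) = ∑_{S ⊆ {1,…,m}} (−1)^{|S|} (∏_{j∉S} b_j)·T(g₁^S,…,g_m^S)`,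
where `g_j^S = b_j f_j` for `j ∈ S` and `g_j^S = f_j` otherwise. -/
def iterComm {n m : ℕ} (T : (Fin m → Rn n → ℝ) → Rn n → ℝ)
    (b : Fin m → Rn n → ℝ) (f : Fin m → Rn n → ℝ) (x : Rn n) : ℝ :=
  ∑ S : Finset (Fin m), (-1 : ℝ) ^ S.card * (∏ j ∈ Sᶜ, b j x) *
    T (fun j => if j ∈ S then (fun y => b j y * f j y) else f j) x

section Helpers

open Metric Filter
open scoped Topology NNReal

/-! ### Balls and the centred maximal function -/

lemma volume_closedBall_Rn {n : ℕ} (x : Rn n) {R : ℝ} (hR : 0 ≤ R) :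
    volume (closedBall x R) = ENNReal.ofReal R ^ n * volume (ball (0 : Rn n) 1) := by
  rw [Measure.addHaar_closedBall volume x hR, finrank_euclideanSpace_fin, ENNReal.ofReal_pow hR]

/-- Points at which some centred ball has mass of `h` larger than `t R ^ n`. -/
def maxSet {n : ℕ} (h : Rn n → ℝ≥0∞) (t : ℝ≥0∞) : Set (Rn n) :=
  {x | ∃ R : ℝ, 0 < R ∧ t * ENNReal.ofReal R ^ n < ∫⁻ y in closedBall x R, h y}

lemma lintegral_closedBall_le_of_notMem_maxSet {n : ℕ} {h : Rn n → ℝ≥0∞} {t : ℝ≥0∞} {x : Rn n}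
    (hx : x ∉ maxSet h t) {R : ℝ} (hR : 0 < R) :
    ∫⁻ y in closedBall x R, h y ≤ t * ENNReal.ofReal R ^ n := by
  by_contra hc
  exact hx ⟨R, hR, not_le.1 hc⟩

/-- Vitali selection: balls with radii bounded by `t R ^ n < ∫ h` have a countable disjoint
subfamily whose fivefold dilates contain all of them. -/
lemma exists_vitali_family {n : ℕ} (hn : 1 ≤ n) (h : Rn n → ℝ≥0∞) (t : ℝ≥0∞) (ht : t ≠ 0)
    (hh : ∫⁻ y, h y ≠ ∞) (F : Set (Rn n × ℝ))
    (hF : ∀ p ∈ F, 0 < p.2 ∧ t * ENNReal.ofReal p.2 ^ n < ∫⁻ y in closedBall p.1 p.2, h y) :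
    ∃ u : Set (Rn n × ℝ), u ⊆ F ∧ u.Countable ∧
      (∀ a ∈ F, ∃ b ∈ u, closedBall a.1 a.2 ⊆ closedBall b.1 (5 * b.2)) ∧
      ∑' b : u, ENNReal.ofReal b.1.2 ^ n ≤ (∫⁻ y, h y) / t := by
  have hbd : ∃ R0 : ℝ, ∀ p ∈ F, p.2 ≤ R0 := by
    refine ⟨max 1 ((∫⁻ y, h y) / t).toReal, fun p hp => ?_⟩
    obtain ⟨h1, h2⟩ := hF p hp
    by_cases hle : p.2 ≤ 1
    · exact le_max_of_le_left hle
    refine le_max_of_le_right ?_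
    have hlt : (∫⁻ y, h y) / t ≠ ∞ := by
      intro hc
      rw [ENNReal.div_eq_top] at hc
      rcases hc with hc | hc
      · exact ht hc.2
      · exact hh hc.1
    have htt : t ≠ ∞ := by
      rintro rfl
      rw [ENNReal.top_mul] at h2
      · exact not_top_lt h2
      · simp [h1]
    rw [← ENNReal.ofReal_le_iff_le_toReal hlt, ENNReal.le_div_iff_mul_le (Or.inl ht) (Or.inl htt)]
    calc ENNReal.ofReal p.2 * t ≤ ENNReal.ofReal p.2 ^ n * t := by
          gcongr
          exact le_self_pow (by simpa using (not_le.1 hle).le) (by omega)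
      _ ≤ ∫⁻ y, h y := by
          rw [mul_comm]
          exact h2.le.trans (setLIntegral_le_lintegral _ _)
  obtain ⟨R0, hR0⟩ := hbd
  obtain ⟨u, huF, hdis, hcov⟩ := Vitali.exists_disjoint_subfamily_covering_enlargement_closedBall
    F (fun p => p.1) (fun p => p.2) R0 hR0 5 (by norm_num)
  have hcount : u.Countable := by
    refine hdis.countable_of_nonempty_interior fun p hp => ?_
    have : 0 < p.2 := (hF p (huF hp)).1
    exact ⟨p.1, ball_subset_interior_closedBall (mem_ball_self this)⟩
  refine ⟨u, huF, hcount, hcov, ?_⟩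
  have := hcount.to_subtype
  have h3 : ∑' b : u, t * ENNReal.ofReal b.1.2 ^ n ≤ ∫⁻ y, h y := by
    calc ∑' b : u, t * ENNReal.ofReal b.1.2 ^ n
        ≤ ∑' b : u, ∫⁻ y in closedBall b.1.1 b.1.2, h y :=
          ENNReal.tsum_le_tsum fun b => (hF b (huF b.2)).2.le
      _ = ∫⁻ y in ⋃ b : u, closedBall b.1.1 b.1.2, h y := by
          rw [lintegral_iUnion (fun b => isClosed_closedBall.measurableSet)]
          intro a b hab
          exact hdis a.2 b.2 (fun hc => hab (Subtype.ext hc))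
      _ ≤ ∫⁻ y, h y := setLIntegral_le_lintegral _ _
  rw [ENNReal.tsum_mul_left] at h3
  by_cases htt : t = ∞
  · subst htt
    have : ∀ b : u, False := by
      intro b
      have h4 := hF b (huF b.2)
      rw [ENNReal.top_mul] at h4
      · exact not_top_lt h4.2
      · simp [h4.1]
    have : IsEmpty u := ⟨this⟩
    simp
  rw [ENNReal.le_div_iff_mul_le (Or.inl ht) (Or.inl htt), mul_comm]
  exact h3

/-- Weak type `(1,1)` of the centred maximal function. -/
lemma volume_maxSet_le {n : ℕ} (hn : 1 ≤ n) : ∃ C : ℝ≥0, 1 ≤ C ∧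
    ∀ (h : Rn n → ℝ≥0∞) (t : ℝ≥0∞), t ≠ 0 → (∫⁻ y, h y) ≠ ∞ →
      volume (maxSet h t) ≤ C * ((∫⁻ y, h y) / t) := by
  have hfin : volume (ball (0 : Rn n) 1) ≠ ∞ := measure_ball_lt_top.ne
  refine ⟨max 1 (5 ^ n * (volume (ball (0 : Rn n) 1)).toNNReal), le_max_left _ _,
    fun h t ht hh => ?_⟩
  obtain ⟨u, huF, hcount, hcov, hsum⟩ := exists_vitali_family hn h t ht hh
    {p | 0 < p.2 ∧ t * ENNReal.ofReal p.2 ^ n < ∫⁻ y in closedBall p.1 p.2, h y} (fun p hp => hp)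
  have := hcount.to_subtype
  calc volume (maxSet h t) ≤ volume (⋃ b : u, closedBall b.1.1 (5 * b.1.2)) := by
        refine measure_mono fun x ⟨R, hR, hx⟩ => ?_
        obtain ⟨b, hb, hsub⟩ := hcov (x, R) ⟨hR, hx⟩
        exact mem_iUnion.2 ⟨⟨b, hb⟩, hsub (mem_closedBall_self hR.le)⟩
    _ ≤ ∑' b : u, volume (closedBall b.1.1 (5 * b.1.2)) := measure_iUnion_le _
    _ = ∑' b : u, (5 ^ n * volume (ball (0 : Rn n) 1)) * ENNReal.ofReal b.1.2 ^ n := by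
        congr with b
        have h0 : 0 ≤ b.1.2 := (huF b.2).1.le
        rw [volume_closedBall_Rn _ (by positivity), ENNReal.ofReal_mul (by norm_num), mul_pow]
        simp only [ENNReal.ofReal_ofNat]
        ring
    _ = (5 ^ n * volume (ball (0 : Rn n) 1)) * ∑' b : u, ENNReal.ofReal b.1.2 ^ n :=
        ENNReal.tsum_mul_left
    _ ≤ _ := by
        gcongr
        rw [ENNReal.coe_max, ENNReal.coe_mul, ENNReal.coe_toNNReal hfin]
        refine le_max_of_le_right (by simp)

/-! ### Dyadic grids and stopping cubes -/

/-- The half-open cube with centre `c` and side length `l`. -/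
def hcube {n : ℕ} (c : Rn n) (l : ℝ) : Set (Rn n) :=
  {y | ∀ i, c i - l / 2 ≤ y i ∧ y i < c i + l / 2}

/-- The multi-index of the cell of side `2 ^ k * l` containing `x`, in the grid based at `a`. -/
def gridIdx {n : ℕ} (a : Rn n) (l : ℝ) (k : ℤ) (x : Rn n) : Fin n → ℤ :=
  fun i => ⌊(x i - a i) / ((2 : ℝ) ^ k * l)⌋

/-- The centre of a grid cell. -/
def cellCtr {n : ℕ} (a : Rn n) (l : ℝ) (k : ℤ) (v : Fin n → ℤ) : Rn n :=
  WithLp.toLp 2 fun i => a i + (2 : ℝ) ^ k * l * ((v i : ℝ) + 1 / 2)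

/-- A grid cell. -/
def cell {n : ℕ} (a : Rn n) (l : ℝ) (k : ℤ) (v : Fin n → ℤ) : Set (Rn n) :=
  hcube (cellCtr a l k v) ((2 : ℝ) ^ k * l)

lemma mem_cell_iff {n : ℕ} {a : Rn n} {l : ℝ} (hl : 0 < l) {k : ℤ} {v : Fin n → ℤ} {x : Rn n} :
    x ∈ cell a l k v ↔ gridIdx a l k x = v := by
  have hp : 0 < (2 : ℝ) ^ k * l := by positivity
  rw [funext_iff]
  refine forall_congr' fun i => ?_
  simp only [gridIdx, cellCtr, Int.floor_eq_iff, le_div_iff₀ hp, div_lt_iff₀ hp]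
  constructor
  · rintro ⟨h1, h2⟩; constructor <;> nlinarith
  · rintro ⟨h1, h2⟩; constructor <;> nlinarith

lemma gridIdx_succ {n : ℕ} (a : Rn n) (l : ℝ) (k : ℤ) (x : Rn n) (i : Fin n) :
    gridIdx a l (k + 1) x i = gridIdx a l k x i / 2 := by
  have h := Int.floor_div_natCast ((x i - a i) / ((2 : ℝ) ^ k * l)) 2
  simp only [gridIdx]
  rw [zpow_add_one₀ (by norm_num)]
  push_cast at h
  rw [← h]
  congr 1
  rw [div_div]
  ring_nf

lemma gridIdx_mono {n : ℕ} {a : Rn n} {l : ℝ} {k k' : ℤ} (hk : k ≤ k') {x y : Rn n}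
    (h : gridIdx a l k x = gridIdx a l k y) : gridIdx a l k' x = gridIdx a l k' y := by
  induction k', hk using Int.leInduction with
  | base => exact h
  | succ j _ ih =>
    funext i
    rw [gridIdx_succ, gridIdx_succ, ih]

lemma cell_subset_cell {n : ℕ} {a : Rn n} {l : ℝ} (hl : 0 < l) {k k' : ℤ} (hk : k ≤ k')
    {v v' : Fin n → ℤ} {x : Rn n} (hx : x ∈ cell a l k v) (hx' : x ∈ cell a l k' v') :
    cell a l k v ⊆ cell a l k' v' := by
  intro y hy
  rw [mem_cell_iff hl] at *
  rw [← hx']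
  exact gridIdx_mono hk (hy.trans hx.symm)

lemma ctr_mem_hcube {n : ℕ} (c : Rn n) {l : ℝ} (hl : 0 < l) : c ∈ hcube c l :=
  fun i => ⟨by linarith, by linarith⟩

lemma hcube_subset_cube {n : ℕ} (c : Rn n) (l : ℝ) : hcube c l ⊆ cube c l := by
  intro y hy i
  have := hy i
  rw [abs_le]
  constructor <;> linarith

lemma hcube_eq_preimage {n : ℕ} (c : Rn n) (l : ℝ) :
    hcube c l = (MeasurableEquiv.toLp 2 (Fin n → ℝ)).symm ⁻¹'
      (Set.pi univ fun i => Ico (c i - l / 2) (c i + l / 2)) := by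
  ext y
  simp [hcube]

lemma cube_eq_preimage {n : ℕ} (c : Rn n) (l : ℝ) :
    cube c l = (MeasurableEquiv.toLp 2 (Fin n → ℝ)).symm ⁻¹'
      (Set.pi univ fun i => Icc (c i - l / 2) (c i + l / 2)) := by
  ext y
  simp only [cube, mem_ofPred_eq, mem_preimage, mem_univ_pi, mem_Icc,
    MeasurableEquiv.coe_toLp_symm]
  refine forall_congr' fun i => ?_
  rw [abs_le]
  constructor <;> rintro ⟨h1, h2⟩ <;> constructor <;> linarith

lemma measurableSet_hcube {n : ℕ} (c : Rn n) (l : ℝ) : MeasurableSet (hcube c l) := by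
  rw [hcube_eq_preimage]
  exact (MeasurableEquiv.measurable _)
    (MeasurableSet.univ_pi fun i => measurableSet_Ico)

lemma measurableSet_cube {n : ℕ} (c : Rn n) (l : ℝ) : MeasurableSet (cube c l) := by
  rw [cube_eq_preimage]
  exact (MeasurableEquiv.measurable _)
    (MeasurableSet.univ_pi fun i => measurableSet_Icc)

lemma volume_hcube {n : ℕ} (c : Rn n) (l : ℝ) : volume (hcube c l) = ENNReal.ofReal l ^ n := by
  rw [hcube_eq_preimage,
    (EuclideanSpace.volume_preserving_symm_measurableEquiv_toLp (Fin n)).measure_preimage_equiv,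
    Real.volume_pi_Ico]
  simp

lemma volume_cube {n : ℕ} (c : Rn n) (l : ℝ) : volume (cube c l) = ENNReal.ofReal l ^ n := by
  rw [cube_eq_preimage,
    (EuclideanSpace.volume_preserving_symm_measurableEquiv_toLp (Fin n)).measure_preimage_equiv,
    MeasureTheory.volume_pi_pi]
  simp [Real.volume_Icc]

lemma measurableSet_cell {n : ℕ} (a : Rn n) (l : ℝ) (k : ℤ) (v : Fin n → ℤ) :
    MeasurableSet (cell a l k v) := measurableSet_hcube _ _

lemma norm_le_of_abs_coord_le {n : ℕ} {x : Rn n} {r : ℝ} (h : ∀ i, |x i| ≤ r) :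
    ‖x‖ ≤ n * r := by
  have h1 : ‖x‖ ≤ ∑ i, |x i| := by
    rw [EuclideanSpace.norm_eq]
    apply Real.sqrt_le_iff.2
    refine ⟨Finset.sum_nonneg fun i _ => abs_nonneg _, ?_⟩
    exact Finset.sum_sq_le_sq_sum_of_nonneg fun i _ => abs_nonneg (x i)
  calc ‖x‖ ≤ ∑ i, |x i| := h1
    _ ≤ ∑ _i : Fin n, r := Finset.sum_le_sum fun i _ => h i
    _ = n * r := by simp

lemma cube_subset_closedBall {n : ℕ} (c : Rn n) (l : ℝ) :
    cube c l ⊆ closedBall c (n * (l / 2)) := by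
  intro y hy
  rw [mem_closedBall, dist_eq_norm]
  exact norm_le_of_abs_coord_le fun i => by simpa using hy i

lemma closedBall_subset_cube {n : ℕ} (c : Rn n) (R : ℝ) :
    closedBall c R ⊆ cube c (2 * R) := by
  intro y hy i
  rw [mem_closedBall, dist_eq_norm] at hy
  have h : |(y - c) i| ≤ ‖y - c‖ := by
    simpa using PiLp.norm_apply_le (y - c) i
  simp only [PiLp.sub_apply] at h
  linarith

lemma norm_sub_le_of_mem_hcube {n : ℕ} {c : Rn n} {l : ℝ} {x y : Rn n}
    (hx : x ∈ hcube c l) (hy : y ∈ hcube c l) : ‖x - y‖ ≤ n * l := by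
  refine norm_le_of_abs_coord_le fun i => ?_
  have h1 := hx i
  have h2 := hy i
  simp only [PiLp.sub_apply, abs_le]
  constructor <;> linarith

lemma abs_ctr_sub_le_of_hcube_subset {n : ℕ} {c c' : Rn n} {l l' : ℝ} (hl' : 0 < l')
    (h : hcube c' l' ⊆ hcube c l) (i : Fin n) : |c' i - c i| ≤ (l - l') / 2 := by
  have key : ∀ t : ℝ, 0 ≤ t → t < 1 → c i - l / 2 ≤ c' i - l' / 2 + t * l' ∧
      c' i - l' / 2 + t * l' < c i + l / 2 := by
    intro t ht ht'
    have hm : (WithLp.toLp 2 (fun j => c' j - l' / 2 + t * l') : Rn n) ∈ hcube c' l' := by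
      intro j
      simp only
      constructor <;> nlinarith
    simpa using h hm i
  have h0 := (key 0 le_rfl one_pos).1
  have h1 : c' i + l' / 2 ≤ c i + l / 2 := by
    by_contra hc
    push Not at hc
    set δ := c' i + l' / 2 - (c i + l / 2) with hδ
    have hδ0 : 0 < δ := by linarith
    have := (key (max 0 (1 - δ / l')) (le_max_left _ _)
      (max_lt one_pos (by have := div_pos hδ0 hl'; linarith))).2
    have h3 : (1 - δ / l') * l' ≤ max 0 (1 - δ / l') * l' :=
      mul_le_mul_of_nonneg_right (le_max_right _ _) hl'.le
    have h4 : (1 - δ / l') * l' = l' - δ := by field_simp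
    linarith
  rw [abs_le]
  constructor <;> linarith

lemma closedBall_subset_of_hcube_subset {n : ℕ} {c c' : Rn n} {l l' : ℝ} (hl' : 0 < l')
    (h : hcube c' l' ⊆ hcube c l) {Λ : ℝ} (hΛ : (n : ℝ) ≤ Λ) (hl : l' ≤ l) :
    closedBall c' (Λ * l') ⊆ closedBall c (Λ * l) := by
  apply closedBall_subset_closedBall'
  rw [dist_eq_norm]
  have h1 : ‖c' - c‖ ≤ n * ((l - l') / 2) := norm_le_of_abs_coord_le fun i => by
    simpa using abs_ctr_sub_le_of_hcube_subset hl' h i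
  have h2 : (n : ℝ) * ((l - l') / 2) ≤ Λ * (l - l') := by
    have : (0 : ℝ) ≤ n := by positivity
    nlinarith
  linarith

/-- Maximal cells for a predicate which only selects cells of bounded size. -/
lemma exists_stopping {n : ℕ} (a : Rn n) {l : ℝ} (hl : 0 < l) (Sel : ℤ → (Fin n → ℤ) → Prop)
    (K : ℤ) (hK : ∀ k v, Sel k v → k ≤ K) :
    ∃ S : Set (ℤ × (Fin n → ℤ)), (∀ p ∈ S, Sel p.1 p.2) ∧
      (S.PairwiseDisjoint fun p => cell a l p.1 p.2) ∧
      (∀ k x, Sel k (gridIdx a l k x) → ∃ p ∈ S, x ∈ cell a l p.1 p.2 ∧ k ≤ p.1) ∧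
      (∀ p ∈ S, ∀ x ∈ cell a l p.1 p.2, ∀ k > p.1, ¬ Sel k (gridIdx a l k x)) := by
  refine ⟨{p | Sel p.1 p.2 ∧ ∀ x ∈ cell a l p.1 p.2, ∀ k > p.1, ¬ Sel k (gridIdx a l k x)},
    fun p hp => hp.1, ?_, ?_, fun p hp => hp.2⟩
  · intro p hp q hq hpq
    rw [Function.onFun, Set.disjoint_left]
    intro x hxp hxq
    apply hpq
    have h1 := (mem_cell_iff hl).1 hxp
    have h2 := (mem_cell_iff hl).1 hxq
    rcases lt_trichotomy p.1 q.1 with h | h | h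
    · exact absurd (h2 ▸ hq.1) (hp.2 x hxp _ h)
    · refine Prod.ext h ?_
      rw [← h1, ← h2, h]
    · exact absurd (h1 ▸ hp.1) (hq.2 x hxq _ h)
  · intro k x hk
    obtain ⟨k', ⟨hk', hkk'⟩, hmax⟩ := Int.exists_greatest_of_bdd
      (P := fun j => Sel j (gridIdx a l j x) ∧ k ≤ j) ⟨K, fun z hz => hK _ _ hz.1⟩ ⟨k, hk, le_rfl⟩
    refine ⟨(k', gridIdx a l k' x), ⟨hk', fun y hy j hj hs => ?_⟩, (mem_cell_iff hl).2 rfl, hkk'⟩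
    have hy' := (mem_cell_iff hl).1 hy
    rw [gridIdx_mono hj.le hy'] at hs
    exact absurd (hmax j ⟨hs, hkk'.trans hj.le⟩) (not_le.2 hj)

/-- Stopping cubes of a small subset of a cube. -/
lemma exists_local_stopping {n : ℕ} (hn : 1 ≤ n) (c : Rn n) {l : ℝ} (hl : 0 < l)
    (E : Set (Rn n)) (hE : volume (E ∩ hcube c l) ≤ ENNReal.ofReal l ^ n / 2 ^ (n + 3)) :
    ∃ (ι : Type) (_ : Countable ι) (ctr : ι → Rn n) (s : ι → ℝ),
      (∀ i, 0 < s i ∧ s i ≤ l ∧ hcube (ctr i) (s i) ⊆ hcube c l ∧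
        volume (E ∩ hcube (ctr i) (s i)) ≤ ENNReal.ofReal (s i) ^ n / 2) ∧
      Pairwise (fun i j => Disjoint (hcube (ctr i) (s i)) (hcube (ctr j) (s j))) ∧
      ∑' i, ENNReal.ofReal (s i) ^ n ≤ ENNReal.ofReal l ^ n / 2 ∧
      E ∩ hcube c l ⊆ ⋃ i, hcube (ctr i) (s i) := by
  have hln : 0 < ENNReal.ofReal l ^ n := by positivity
  have hlt : ENNReal.ofReal l ^ n ≠ ∞ := by finiteness
  obtain ⟨U, hEU, hUo, hU⟩ := (E ∩ hcube c l).exists_isOpen_lt_of_lt (μ := volume)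
    (ENNReal.ofReal l ^ n / 2 ^ (n + 2)) (hE.trans_lt (by
      rw [pow_succ 2 (n + 2)]
      apply ENNReal.div_lt_div_left hln.ne' hlt
      calc (2 : ℝ≥0∞) ^ (n + 2) = 2 ^ (n + 2) * 1 := by rw [mul_one]
        _ < 2 ^ (n + 2) * 2 := by
          rw [ENNReal.mul_lt_mul_iff_right (by positivity) (by finiteness)]
          norm_num))
  set a : Rn n := WithLp.toLp 2 fun i => c i - l / 2 with ha
  have hP : cell a l 0 0 = hcube c l := by
    have : cellCtr a l 0 0 = c := by
      ext i
      simp only [cellCtr, ha, Pi.zero_apply]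
      push_cast
      simp
      ring
    simp [cell, this]
  have hvol : ∀ k v, volume (cell a l k v) = ENNReal.ofReal ((2 : ℝ) ^ k * l) ^ n :=
    fun k v => volume_hcube _ _
  set V : Set (Rn n) := U ∩ hcube c l with hV
  have hVU : volume V < ENNReal.ofReal l ^ n / 2 ^ (n + 2) :=
    (measure_mono inter_subset_left).trans_lt hU
  have hVm : MeasurableSet V := hUo.measurableSet.inter (measurableSet_hcube _ _)
  obtain ⟨S, hS1, hS2, hS3, hS4⟩ := exists_stopping a hl
    (fun k v => volume (cell a l k v) / 2 ^ (n + 1) < volume (cell a l k v ∩ V)) (-1) (by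
      intro k v hs
      by_contra hk
      have hk0 : 0 ≤ k := by omega
      have h1 : (1 : ℝ) ≤ 2 ^ k := one_le_zpow₀ (by norm_num) hk0
      have h2 : ENNReal.ofReal l ^ n ≤ volume (cell a l k v) := by
        rw [hvol]
        gcongr
        nlinarith
      have h3 := hs.trans_le ((measure_mono inter_subset_right).trans hVU.le)
      have h4 : ENNReal.ofReal l ^ n / 2 ^ (n + 2) ≤ volume (cell a l k v) / 2 ^ (n + 1) := by
        gcongr
        · norm_num
        · omega
      exact absurd h3 (not_lt.2 h4))
  have hneg : ∀ p ∈ S, p.1 ≤ -1 := by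
    intro p hp
    by_contra hk
    have hk0 : 0 ≤ p.1 := by omega
    have h1 : (1 : ℝ) ≤ 2 ^ p.1 := one_le_zpow₀ (by norm_num) hk0
    have h2 : ENNReal.ofReal l ^ n ≤ volume (cell a l p.1 p.2) := by
      rw [hvol]
      gcongr
      nlinarith
    have h3 := (hS1 p hp).trans_le ((measure_mono inter_subset_right).trans hVU.le)
    have h4 : ENNReal.ofReal l ^ n / 2 ^ (n + 2) ≤ volume (cell a l p.1 p.2) / 2 ^ (n + 1) := by
      gcongr
      · norm_num
      · omega
    exact absurd h3 (not_lt.2 h4)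
  have hsub : ∀ p ∈ S, cell a l p.1 p.2 ⊆ hcube c l := by
    intro p hp
    have h1 : (cell a l p.1 p.2 ∩ V).Nonempty := by
      rw [nonempty_iff_ne_empty]
      intro h0
      have := hS1 p hp
      simp [h0] at this
    obtain ⟨x, hx, hxV⟩ := h1
    rw [← hP]
    exact cell_subset_cell hl (by have := hneg p hp; omega) hx (hP ▸ hxV.2)
  refine ⟨S, inferInstance, fun p => cellCtr a l p.1.1 p.1.2, fun p => 2 ^ p.1.1 * l,
    ?_, ?_, ?_, ?_⟩
  · rintro ⟨p, hp⟩
    refine ⟨by positivity, ?_, hsub p hp, ?_⟩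
    · have : (2 : ℝ) ^ p.1 ≤ 1 := zpow_le_one_of_nonpos₀ (by norm_num)
        (by have := hneg p hp; omega)
      simp only
      nlinarith
    · have hc := ctr_mem_hcube (cellCtr a l p.1 p.2) (l := 2 ^ p.1 * l) (by positivity)
      have hns := hS4 p hp _ hc (p.1 + 1) (by omega)
      rw [not_lt] at hns
      have hpar : cell a l p.1 p.2 ⊆
          cell a l (p.1 + 1) (gridIdx a l (p.1 + 1) (cellCtr a l p.1 p.2)) :=
        cell_subset_cell hl (by omega) hc ((mem_cell_iff hl).2 rfl)
      calc volume (E ∩ hcube (cellCtr a l p.1 p.2) (2 ^ p.1 * l))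
          ≤ volume (cell a l (p.1 + 1) (gridIdx a l (p.1 + 1) (cellCtr a l p.1 p.2)) ∩ V) := by
            apply measure_mono
            rintro y ⟨hyE, hy⟩
            exact ⟨hpar hy, hEU ⟨hyE, hsub p hp hy⟩, hsub p hp hy⟩
        _ ≤ _ := hns
        _ = ENNReal.ofReal (2 ^ p.1 * l) ^ n / 2 := by
            rw [hvol, zpow_add_one₀ (by norm_num), mul_right_comm,
              ENNReal.ofReal_mul (by positivity), mul_pow, ENNReal.ofReal_ofNat, pow_succ,
              mul_comm (_ ^ n) ((2 : ℝ≥0∞) ^ n),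
              ENNReal.mul_div_mul_left _ _ (by positivity) (by finiteness)]
  · intro p q hpq
    exact hS2 p.2 q.2 (fun h => hpq (Subtype.ext h))
  · calc ∑' p : S, ENNReal.ofReal (2 ^ p.1.1 * l) ^ n
        ≤ ∑' p : S, 2 ^ (n + 1) * volume (cell a l p.1.1 p.1.2 ∩ V) := by
          refine ENNReal.tsum_le_tsum fun p => ?_
          rw [← hvol p.1.1 p.1.2]
          have := (hS1 p.1 p.2).le
          rwa [ENNReal.div_le_iff_le_mul (by simp) (by simp), mul_comm] at this
      _ = 2 ^ (n + 1) * volume (⋃ p : S, cell a l p.1.1 p.1.2 ∩ V) := by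
          rw [ENNReal.tsum_mul_left, measure_iUnion]
          · intro p q hpq
            exact (hS2 p.2 q.2 (fun h => hpq (Subtype.ext h))).mono inter_subset_left
              inter_subset_left
          · exact fun p => (measurableSet_cell _ _ _ _).inter hVm
      _ ≤ 2 ^ (n + 1) * (ENNReal.ofReal l ^ n / 2 ^ (n + 2)) := by
          gcongr
          exact (measure_mono (iUnion_subset fun p => inter_subset_right)).trans hVU.le
      _ = ENNReal.ofReal l ^ n / 2 := by
          rw [pow_succ 2 (n + 1), ← mul_div_assoc,
            ENNReal.mul_div_mul_left _ _ (by positivity) (by finiteness)]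
  · rintro x hx
    obtain ⟨δ, hδ, hball⟩ := Metric.isOpen_iff.1 hUo x (hEU hx)
    obtain ⟨N, hN⟩ := exists_pow_lt_of_lt_one (show 0 < δ / (n * l) from
      div_pos hδ (mul_pos (by exact_mod_cast hn) hl)) (show (1 / 2 : ℝ) < 1 by norm_num)
    have hn0 : (0 : ℝ) < n := by exact_mod_cast hn
    set k : ℤ := -(N : ℤ) - 1 with hk
    have hk2 : (2 : ℝ) ^ k < δ / (n * l) := by
      calc (2 : ℝ) ^ k ≤ 2 ^ (-(N : ℤ)) := zpow_le_zpow_right₀ (by norm_num) (by omega)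
        _ = (1 / 2) ^ N := by rw [zpow_neg, zpow_natCast, one_div, inv_pow]
        _ < _ := hN
    have hxc : x ∈ cell a l k (gridIdx a l k x) := (mem_cell_iff hl).2 rfl
    have hcV : cell a l k (gridIdx a l k x) ⊆ V := by
      refine subset_inter (fun y hy => hball ?_) ?_
      · rw [mem_ball, dist_eq_norm]
        calc ‖y - x‖ ≤ n * (2 ^ k * l) := norm_sub_le_of_mem_hcube hy hxc
          _ < δ := by
            rw [lt_div_iff₀ (by positivity)] at hk2
            nlinarith
      · rw [← hP]
        exact cell_subset_cell hl (by omega) hxc (hP ▸ hx.2)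
    obtain ⟨p, hp, hxp, -⟩ := hS3 k x (by
      rw [inter_eq_self_of_subset_left hcV, hvol]
      apply ENNReal.div_lt_of_lt_mul
      calc ENNReal.ofReal (2 ^ k * l) ^ n = ENNReal.ofReal (2 ^ k * l) ^ n * 1 := by rw [mul_one]
        _ < _ := by
          rw [ENNReal.mul_lt_mul_iff_right (by positivity) (by finiteness)]
          exact one_lt_pow₀ (by norm_num) (by omega))
    exact mem_iUnion.2 ⟨⟨p, hp⟩, hxp⟩

/-! ### Functions of bounded mean oscillation -/

lemma integrableOn_cube {n : ℕ} {b : Rn n → ℝ} (hb : LocallyIntegrable b volume) (c : Rn n)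
    (l : ℝ) : IntegrableOn b (cube c l) :=
  (hb.integrableOn_isCompact (isCompact_closedBall c _)).mono_set (cube_subset_closedBall c l)

lemma volume_real_cube {n : ℕ} (c : Rn n) {l : ℝ} (hl : 0 < l) :
    volume.real (cube c l) = l ^ n := by
  rw [measureReal_def, volume_cube, ENNReal.toReal_pow, ENNReal.toReal_ofReal hl.le]

lemma enorm_avgOn_sub_mul_le {n : ℕ} {b : Rn n → ℝ} (hb : LocallyIntegrable b volume) (c : Rn n)
    {l : ℝ} (hl : 0 < l) (a : ℝ) :
    ‖avgOn b (cube c l) - a‖ₑ * ENNReal.ofReal l ^ n ≤ ∫⁻ x in cube c l, ‖b x - a‖ₑ := by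
  have hi := integrableOn_cube hb c l
  have hc : IntegrableOn (fun _ : Rn n => a) (cube c l) :=
    integrableOn_const (by rw [volume_cube]; finiteness)
  have h1 : (avgOn b (cube c l) - a) * l ^ n = ∫ x in cube c l, (b x - a) := by
    rw [integral_sub hi hc, avgOn, setAverage_eq, setIntegral_const, volume_real_cube c hl]
    simp only [smul_eq_mul]
    have : l ^ n ≠ 0 := by positivity
    field_simp
  calc ‖avgOn b (cube c l) - a‖ₑ * ENNReal.ofReal l ^ n
      = ‖(avgOn b (cube c l) - a) * l ^ n‖ₑ := by
        rw [enorm_mul, enorm_pow, Real.enorm_of_nonneg hl.le]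
    _ ≤ _ := by
        rw [h1]
        exact enorm_integral_le_lintegral_enorm _

lemma lintegral_cube_sub_avgOn_le {n : ℕ} {b : Rn n → ℝ} (hb : LocallyIntegrable b volume) {M : ℝ}
    (hM : OscBound b M) (c : Rn n) {l : ℝ} (hl : 0 < l) :
    ∫⁻ x in cube c l, ‖b x - avgOn b (cube c l)‖ₑ ≤ ENNReal.ofReal M * ENNReal.ofReal l ^ n := by
  have hi : IntegrableOn (fun x => b x - avgOn b (cube c l)) (cube c l) :=
    (integrableOn_cube hb c l).sub (integrableOn_const (by rw [volume_cube]; finiteness))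
  have h := hM c l hl
  rw [setAverage_eq, volume_real_cube c hl, smul_eq_mul, inv_mul_le_iff₀ (by positivity)] at h
  rw [← ofReal_integral_norm_eq_lintegral_enorm hi, mul_comm,
    ← ENNReal.ofReal_pow hl.le, ← ENNReal.ofReal_mul (by positivity)]
  exact ENNReal.ofReal_le_ofReal h

lemma abs_avgOn_sub_le {n : ℕ} {b : Rn n → ℝ} (hb : LocallyIntegrable b volume) {M : ℝ}
    (hM0 : 0 ≤ M) (hM : OscBound b M) {c c' : Rn n} {l t : ℝ} (hl : 0 < l) (ht : 0 < t)
    (hsub : cube c' l ⊆ cube c (t * l)) :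
    |avgOn b (cube c' l) - avgOn b (cube c (t * l))| ≤ t ^ n * M := by
  have h := (enorm_avgOn_sub_mul_le hb c' hl (avgOn b (cube c (t * l)))).trans
    ((lintegral_mono_set hsub).trans (lintegral_cube_sub_avgOn_le hb hM c (by positivity)))
  rw [Real.enorm_eq_ofReal_abs, ← ENNReal.ofReal_pow (by positivity),
    ← ENNReal.ofReal_mul (by positivity), ← ENNReal.ofReal_pow (by positivity),
    ← ENNReal.ofReal_mul (by positivity),
    ENNReal.ofReal_le_ofReal_iff (by positivity), mul_pow] at h
  have : 0 < l ^ n := by positivity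
  refine le_of_mul_le_mul_right ?_ this
  linarith

lemma cube_subset_cube {n : ℕ} (c : Rn n) {l l' : ℝ} (h : l ≤ l') : cube c l ⊆ cube c l' :=
  fun _ hy i => (hy i).trans (by linarith)

lemma abs_avgOn_dilate_sub_le {n : ℕ} {b : Rn n → ℝ} (hb : LocallyIntegrable b volume) {M : ℝ}
    (hM0 : 0 ≤ M) (hM : OscBound b M) (c : Rn n) {l : ℝ} (hl : 0 < l) (k : ℕ) :
    |avgOn b (cube c (2 ^ k * l)) - avgOn b (cube c l)| ≤ k * (2 ^ n * M) := by
  induction k with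
  | zero => simp
  | succ k ih =>
    have h := abs_avgOn_sub_le hb hM0 hM (c := c) (c' := c) (l := 2 ^ k * l) (t := 2)
      (by positivity) two_pos (cube_subset_cube c (by
        have : 0 < 2 ^ k * l := by positivity
        linarith))
    have e : 2 * (2 ^ k * l) = 2 ^ (k + 1) * l := by ring
    rw [e, abs_sub_comm] at h
    have := abs_sub_le (avgOn b (cube c (2 ^ (k + 1) * l))) (avgOn b (cube c (2 ^ k * l)))
      (avgOn b (cube c l))
    push_cast
    linarith

lemma volume_dev_le {n : ℕ} {b : Rn n → ℝ} (hb : LocallyIntegrable b volume) {M : ℝ}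
    (hM0 : 0 < M) (hM : OscBound b M) (c : Rn n) {l κ : ℝ} (hl : 0 < l) (hκ : 0 < κ) :
    volume ({x | κ * M < |b x - avgOn b (cube c l)|} ∩ cube c l) ≤
      ENNReal.ofReal l ^ n / ENNReal.ofReal κ := by
  have hm : AEMeasurable (fun x => ‖b x - avgOn b (cube c l)‖ₑ) (volume.restrict (cube c l)) :=
    ((hb.aestronglyMeasurable.aemeasurable.sub_const _).enorm).restrict
  have h := mul_meas_ge_le_lintegral₀ hm (ENNReal.ofReal (κ * M))
  have h2 : volume ({x | κ * M < |b x - avgOn b (cube c l)|} ∩ cube c l) ≤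
      volume.restrict (cube c l)
        {x | ENNReal.ofReal (κ * M) ≤ ‖b x - avgOn b (cube c l)‖ₑ} := by
    refine (measure_mono (inter_subset_inter_left _ fun x hx => ?_)).trans
      (Measure.le_restrict_apply _ _)
    simp only [mem_ofPred_eq] at hx ⊢
    rw [Real.enorm_eq_ofReal_abs]
    exact ENNReal.ofReal_le_ofReal hx.le
  have h3 := h.trans (lintegral_cube_sub_avgOn_le hb hM c hl)
  rw [ENNReal.le_div_iff_mul_le (Or.inl (by positivity)) (Or.inl (by finiteness))]
  refine le_trans (mul_le_mul_left h2 _) ?_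
  generalize volume.restrict (cube c l) _ = v at h3 ⊢
  rw [ENNReal.ofReal_mul hκ.le, mul_comm (ENNReal.ofReal κ), mul_assoc,
    ENNReal.mul_le_mul_iff_right (by positivity) (by finiteness), mul_comm] at h3
  exact h3

/-- The John–Nirenberg inequality. -/
lemma volume_johnNirenberg {n : ℕ} (hn : 1 ≤ n) {b : Rn n → ℝ}
    (hb : LocallyIntegrable b volume) {M : ℝ} (hM0 : 0 < M) (hM : OscBound b M) (j : ℕ) :
    ∀ (c : Rn n) (l : ℝ), 0 < l →
      volume ({x | ((2 ^ (n + 3) + 4) * M) * j ≤ |b x - avgOn b (cube c l)|} ∩ hcube c l) ≤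
        ENNReal.ofReal l ^ n / 2 ^ j := by
  induction j with
  | zero =>
    intro c l hl
    rw [pow_zero, div_one, ← volume_hcube]
    exact measure_mono inter_subset_right
  | succ j ih =>
    intro c l hl
    set E : Set (Rn n) := {x | 2 ^ (n + 3) * M < |b x - avgOn b (cube c l)|} with hE
    have hEv : volume (E ∩ hcube c l) ≤ ENNReal.ofReal l ^ n / 2 ^ (n + 3) := by
      have h := volume_dev_le hb hM0 hM c (κ := 2 ^ (n + 3)) hl (by positivity)
      rw [ENNReal.ofReal_pow (by norm_num), ENNReal.ofReal_ofNat] at h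
      exact (measure_mono (inter_subset_inter_right _ (hcube_subset_cube c l))).trans h
    obtain ⟨ι, _, ctr, s, hs, -, hsum, hcov⟩ := exists_local_stopping hn c hl E hEv
    have havg : ∀ i, |avgOn b (cube (ctr i) (s i)) - avgOn b (cube c l)| ≤
        (2 ^ (n + 3) + 4) * M := by
      intro i
      obtain ⟨hs0, -, -, hsE⟩ := hs i
      have h4 := volume_dev_le hb hM0 hM (ctr i) (κ := 4) hs0 (by norm_num)
      have hpos : (0 : ℝ≥0∞) < ENNReal.ofReal (s i) ^ n := by positivity
      have hfin : ENNReal.ofReal (s i) ^ n ≠ ∞ := by finiteness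
      have hne : ¬ hcube (ctr i) (s i) ⊆ (E ∩ hcube (ctr i) (s i)) ∪
          ({x | 4 * M < |b x - avgOn b (cube (ctr i) (s i))|} ∩ cube (ctr i) (s i)) := by
        intro hsub
        have h := (measure_mono hsub).trans ((measure_union_le _ _).trans (add_le_add hsE h4))
        rw [volume_hcube, ENNReal.ofReal_ofNat] at h
        refine absurd h (not_le.2 ?_)
        calc ENNReal.ofReal (s i) ^ n / 2 + ENNReal.ofReal (s i) ^ n / 4
            < ENNReal.ofReal (s i) ^ n / 2 + ENNReal.ofReal (s i) ^ n / 2 := by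
              refine ENNReal.add_lt_add_left (by finiteness) ?_
              exact ENNReal.div_lt_div_left hpos.ne' hfin (by norm_num)
          _ = _ := ENNReal.add_halves _
      obtain ⟨z, hz, hz'⟩ := Set.not_subset.1 hne
      simp only [mem_union, mem_inter_iff, hE, mem_ofPred_eq, hz, hcube_subset_cube _ _ hz,
        and_true, not_or, not_lt] at hz'
      have := abs_sub_le (avgOn b (cube (ctr i) (s i))) (b z) (avgOn b (cube c l))
      rw [abs_sub_comm (avgOn b (cube (ctr i) (s i))) (b z)] at this
      linarith [hz'.1, hz'.2]
    have hsub : {x | ((2 ^ (n + 3) + 4) * M) * ((j + 1 : ℕ) : ℝ) ≤ |b x - avgOn b (cube c l)|} ∩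
        hcube c l ⊆ ⋃ i, ({x | ((2 ^ (n + 3) + 4) * M) * j ≤
          |b x - avgOn b (cube (ctr i) (s i))|} ∩ hcube (ctr i) (s i)) := by
      rintro x ⟨hx, hxP⟩
      simp only [mem_ofPred_eq] at hx
      push_cast at hx
      have hp : 0 ≤ (2 ^ (n + 3) + 4) * M * (j : ℝ) := by positivity
      obtain ⟨i, hi⟩ := mem_iUnion.1 (hcov ⟨show 2 ^ (n + 3) * M < _ by nlinarith, hxP⟩)
      refine mem_iUnion.2 ⟨i, ?_, hi⟩
      have := abs_sub_le (b x) (avgOn b (cube (ctr i) (s i))) (avgOn b (cube c l))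
      simp only [mem_ofPred_eq]
      linarith [havg i]
    calc _ ≤ ∑' i, ENNReal.ofReal (s i) ^ n / 2 ^ j :=
          (measure_mono hsub).trans ((measure_iUnion_le _).trans
            (ENNReal.tsum_le_tsum fun i => ih _ _ (hs i).1))
      _ = (∑' i, ENNReal.ofReal (s i) ^ n) / 2 ^ j := by
          simp only [div_eq_mul_inv, ENNReal.tsum_mul_right]
      _ ≤ ENNReal.ofReal l ^ n / 2 / 2 ^ j := by gcongr
      _ = _ := by
          rw [pow_succ', div_eq_mul_inv, div_eq_mul_inv, div_eq_mul_inv, mul_assoc,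
            ENNReal.mul_inv (by simp) (by simp)]

lemma pow_le_tsum_indicator {κ : ℝ≥0} (hκ : κ ≠ 0) (p : ℕ) (h : ℝ≥0) :
    (h : ℝ≥0∞) ^ p ≤ ∑' j : ℕ, (κ * (j + 1) : ℝ≥0∞) ^ p * if κ * j ≤ h then 1 else 0 := by
  have hf : (⌊h / κ⌋₊ : ℝ≥0) ≤ h / κ := Nat.floor_le (by positivity)
  have hf2 : h / κ < ⌊h / κ⌋₊ + 1 := Nat.lt_floor_add_one _
  have hk : 0 < κ := pos_iff_ne_zero.2 hκ
  refine le_trans ?_ (ENNReal.le_tsum ⌊h / κ⌋₊)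
  rw [le_div_iff₀ hk, mul_comm] at hf
  rw [div_lt_iff₀ hk, mul_comm] at hf2
  rw [if_pos hf, mul_one]
  gcongr
  exact_mod_cast hf2.le

lemma tsum_pow_div_two_pow_ne_top (p : ℕ) : (∑' j : ℕ, ((j : ℝ≥0∞) + 1) ^ p / 2 ^ j) ≠ ∞ := by
  have h1 : Summable fun j : ℕ => ((j : ℝ) + 1) ^ p * (1 / 2) ^ j := by
    have h := (summable_nat_add_iff 1).2 (summable_pow_mul_geometric_of_norm_lt_one p
      (r := (1 / 2 : ℝ)) (by norm_num))
    refine (h.mul_left 2).congr fun j => ?_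
    push_cast
    rw [pow_succ]
    ring
  have h2 := h1.tsum_ofReal_ne_top
  convert h2 using 3 with j
  rw [ENNReal.ofReal_mul (by positivity), ENNReal.ofReal_pow (by positivity),
    ENNReal.ofReal_add (by positivity) (by norm_num), ENNReal.ofReal_natCast, ENNReal.ofReal_one,
    div_eq_mul_inv, ENNReal.ofReal_pow (by positivity), one_div, ENNReal.ofReal_inv_of_pos two_pos,
    ENNReal.ofReal_ofNat, ENNReal.inv_pow]

lemma lintegral_hcube_osc_pow_le {n : ℕ} (hn : 1 ≤ n) {M : ℝ} (hM0 : 0 < M) (p : ℕ) :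
    ∃ C : ℝ≥0, ∀ b : Rn n → ℝ, LocallyIntegrable b volume → OscBound b M →
      ∀ (c : Rn n) (l : ℝ), 0 < l →
        ∫⁻ x in hcube c l, ‖b x - avgOn b (cube c l)‖ₑ ^ p ≤ C * ENNReal.ofReal l ^ n := by
  set κ : ℝ≥0 := ((2 ^ (n + 3) + 4) * M).toNNReal with hκ
  have hκ0 : κ ≠ 0 := by
    rw [hκ]
    exact (Real.toNNReal_pos.2 (by positivity)).ne'
  have hκr : (κ : ℝ) = (2 ^ (n + 3) + 4) * M := Real.coe_toNNReal _ (by positivity)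
  have hfin : (κ : ℝ≥0∞) ^ p * ∑' j : ℕ, ((j : ℝ≥0∞) + 1) ^ p / 2 ^ j ≠ ∞ :=
    ENNReal.mul_ne_top (by finiteness) (tsum_pow_div_two_pow_ne_top p)
  refine ⟨((κ : ℝ≥0∞) ^ p * ∑' j : ℕ, ((j : ℝ≥0∞) + 1) ^ p / 2 ^ j).toNNReal,
    fun b hb hM c l hl => ?_⟩
  rw [ENNReal.coe_toNNReal hfin]
  have hm : AEMeasurable (fun x => ‖b x - avgOn b (cube c l)‖₊) (volume.restrict (hcube c l)) :=
    ((hb.aestronglyMeasurable.aemeasurable.sub_const _).nnnorm).restrict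
  calc ∫⁻ x in hcube c l, ‖b x - avgOn b (cube c l)‖ₑ ^ p
      ≤ ∫⁻ x in hcube c l, ∑' j : ℕ, (κ * (j + 1) : ℝ≥0∞) ^ p *
          if κ * j ≤ ‖b x - avgOn b (cube c l)‖₊ then 1 else 0 :=
        lintegral_mono fun x => pow_le_tsum_indicator hκ0 p _
    _ = ∑' j : ℕ, (κ * (j + 1) : ℝ≥0∞) ^ p * ∫⁻ x in hcube c l,
          if κ * j ≤ ‖b x - avgOn b (cube c l)‖₊ then 1 else 0 := by
        have hmj : ∀ j : ℕ, AEMeasurable (fun x => if κ * j ≤ ‖b x - avgOn b (cube c l)‖₊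
            then (1 : ℝ≥0∞) else 0) (volume.restrict (hcube c l)) := fun j =>
          (Measurable.ite measurableSet_Ici measurable_const
            measurable_const : Measurable fun t : ℝ≥0 =>
              if κ * j ≤ t then (1 : ℝ≥0∞) else 0).comp_aemeasurable hm
        rw [lintegral_tsum fun j => (hmj j).const_mul _]
        refine tsum_congr fun j => ?_
        rw [lintegral_const_mul'' _ (hmj j)]
    _ ≤ ∑' j : ℕ, (κ * (j + 1) : ℝ≥0∞) ^ p * (ENNReal.ofReal l ^ n / 2 ^ j) := by
        refine ENNReal.tsum_le_tsum fun j => ?_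
        gcongr
        have hms : NullMeasurableSet {x | κ * j ≤ ‖b x - avgOn b (cube c l)‖₊}
            (volume.restrict (hcube c l)) := hm.nullMeasurable measurableSet_Ici
        have e : (fun x => if κ * j ≤ ‖b x - avgOn b (cube c l)‖₊ then (1 : ℝ≥0∞) else 0) =
            Set.indicator {x | κ * j ≤ ‖b x - avgOn b (cube c l)‖₊} 1 := by
          ext x
          simp [Set.indicator]
        rw [e, lintegral_indicator_one₀ hms, Measure.restrict_apply' (measurableSet_hcube _ _)]
        refine le_trans (measure_mono (inter_subset_inter_left _ fun x hx => ?_))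
          (volume_johnNirenberg hn hb hM0 hM j c l hl)
        simp only [mem_ofPred_eq] at hx ⊢
        rw [← hκr, ← Real.norm_eq_abs]
        exact_mod_cast hx
    _ = _ := by
        rw [← ENNReal.tsum_mul_left, ← ENNReal.tsum_mul_right]
        refine tsum_congr fun j => ?_
        rw [mul_pow, div_eq_mul_inv, div_eq_mul_inv]
        ring

lemma cube_ae_eq_hcube {n : ℕ} (c : Rn n) (l : ℝ) : (hcube c l : Set (Rn n)) =ᵐ[volume] cube c l :=
  ae_eq_of_subset_of_measure_ge (hcube_subset_cube c l) (by rw [volume_cube, volume_hcube])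
    (measurableSet_hcube c l).nullMeasurableSet (by rw [volume_cube]; finiteness)

/-- `L^p` form of the John–Nirenberg inequality on dilated cubes. -/
lemma lintegral_cube_osc_pow_le {n : ℕ} (hn : 1 ≤ n) {M : ℝ} (hM0 : 0 < M) (p : ℕ) :
    ∃ C : ℝ≥0, ∀ b : Rn n → ℝ, LocallyIntegrable b volume → OscBound b M →
      ∀ (c : Rn n) (l : ℝ), 0 < l → ∀ k : ℕ,
        ∫⁻ x in cube c (2 ^ k * l), ‖b x - avgOn b (cube c l)‖ₑ ^ p ≤
          C * (1 + k) ^ p * ENNReal.ofReal (2 ^ k * l) ^ n := by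
  obtain ⟨C, hC⟩ := lintegral_hcube_osc_pow_le hn hM0 p
  refine ⟨2 ^ p * (C + (2 ^ n * M).toNNReal ^ p), fun b hb hM c l hl k => ?_⟩
  have h1 := hC b hb hM c (2 ^ k * l) (by positivity)
  rw [setLIntegral_congr (cube_ae_eq_hcube c _)] at h1
  have h2 : ‖avgOn b (cube c (2 ^ k * l)) - avgOn b (cube c l)‖ₑ ≤
      k * ENNReal.ofReal (2 ^ n * M) := by
    rw [Real.enorm_eq_ofReal_abs, ← ENNReal.ofReal_natCast, ← ENNReal.ofReal_mul (by positivity)]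
    exact ENNReal.ofReal_le_ofReal (abs_avgOn_dilate_sub_le hb hM0.le hM c hl k)
  have hadd : ∀ s t : ℝ≥0∞, (s + t) ^ p ≤ 2 ^ p * (s ^ p + t ^ p) := by
    intro s t
    calc (s + t) ^ p ≤ (2 * max s t) ^ p := by
          gcongr
          rw [two_mul]
          exact add_le_add (le_max_left _ _) (le_max_right _ _)
      _ = 2 ^ p * (max s t) ^ p := mul_pow _ _ _
      _ ≤ _ := by
          gcongr
          rcases max_choice s t with h | h <;> rw [h]
          · exact le_self_add
          · exact le_add_self
  calc ∫⁻ x in cube c (2 ^ k * l), ‖b x - avgOn b (cube c l)‖ₑ ^ p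
      ≤ ∫⁻ x in cube c (2 ^ k * l), 2 ^ p * (‖b x - avgOn b (cube c (2 ^ k * l))‖ₑ ^ p +
          (k * ENNReal.ofReal (2 ^ n * M)) ^ p) := by
        refine lintegral_mono fun x => le_trans ?_ (hadd _ _)
        gcongr
        calc ‖b x - avgOn b (cube c l)‖ₑ
            = ‖(b x - avgOn b (cube c (2 ^ k * l))) +
              (avgOn b (cube c (2 ^ k * l)) - avgOn b (cube c l))‖ₑ := by ring_nf
          _ ≤ _ := (enorm_add_le _ _).trans (by gcongr)
    _ = 2 ^ p * ((∫⁻ x in cube c (2 ^ k * l), ‖b x - avgOn b (cube c (2 ^ k * l))‖ₑ ^ p) +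
          (k * ENNReal.ofReal (2 ^ n * M)) ^ p * ENNReal.ofReal (2 ^ k * l) ^ n) := by
        rw [lintegral_const_mul' _ _ (by finiteness), lintegral_add_right _ measurable_const,
          setLIntegral_const, volume_cube]
    _ ≤ 2 ^ p * (C * ENNReal.ofReal (2 ^ k * l) ^ n +
          (k * ENNReal.ofReal (2 ^ n * M)) ^ p * ENNReal.ofReal (2 ^ k * l) ^ n) := by
        gcongr
    _ = 2 ^ p * (C * 1 ^ p + ENNReal.ofReal (2 ^ n * M) ^ p * k ^ p) *
          ENNReal.ofReal (2 ^ k * l) ^ n := by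
        rw [mul_pow, one_pow]
        ring
    _ ≤ 2 ^ p * (C * (1 + k) ^ p + ENNReal.ofReal (2 ^ n * M) ^ p * (1 + k) ^ p) *
          ENNReal.ofReal (2 ^ k * l) ^ n := by
        gcongr
        · exact le_self_add
        · exact le_add_self
    _ = _ := by
        push_cast
        rw [← ENNReal.ofReal]
        ring

/-! ### The modulus of continuity -/

lemma tsum_omega_ne_top {m : ℕ} {ω : ℝ → ℝ} (hm : 1 ≤ m) (hω0 : ∀ t, 0 < t → 0 ≤ ω t)
    (hωmono : ∀ s t : ℝ, 0 < s → s ≤ t → ω s ≤ ω t)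
    (hω_logDini : IntegrableOn
      (fun t => ω t ^ ((1:ℝ)/(2*(m:ℝ))) * (1 + Real.log (1 / t)) / t) (Ioo (0:ℝ) 1))
    {e : ℝ} (he : 1 / (2 * (m : ℝ)) ≤ e) :
    ∑' p : ℕ, (1 + p : ℝ≥0∞) * ENNReal.ofReal (ω ((1 / 2) ^ p) ^ e) ≠ ∞ := by
  have hm0 : (0 : ℝ) < m := by exact_mod_cast hm
  set a : ℝ := 1 / (2 * (m : ℝ)) with ha
  have ha0 : 0 < a := by positivity
  have hfin := Integrable.lintegral_lt_top hω_logDini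
  have hanti : Antitone fun p : ℕ => ((1 : ℝ) / 2) ^ p :=
    pow_right_anti₀ (by norm_num) (by norm_num)
  have hsubs : (⋃ p : ℕ, Ioo ((1 / 2 : ℝ) ^ (p + 1)) ((1 / 2) ^ p)) ⊆ Ioo (0 : ℝ) 1 := by
    refine iUnion_subset fun p t ht => ⟨lt_trans (by positivity) ht.1, ht.2.trans_le ?_⟩
    exact pow_le_one₀ (by norm_num) (by norm_num)
  have hsum := (lintegral_mono_set hsubs).trans_lt hfin
  rw [lintegral_iUnion (s := fun p : ℕ => Ioo ((1 / 2 : ℝ) ^ (p + 1)) ((1 / 2) ^ p))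
    (fun p => measurableSet_Ioo) hanti.pairwise_disjoint_on_Ioo_succ] at hsum
  have hlog2 : (1 / 2 : ℝ) ≤ Real.log 2 := by have := Real.log_two_gt_d9; linarith
  have hterm : ∀ p : ℕ, (1 + (p + 1 : ℕ) : ℝ≥0∞) * ENNReal.ofReal (ω ((1 / 2) ^ (p + 1)) ^ e) ≤
      ENNReal.ofReal (8 * ω 1 ^ (e - a)) * ∫⁻ t in Ioo ((1 / 2 : ℝ) ^ (p + 1)) ((1 / 2) ^ p),
        ENNReal.ofReal (ω t ^ a * (1 + Real.log (1 / t)) / t) := by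
    intro p
    have hp : (0 : ℝ) < (1 / 2) ^ (p + 1) := by positivity
    have hw := hω0 _ hp
    have hlow : ∀ t ∈ Ioo ((1 / 2 : ℝ) ^ (p + 1)) ((1 / 2) ^ p),
        ENNReal.ofReal (ω ((1 / 2) ^ (p + 1)) ^ a * ((p + 2) / 4) * 2 ^ p) ≤
          ENNReal.ofReal (ω t ^ a * (1 + Real.log (1 / t)) / t) := by
      intro t ht
      have ht0 : 0 < t := hp.trans ht.1
      have h2 : (2 : ℝ) ^ p ≤ 1 / t := by
        rw [le_div_iff₀ ht0]
        calc (2 : ℝ) ^ p * t ≤ 2 ^ p * (1 / 2) ^ p := by gcongr; exact ht.2.le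
          _ = 1 := by rw [← mul_pow]; norm_num
      have h3 : (p + 2) / 4 ≤ 1 + Real.log (1 / t) := by
        have := Real.log_le_log (by positivity) h2
        rw [Real.log_pow] at this
        have hp0 : (0 : ℝ) ≤ p := by positivity
        nlinarith
      apply ENNReal.ofReal_le_ofReal
      have h4 := hωmono _ _ hp ht.1.le
      have h5 := hω0 t ht0
      have h6 : 0 ≤ 1 + Real.log (1 / t) := le_trans (by positivity) h3
      rw [div_eq_mul_one_div (_ * (1 + _)) t]
      gcongr
    have hint : ENNReal.ofReal (ω ((1 / 2) ^ (p + 1)) ^ a * ((p + 2) / 4) * 2 ^ p) *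
        ENNReal.ofReal ((1 / 2) ^ (p + 1)) ≤
        ∫⁻ t in Ioo ((1 / 2 : ℝ) ^ (p + 1)) ((1 / 2) ^ p),
          ENNReal.ofReal (ω t ^ a * (1 + Real.log (1 / t)) / t) := by
      calc _ = ∫⁻ _t in Ioo ((1 / 2 : ℝ) ^ (p + 1)) ((1 / 2) ^ p),
            ENNReal.ofReal (ω ((1 / 2) ^ (p + 1)) ^ a * ((p + 2) / 4) * 2 ^ p) := by
            rw [setLIntegral_const, Real.volume_Ioo]
            congr 2
            rw [pow_succ]
            ring
        _ ≤ _ := setLIntegral_mono' measurableSet_Ioo hlow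
    refine le_trans ?_ (mul_le_mul_right hint _)
    have hle1 : ω ((1 / 2) ^ (p + 1)) ≤ ω 1 :=
      hωmono _ _ hp (pow_le_one₀ (by norm_num) (by norm_num))
    have h1 : (0 : ℝ) ≤ ω 1 := hω0 1 one_pos
    rw [← ENNReal.ofReal_mul (by positivity), ← ENNReal.ofReal_mul (by positivity)]
    have e1 : (1 + (p + 1 : ℕ) : ℝ≥0∞) = ENNReal.ofReal (p + 2) := by
      rw [ENNReal.ofReal_add (by positivity) (by norm_num)]
      push_cast
      simp
      ring_nf
    rw [e1, ← ENNReal.ofReal_mul (by positivity)]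
    apply ENNReal.ofReal_le_ofReal
    have e2 : (2 : ℝ) ^ p * (1 / 2) ^ (p + 1) = 1 / 2 := by
      rw [pow_succ, ← mul_assoc, ← mul_pow]
      norm_num
    have e3 : ω ((1 / 2) ^ (p + 1)) ^ e ≤ ω ((1 / 2) ^ (p + 1)) ^ a * ω 1 ^ (e - a) := by
      calc ω ((1 / 2) ^ (p + 1)) ^ e
          = ω ((1 / 2) ^ (p + 1)) ^ a * ω ((1 / 2) ^ (p + 1)) ^ (e - a) := by
            rw [← Real.rpow_add_of_nonneg hw ha0.le (by linarith)]
            ring_nf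
        _ ≤ _ := by
          gcongr
    calc (p + 2 : ℝ) * ω ((1 / 2) ^ (p + 1)) ^ e
        ≤ (p + 2) * (ω ((1 / 2) ^ (p + 1)) ^ a * ω 1 ^ (e - a)) := by gcongr
      _ = 8 * ω 1 ^ (e - a) * (ω ((1 / 2) ^ (p + 1)) ^ a * ((p + 2) / 4) *
            (2 ^ p * (1 / 2) ^ (p + 1))) := by rw [e2]; ring
      _ = _ := by ring
  rw [tsum_eq_zero_add' ENNReal.summable]
  refine ENNReal.add_ne_top.2 ⟨by finiteness, ?_⟩
  refine ne_top_of_le_ne_top ?_ (ENNReal.tsum_le_tsum hterm)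
  rw [ENNReal.tsum_mul_left]
  exact ENNReal.mul_ne_top (by finiteness) hsum.ne

/-! ### Multilinear Calderón–Zygmund operators -/

/-- The hypotheses on a multilinear Calderón–Zygmund operator, with a common constant `A`. -/
structure CZ {n m : ℕ} (A : ℝ) (ω : ℝ → ℝ) (K : Rn n → (Fin m → Rn n) → ℝ)
    (T : (Fin m → Rn n → ℝ) → Rn n → ℝ) : Prop where
  dim_pos : 1 ≤ n
  arity_pos : 1 ≤ m
  nonneg : ∀ t, 0 < t → 0 ≤ ω t
  mono : ∀ s t : ℝ, 0 < s → s ≤ t → ω s ≤ ω t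
  dini : ∑' p : ℕ, ENNReal.ofReal (ω ((1 / 2) ^ p)) ≠ ∞
  pos : 0 < A
  ker : IsCZKernelM A ω K
  meas : ∀ f : Fin m → Rn n → ℝ, (∀ j, Integrable (f j)) → Measurable (T f)
  lin : MultilinM T
  rep : KernelRepM K T
  weak : ∀ f : Fin m → Rn n → ℝ, (∀ j, Integrable (f j)) → ∀ lam : ℝ, 0 < lam →
    volume {x | lam < |T f x|} ≤
      ENNReal.ofReal ((A * (∏ j, l1norm (f j)) / lam) ^ ((1:ℝ)/(m:ℝ)))

/-- The submodule of integrable functions. -/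
def integrableSub (n : ℕ) : Submodule ℝ (Rn n → ℝ) where
  carrier := {f | Integrable f}
  add_mem' hf hg := Integrable.add (mem_ofPred_eq ▸ hf) (mem_ofPred_eq ▸ hg)
  zero_mem' := integrable_zero _ _ _
  smul_mem' c _ hf := Integrable.smul c (mem_ofPred_eq ▸ hf)

/-- A multilinear operator evaluated at a point, as a `MultilinearMap`. -/
def evalML {n m : ℕ} {T : (Fin m → Rn n → ℝ) → Rn n → ℝ} (hT : MultilinM T) (x : Rn n) :
    MultilinearMap ℝ (fun _ : Fin m => integrableSub n) ℝ where
  toFun F := T (fun j => (F j).1) x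
  map_update_add' := by
    intro _ F j g g'
    have key : ∀ h : integrableSub n, (fun k => (Function.update F j h k).1) =
        Function.update (fun k => (F k).1) j h.1 := by
      intro h
      ext k
      by_cases hk : k = j
      · subst hk; simp
      · simp [hk]
    rw [key, key, key]
    change T (Function.update (fun k => (F k).1) j (fun y => g.1 y + g'.1 y)) x = _
    convert hT.1 (fun k => (F k).1) j g.1 g'.1 (fun k => (F k).2) g.2 g'.2 x
  map_update_smul' := by
    intro _ F j r g
    have key : ∀ h : integrableSub n, (fun k => (Function.update F j h k).1) =
        Function.update (fun k => (F k).1) j h.1 := by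
      intro h
      ext k
      by_cases hk : k = j
      · subst hk; simp
      · simp [hk]
    rw [key, key]
    change T (Function.update (fun k => (F k).1) j (fun y => r * g.1 y)) x = r * _
    convert hT.2 (fun k => (F k).1) j r g.1 (fun k => (F k).2) g.2 x

lemma MultilinM.add_univ {n m : ℕ} {T : (Fin m → Rn n → ℝ) → Rn n → ℝ} (hT : MultilinM T)
    {p q : Fin m → Rn n → ℝ} (hp : ∀ j, Integrable (p j)) (hq : ∀ j, Integrable (q j))
    (x : Rn n) :
    T (fun j y => p j y + q j y) x =
      ∑ S : Finset (Fin m), T (fun j => if j ∈ S then p j else q j) x := by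
  have h := (evalML hT x).map_add_univ (fun j => ⟨p j, hp j⟩) (fun j => ⟨q j, hq j⟩)
  refine h.trans (Finset.sum_congr rfl fun S _ => ?_)
  simp only [evalML, MultilinearMap.coe_mk]
  congr 1
  ext j
  by_cases hj : j ∈ S <;> simp [hj]

lemma MultilinM.sum {n m : ℕ} {T : (Fin m → Rn n → ℝ) → Rn n → ℝ} (hT : MultilinM T)
    {κ : Fin m → Type*} (s : ∀ j, Finset (κ j)) {g : ∀ j, κ j → Rn n → ℝ}
    (hg : ∀ j i, Integrable (g j i)) (x : Rn n) :
    T (fun j y => ∑ i ∈ s j, g j i y) x =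
      ∑ σ ∈ Fintype.piFinset s, T (fun j => g j (σ j)) x := by
  have h := (evalML hT x).map_sum_finset (fun j i => ⟨g j i, hg j i⟩) s
  refine Eq.trans ?_ h
  simp only [evalML, MultilinearMap.coe_mk]
  congr 1
  ext j y
  simp

lemma MultilinM.smul_univ {n m : ℕ} {T : (Fin m → Rn n → ℝ) → Rn n → ℝ} (hT : MultilinM T)
    (c : Fin m → ℝ) {p : Fin m → Rn n → ℝ} (hp : ∀ j, Integrable (p j)) (x : Rn n) :
    T (fun j y => c j * p j y) x = (∏ j, c j) * T p x :=
  (evalML hT x).map_smul_univ c (fun j => ⟨p j, hp j⟩)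

lemma MultilinM.update_sub {n m : ℕ} {T : (Fin m → Rn n → ℝ) → Rn n → ℝ} (hT : MultilinM T)
    {p q : Fin m → Rn n → ℝ} (hp : ∀ j, Integrable (p j)) (hq : ∀ j, Integrable (q j)) (i : Fin m)
    (hpq : ∀ j, j ≠ i → p j = q j) (x : Rn n) :
    T p x - T q x = T (Function.update p i (fun y => p i y - q i y)) x := by
  have h := (evalML hT x).map_update_sub (fun j => ⟨p j, hp j⟩) i ⟨p i, hp i⟩ ⟨q i, hq i⟩
  simp only [evalML, MultilinearMap.coe_mk] at h
  convert h.symm using 2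
  · congr 1
    ext j y
    by_cases hj : j = i
    · subst hj; simp
    · simp [hj]
  · congr 1
    ext j y
    by_cases hj : j = i
    · subst hj; simp
    · simp [hj, hpq j hj]
  · ext j y
    by_cases hj : j = i
    · subst hj; simp
    · simp [hj]

/-- The iterated commutator as a value of `T` with arguments depending on the point. -/
lemma iterComm_eq {n m : ℕ} {T : (Fin m → Rn n → ℝ) → Rn n → ℝ} (hT : MultilinM T)
    {b f : Fin m → Rn n → ℝ} (hf : ∀ j, Integrable (f j))
    (hbf : ∀ j, Integrable (fun y => b j y * f j y)) (x : Rn n) :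
    iterComm T b f x = T (fun j y => b j x * f j y - b j y * f j y) x := by
  have h := hT.add_univ (p := fun j y => (-1) * (b j y * f j y)) (q := fun j y => b j x * f j y)
    (fun j => (hbf j).const_mul _) (fun j => (hf j).const_mul _) x
  have e : (fun (j : Fin m) (y : Rn n) => b j x * f j y - b j y * f j y) =
      fun j y => (-1) * (b j y * f j y) + b j x * f j y := by
    ext j y
    ring
  rw [e, h, iterComm]
  refine Finset.sum_congr rfl fun S _ => ?_
  have h2 := hT.smul_univ (fun j => if j ∈ S then (-1) else b j x)
    (p := fun j => if j ∈ S then (fun y => b j y * f j y) else f j)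
    (fun j => by by_cases hj : j ∈ S <;> simp only [hj, if_true, if_false, hf, hbf]) x
  have e2 : (∏ j, if j ∈ S then (-1 : ℝ) else b j x) = (-1) ^ S.card * ∏ j ∈ Sᶜ, b j x := by
    rw [Finset.prod_ite]
    simp [Finset.filter_not, Finset.compl_eq_univ_sdiff]
  rw [← e2, ← h2]
  congr 1
  ext j y
  by_cases hj : j ∈ S <;> simp [hj]

/-! ### Kernel estimates -/

lemma CZ.exists_omega_le {n m : ℕ} {A : ℝ} {ω : ℝ → ℝ} {K : Rn n → (Fin m → Rn n) → ℝ}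
    {T : (Fin m → Rn n → ℝ) → Rn n → ℝ} (h : CZ A ω K T) {ε : ℝ} (hε : 0 < ε) :
    ∃ t, 0 < t ∧ ω t ≤ ε := by
  have h1 := ENNReal.tendsto_atTop_zero_of_tsum_ne_top h.dini
  obtain ⟨p, hp⟩ := (h1.eventually (gt_mem_nhds (ENNReal.ofReal_pos.2 hε))).exists
  exact ⟨_, by positivity, ((ENNReal.ofReal_lt_ofReal_iff hε).1 hp).le⟩

lemma norm_le_sum_norm {n m : ℕ} (x : Rn n) (y : Fin m → Rn n) (j : Fin m) :
    ‖x - y j‖ ≤ ∑ i, ‖x - y i‖ :=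
  Finset.single_le_sum (f := fun i => ‖x - y i‖) (fun _ _ => norm_nonneg _) (Finset.mem_univ j)

lemma CZ.continuousOn_ker {n m : ℕ} {A : ℝ} {ω : ℝ → ℝ} {K : Rn n → (Fin m → Rn n) → ℝ}
    {T : (Fin m → Rn n → ℝ) → Rn n → ℝ} (h : CZ A ω K T) (x : Rn n) :
    ContinuousOn (K x) {fun _ => x}ᶜ := by
  intro y₀ hy₀
  apply ContinuousAt.continuousWithinAt
  obtain ⟨j₀, hj₀⟩ : ∃ j, y₀ j ≠ x := by
    by_contra hc
    push Not at hc
    exact hy₀ (funext hc)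
  set d := ‖x - y₀ j₀‖ with hd
  have hd0 : 0 < d := norm_pos_iff.2 (sub_ne_zero.2 (Ne.symm hj₀))
  have hA := h.pos
  have key : ∀ s : Finset (Fin m),
      Tendsto (fun y : Fin m → Rn n => K x (s.piecewise y y₀)) (𝓝 y₀) (𝓝 (K x y₀)) := by
    intro s
    induction s using Finset.induction_on with
    | empty => simp
    | insert i s hi ih =>
      suffices hs : Tendsto (fun y : Fin m → Rn n => K x (s.piecewise y y₀) -
          K x ((insert i s).piecewise y y₀)) (𝓝 y₀) (𝓝 0) by
        simpa using ih.sub hs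
      rw [Metric.tendsto_nhds_nhds]
      intro ε hε
      obtain ⟨t, ht0, ht⟩ := h.exists_omega_le
        (show 0 < ε * (d / 2) ^ (m * n) / (2 * A) by positivity)
      refine ⟨min (d / 4) (t * (d / 2)), by positivity, fun y hy => ?_⟩
      rw [lt_min_iff] at hy
      have hyj : ∀ j, ‖y j - y₀ j‖ ≤ dist y y₀ := fun j => by
        rw [← dist_eq_norm]; exact dist_le_pi_dist y y₀ j
      set u := s.piecewise y y₀ with hu
      have huj : ‖u j₀ - y₀ j₀‖ < d / 4 := by
        by_cases hj : j₀ ∈ s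
        · simp only [hu, hj, Finset.piecewise_eq_of_mem]
          exact (hyj j₀).trans_lt hy.1
        · simp only [hu, hj, not_false_eq_true, Finset.piecewise_eq_of_notMem, sub_self, norm_zero]
          positivity
      have hxu : d / 2 ≤ ‖x - u j₀‖ := by
        have : ‖x - y₀ j₀‖ ≤ ‖x - u j₀‖ + ‖u j₀ - y₀ j₀‖ := norm_sub_le_norm_sub_add_norm_sub _ _ _
        linarith
      have hui : u i = y₀ i := by simp [hu, hi]
      have hδ : ‖u i - y i‖ ≤ dist y y₀ := by rw [hui, norm_sub_rev]; exact hyj i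
      have hS : d / 2 ≤ ∑ j, ‖x - u j‖ := hxu.trans (norm_le_sum_norm x u j₀)
      rw [Finset.piecewise_insert, ← hu, dist_zero_right, Real.norm_eq_abs]
      rcases eq_or_ne (u i) (y i) with he | he
      · rw [← he, Function.update_eq_self]
        simpa using hε
      have hpos : 0 < ‖u i - y i‖ := norm_pos_iff.2 (sub_ne_zero.2 he)
      have h3 := h.ker.2.2 x u i (y i)
        (fun hall => by
          have := hall j₀
          rw [this, sub_self, norm_zero] at hxu
          linarith) ⟨j₀, by linarith⟩
      calc _ ≤ _ := h3
        _ ≤ A / (d / 2) ^ (m * n) * (ε * (d / 2) ^ (m * n) / (2 * A)) := by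
          have hr : ω (‖u i - y i‖ / ∑ j, ‖x - u j‖) ≤ ω t := by
            apply h.mono _ _ (div_pos hpos (by linarith))
            rw [div_le_iff₀ (by linarith)]
            calc ‖u i - y i‖ ≤ t * (d / 2) := by linarith
              _ ≤ _ := by gcongr
          have hr0 := h.nonneg _ (div_pos hpos (show 0 < ∑ j, ‖x - u j‖ by linarith))
          gcongr
          exact hr.trans ht
        _ = ε / 2 := by field_simp
        _ < ε := by linarith
  simpa [ContinuousAt] using key Finset.univ

lemma CZ.aestronglyMeasurable_ker {n m : ℕ} {A : ℝ} {ω : ℝ → ℝ} {K : Rn n → (Fin m → Rn n) → ℝ}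
    {T : (Fin m → Rn n → ℝ) → Rn n → ℝ} (h : CZ A ω K T) (x : Rn n) :
    AEStronglyMeasurable (K x) (volume : Measure (Fin m → Rn n)) := by
  have : Nonempty (Fin n) := ⟨⟨0, h.dim_pos⟩⟩
  have : Nonempty (Fin m) := ⟨⟨0, h.arity_pos⟩⟩
  have h1 := (h.continuousOn_ker x).aestronglyMeasurable (μ := (volume : Measure (Fin m → Rn n)))
    (measurableSet_singleton _).compl
  rwa [Measure.restrict_eq_self_of_ae_mem] at h1
  refine compl_mem_ae_iff.2 ?_
  rw [← Set.univ_pi_singleton, volume_pi_pi]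
  refine Finset.prod_eq_zero (Finset.mem_univ (Classical.arbitrary (Fin m))) ?_
  rw [← closedBall_zero, volume_closedBall_Rn x le_rfl, ENNReal.ofReal_zero,
    zero_pow (by have := h.dim_pos; omega), zero_mul]

lemma lintegral_enorm_prod {n m : ℕ} {g : Fin m → Rn n → ℝ} (hg : ∀ j, Integrable (g j)) :
    ∫⁻ y : Fin m → Rn n, ‖∏ j, g j (y j)‖ₑ = ∏ j, ∫⁻ y, ‖g j y‖ₑ := by
  have h1 : Integrable fun y : Fin m → Rn n => ∏ j, g j (y j) :=
    Integrable.fintype_prod hg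
  rw [← ofReal_integral_norm_eq_lintegral_enorm h1]
  simp only [norm_prod]
  rw [integral_fintype_prod_volume_eq_prod (fun j y => ‖g j y‖),
    ENNReal.ofReal_prod_of_nonneg fun j _ => integral_nonneg fun _ => norm_nonneg _]
  exact Finset.prod_congr rfl fun j _ => ofReal_integral_norm_eq_lintegral_enorm (hg j)

/-- Decomposition into dyadic shells. -/
lemma lintegral_shell_le {n m : ℕ} {g : Fin m → Rn n → ℝ} (hg : ∀ j, Integrable (g j))
    (x : Rn n) {L : ℝ} (hL : 0 < L) (Φ : ℝ → ℝ≥0∞) (hΦ : ∀ s t, L ≤ s → s ≤ t → Φ t ≤ Φ s) :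
    ∫⁻ y in {y : Fin m → Rn n | L ≤ ∑ j, ‖x - y j‖}, Φ (∑ j, ‖x - y j‖) * ‖∏ j, g j (y j)‖ₑ ≤
      ∑' p : ℕ, Φ (2 ^ p * L) * ∏ j, ∫⁻ y in closedBall x (2 ^ (p + 1) * L), ‖g j y‖ₑ := by
  set B : ℕ → Set (Rn n) := fun p => closedBall x (2 ^ (p + 1) * L) with hB
  have hind : ∀ p j, Integrable ((B p).indicator (g j)) := fun p j =>
    (hg j).indicator measurableSet_closedBall
  have hrw : ∀ p : ℕ, Φ (2 ^ p * L) * ∏ j, ∫⁻ y in B p, ‖g j y‖ₑ =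
      ∫⁻ y : Fin m → Rn n, Φ (2 ^ p * L) * ‖∏ j, (B p).indicator (g j) (y j)‖ₑ := by
    intro p
    rw [lintegral_const_mul'', lintegral_enorm_prod (hind p)]
    · congr 2
      ext j
      rw [← lintegral_indicator measurableSet_closedBall]
      congr 1
      ext y
      rw [enorm_indicator_eq_indicator_enorm]
    · exact (Integrable.fintype_prod (hind p)).aestronglyMeasurable.enorm
  change _ ≤ ∑' p : ℕ, Φ (2 ^ p * L) * ∏ j, ∫⁻ y in B p, ‖g j y‖ₑ
  simp_rw [hrw]
  rw [← lintegral_tsum]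
  · have hms : MeasurableSet {y : Fin m → Rn n | L ≤ ∑ j, ‖x - y j‖} :=
      measurableSet_le measurable_const
        (by fun_prop)
    rw [← lintegral_indicator hms]
    refine lintegral_mono fun y => ?_
    by_cases hy : L ≤ ∑ j, ‖x - y j‖
    · rw [indicator_of_mem (show y ∈ {y : Fin m → Rn n | L ≤ ∑ j, ‖x - y j‖} from hy)]
      obtain ⟨p, hp1, hp2⟩ := exists_nat_pow_near (x := (∑ j, ‖x - y j‖) / L) (y := 2)
        ((one_le_div hL).2 hy) one_lt_two
      rw [le_div_iff₀ hL] at hp1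
      rw [div_lt_iff₀ hL] at hp2
      refine le_trans ?_ (ENNReal.le_tsum p)
      have hmem : ∀ j, y j ∈ B p := fun j => by
        rw [hB, mem_closedBall, dist_comm, dist_eq_norm]
        exact (norm_le_sum_norm x y j).trans hp2.le
      simp only [indicator_of_mem (hmem _)]
      gcongr
      exact hΦ _ _ (by nlinarith [one_le_pow₀ (M₀ := ℝ) (one_le_two) (n := p)]) hp1
    · rw [indicator_of_notMem (show y ∉ {y : Fin m → Rn n | L ≤ ∑ j, ‖x - y j‖} from hy)]
      exact zero_le
  · intro p
    exact (Integrable.fintype_prod (hind p)).aestronglyMeasurable.enorm.const_mul _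

/-! ### Localisation of multilinear operators -/

section CZ

variable {n m : ℕ} {A : ℝ} {ω : ℝ → ℝ} {K : Rn n → (Fin m → Rn n) → ℝ}
  {T : (Fin m → Rn n → ℝ) → Rn n → ℝ}

lemma CZ.volume_lt_abs_le (h : CZ A ω K T) {f : Fin m → Rn n → ℝ} (hf : ∀ j, Integrable (f j))
    {V Γ q : ℝ} (hV : 0 ≤ V) (hΓ : 0 < Γ) (hq : 0 < q)
    (hfV : ∀ j, ∫⁻ y, ‖f j y‖ₑ ≤ ENNReal.ofReal (Γ * V)) :
    volume {x | (q * Γ) ^ m * A < |T f x|} ≤ ENNReal.ofReal (V / q) := by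
  have hA := h.pos
  have hm : (m : ℝ) ≠ 0 := by have := h.arity_pos; positivity
  refine (h.weak f hf _ (by positivity)).trans (ENNReal.ofReal_le_ofReal ?_)
  have h1 : ∀ j, l1norm (f j) ≤ Γ * V := fun j => by
    have := hfV j
    rw [← ofReal_integral_norm_eq_lintegral_enorm (hf j),
      ENNReal.ofReal_le_ofReal_iff (by positivity)] at this
    exact this
  have h0 : ∀ j, 0 ≤ l1norm (f j) := fun j => integral_nonneg fun _ => abs_nonneg _
  have h2 : ∏ j, l1norm (f j) ≤ (Γ * V) ^ m := by
    calc ∏ j, l1norm (f j) ≤ ∏ _j : Fin m, (Γ * V) :=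
          Finset.prod_le_prod (fun j _ => h0 j) fun j _ => h1 j
      _ = _ := by simp
  have h3 : 0 ≤ ∏ j, l1norm (f j) := Finset.prod_nonneg fun j _ => h0 j
  calc (A * (∏ j, l1norm (f j)) / ((q * Γ) ^ m * A)) ^ ((1:ℝ)/(m:ℝ))
      ≤ ((V / q) ^ m) ^ ((1:ℝ)/(m:ℝ)) := by
        gcongr
        rw [div_le_iff₀ (by positivity)]
        calc A * ∏ j, l1norm (f j) ≤ A * (Γ * V) ^ m := by gcongr
          _ = _ := by rw [div_pow, mul_pow, mul_pow]; field_simp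
    _ = V / q := by
        rw [← Real.rpow_natCast, ← Real.rpow_mul (by positivity), mul_one_div_cancel hm,
          Real.rpow_one]

lemma CZ.abs_ker_le (h : CZ A ω K T) {x : Rn n} {y : Fin m → Rn n} {d : ℝ} (hd : 0 < d)
    {j : Fin m} (hj : d ≤ ‖x - y j‖) : |K x y| ≤ A / d ^ (m * n) := by
  have hA := h.pos
  refine (h.ker.1 x y fun hall => ?_).trans ?_
  · rw [hall j, sub_self, norm_zero] at hj
    linarith
  · have := hj.trans (norm_le_sum_norm x y j)
    gcongr

lemma CZ.integrable_ker_mul (h : CZ A ω K T) {g : Fin m → Rn n → ℝ} (hg : ∀ j, Integrable (g j))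
    {x : Rn n} {d : ℝ} (hd : 0 < d) {j : Fin m} (hj : ∀ y, g j y ≠ 0 → d ≤ ‖x - y‖) :
    Integrable fun y : Fin m → Rn n => K x y * ∏ j, g j (y j) := by
  have h1 : Integrable fun y : Fin m → Rn n => ∏ j, g j (y j) := Integrable.fintype_prod hg
  refine (h1.norm.const_mul (A / d ^ (m * n))).mono'
    ((h.aestronglyMeasurable_ker x).mul h1.aestronglyMeasurable) (Eventually.of_forall fun y => ?_)
  rw [norm_mul]
  by_cases hy : g j (y j) = 0
  · rw [Finset.prod_eq_zero (Finset.mem_univ j) hy]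
    simp
  · gcongr
    exact h.abs_ker_le hd (hj _ hy)

set_option maxHeartbeats 1000000 in
lemma CZ.enorm_integral_ker_sub_le (h : CZ A ω K T) {g : Fin m → Rn n → ℝ}
    (hg : ∀ j, Integrable (g j)) {x z : Rn n} {L : ℝ} (hL : 0 < L) (hxz : ‖z - x‖ ≤ L / 2)
    {j : Fin m} (hj : ∀ y, g j y ≠ 0 → L ≤ ‖z - y‖) {Y : ℝ≥0∞}
    (hY : ∀ j, ∀ R > 0, ∫⁻ y in closedBall z R, ‖g j y‖ₑ ≤ Y * ENNReal.ofReal R ^ n) :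
    ‖(∫ y : Fin m → Rn n, K z y * ∏ j, g j (y j)) - ∫ y : Fin m → Rn n, K x y * ∏ j, g j (y j)‖ₑ ≤
      ENNReal.ofReal A * (2 ^ n * Y) ^ m * ∑' p : ℕ, ENNReal.ofReal (ω ((1 / 2) ^ p)) := by
  have hA := h.pos
  have hj' : ∀ y, g j y ≠ 0 → L / 2 ≤ ‖x - y‖ := fun y hy => by
    have h1 := hj y hy
    have h2 := norm_sub_le_norm_sub_add_norm_sub z x y
    linarith
  rw [← integral_sub (h.integrable_ker_mul hg hL hj)
    (h.integrable_ker_mul hg (half_pos hL) hj')]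
  refine (enorm_integral_le_lintegral_enorm _).trans ?_
  set Φ : ℝ → ℝ≥0∞ := fun s => ENNReal.ofReal (A / s ^ (m * n) * ω (L / 2 / s)) with hΦ
  have hms : MeasurableSet {y : Fin m → Rn n | L ≤ ∑ j, ‖z - y j‖} :=
    measurableSet_le measurable_const (by fun_prop)
  calc ∫⁻ y : Fin m → Rn n, ‖K z y * ∏ j, g j (y j) - K x y * ∏ j, g j (y j)‖ₑ
      ≤ ∫⁻ y in {y : Fin m → Rn n | L ≤ ∑ j, ‖z - y j‖},
          Φ (∑ j, ‖z - y j‖) * ‖∏ j, g j (y j)‖ₑ := by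
        rw [← lintegral_indicator hms]
        refine lintegral_mono fun y => ?_
        by_cases hy : g j (y j) = 0
        · have h0 : ∏ i, g i (y i) = 0 := Finset.prod_eq_zero (Finset.mem_univ j) hy
          have h1 : ‖K z y * ∏ i, g i (y i) - K x y * ∏ i, g i (y i)‖ₑ = 0 := by
            rw [h0, mul_zero, mul_zero, sub_self, enorm_zero]
          exact h1.le.trans zero_le
        have hLz := hj _ hy
        have hLS := hLz.trans (norm_le_sum_norm z y j)
        rw [indicator_of_mem (show y ∈ {y : Fin m → Rn n | L ≤ ∑ j, ‖z - y j‖} from hLS),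
          ← sub_mul, enorm_mul]
        gcongr
        rw [Real.enorm_eq_ofReal_abs]
        refine ENNReal.ofReal_le_ofReal (q := A / (∑ j, ‖z - y j‖) ^ (m * n) *
          ω (L / 2 / ∑ j, ‖z - y j‖)) ?_
        have hS : 0 < ∑ j, ‖z - y j‖ := hL.trans_le hLS
        have hLS0 : 0 < L / 2 / ∑ j, ‖z - y j‖ := div_pos (half_pos hL) hS
        rcases eq_or_ne z x with hzx | hzx
        · rw [hzx, sub_self, abs_zero, ← hzx]
          exact mul_nonneg (div_nonneg hA.le (pow_nonneg hS.le _)) (h.nonneg _ hLS0)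
        · have hpos : 0 < ‖z - x‖ := norm_pos_iff.2 (sub_ne_zero.2 hzx)
          refine (h.ker.2.1 z x y (fun hall => ?_) ⟨j, by linarith⟩).trans ?_
          · rw [hall j, sub_self, norm_zero] at hLz
            linarith
          · exact mul_le_mul_of_nonneg_left (h.mono _ _ (div_pos hpos hS)
              (div_le_div_of_nonneg_right hxz hS.le)) (div_nonneg hA.le (pow_nonneg hS.le _))
    _ ≤ ∑' p : ℕ, Φ (2 ^ p * L) * ∏ j, ∫⁻ y in closedBall z (2 ^ (p + 1) * L), ‖g j y‖ₑ := by
        refine lintegral_shell_le hg z hL Φ fun s t hs hst => ENNReal.ofReal_le_ofReal ?_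
        have hs0 : 0 < s := hL.trans_le hs
        have ht0 : 0 < t := hs0.trans_le hst
        have h1 : ω (L / 2 / t) ≤ ω (L / 2 / s) := h.mono _ _ (by positivity) (by gcongr)
        have h2 := h.nonneg (L / 2 / t) (by positivity)
        gcongr
    _ ≤ ∑' p : ℕ, ENNReal.ofReal A * (2 ^ n * Y) ^ m * ENNReal.ofReal (ω ((1 / 2) ^ p)) := by
        refine ENNReal.tsum_le_tsum fun p => ?_
        have hpL : 0 < 2 ^ p * L := by positivity
        have e1 : L / 2 / (2 ^ p * L) = (1 / 2) ^ (p + 1) := by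
          rw [pow_succ, one_div, inv_pow]
          field_simp
        have h1 : ω ((1 / 2) ^ (p + 1)) ≤ ω ((1 / 2) ^ p) := h.mono _ _ (by positivity)
          (pow_le_pow_of_le_one (by norm_num) (by norm_num) (by omega))
        calc Φ (2 ^ p * L) * ∏ j, ∫⁻ y in closedBall z (2 ^ (p + 1) * L), ‖g j y‖ₑ
            ≤ (ENNReal.ofReal (A / (2 ^ p * L) ^ (m * n)) * ENNReal.ofReal (ω ((1 / 2) ^ p))) *
              ∏ _j : Fin m, (Y * ENNReal.ofReal (2 ^ (p + 1) * L) ^ n) := by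
              gcongr
              · rw [← ENNReal.ofReal_mul (by positivity), hΦ]
                apply ENNReal.ofReal_le_ofReal
                simp only [e1]
                gcongr
              · exact hY _ _ (by positivity)
          _ = ENNReal.ofReal A * (2 ^ n * Y) ^ m * ENNReal.ofReal (ω ((1 / 2) ^ p)) *
              ((ENNReal.ofReal (2 ^ p * L) ^ (m * n))⁻¹ *
                ENNReal.ofReal (2 ^ p * L) ^ (m * n)) := by
              rw [ENNReal.ofReal_div_of_pos (by positivity), ENNReal.ofReal_pow hpL.le,
                Finset.prod_const, Finset.card_univ, Fintype.card_fin, div_eq_mul_inv]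
              have e2 : ENNReal.ofReal (2 ^ (p + 1) * L) = 2 * ENNReal.ofReal (2 ^ p * L) := by
                rw [← ENNReal.ofReal_ofNat, ← ENNReal.ofReal_mul (by norm_num)]
                congr 1
                ring
              rw [e2, mul_pow, mul_pow, mul_pow, mul_pow, ← pow_mul, ← pow_mul, mul_comm n m]
              ring
          _ = _ := by
              rw [ENNReal.inv_mul_cancel (by positivity) (by finiteness), mul_one]
    _ = _ := ENNReal.tsum_mul_left

end CZ

section CZ

variable {n m : ℕ} {A : ℝ} {ω : ℝ → ℝ} {K : Rn n → (Fin m → Rn n) → ℝ}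
  {T : (Fin m → Rn n → ℝ) → Rn n → ℝ}

lemma ctr_mem_closedBall_of_mem_hcube {c x : Rn n} {s : ℝ} (hs : 0 < s) (hx : x ∈ hcube c s) :
    ‖x - c‖ ≤ n * s :=
  norm_sub_le_of_mem_hcube hx (ctr_mem_hcube c hs)

/-- On a cube the operator differs from its localisation by a bounded function, as soon as it is
controlled off a set of small density. -/
lemma CZ.ae_abs_sub_le_on_hcube (h : CZ A ω K T) {c : Rn n} {s : ℝ} (hs : 0 < s)
    {v : Fin m → Rn n → ℝ} (hv : ∀ j, Integrable (v j)) (hvc : ∀ j, HasCompactSupport (v j))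
    {E : Set (Rn n)} (hE : volume (E ∩ hcube c s) ≤ ENNReal.ofReal s ^ n / 2) {a Y : ℝ}
    (hY : 0 < Y) (hEa : ∀ x, x ∉ E → |T v x| ≤ a)
    (hEY : ∀ x, x ∉ E → ∀ j, ∀ R > 0,
      ∫⁻ y in closedBall x R, ‖v j y‖ₑ ≤ ENNReal.ofReal Y * ENNReal.ofReal R ^ n) :
    ∀ᵐ x, x ∈ hcube c s →
      |T v x - T (fun j => (closedBall c (4 * n * s)).indicator (v j)) x| ≤
        a + (4 * (Y * (5 * n) ^ n)) ^ m * A +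
          2 ^ m * (A * (2 ^ n * Y) ^ m * (∑' p : ℕ, ENNReal.ofReal (ω ((1 / 2) ^ p))).toReal) := by
  classical
  have hA := h.pos
  have hn : 1 ≤ n := h.dim_pos
  have hn1 : (1 : ℝ) ≤ n := by exact_mod_cast hn
  set σ := ∑' p : ℕ, ENNReal.ofReal (ω ((1 / 2) ^ p)) with hσ
  have hσt : σ ≠ ∞ := h.dini
  set B := closedBall c (4 * n * s) with hB
  have hBm : MeasurableSet B := measurableSet_closedBall
  set u : Fin m → Rn n → ℝ := fun j => B.indicator (v j) with hu
  set w : Fin m → Rn n → ℝ := fun j => Bᶜ.indicator (v j) with hw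
  have hui : ∀ j, Integrable (u j) := fun j => (hv j).indicator hBm
  have hwi : ∀ j, Integrable (w j) := fun j => (hv j).indicator hBm.compl
  set mix : Finset (Fin m) → Fin m → Rn n → ℝ := fun S j => if j ∈ S then u j else w j with hmix
  have hmi : ∀ S j, Integrable (mix S j) := fun S j => by
    simp only [hmix]; split_ifs
    exacts [hui j, hwi j]
  have hmc : ∀ S j, HasCompactSupport (mix S j) := fun S j => by
    refine (hvc j).mono fun y hy => ?_
    simp only [hmix] at hy
    split_ifs at hy
    exacts [(indicator_apply_ne_zero.1 hy).2, (indicator_apply_ne_zero.1 hy).2]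
  have hmle : ∀ S j y, ‖mix S j y‖ₑ ≤ ‖v j y‖ₑ := fun S j y => by
    simp only [hmix]; split_ifs
    exacts [enorm_indicator_le_enorm_self _ _, enorm_indicator_le_enorm_self _ _]
  have hdec : ∀ x, T v x - T u x = ∑ S ∈ Finset.univ.erase Finset.univ, T (mix S) x := fun x => by
    have h1 : v = fun j y => u j y + w j y := by
      funext j y
      simp only [hu, hw]
      exact (indicator_self_add_compl_apply B (v j) y).symm
    have h2 : T (mix Finset.univ) x = T u x := by
      congr 1
      funext j
      simp [hmix]
    rw [← h2, sub_eq_iff_eq_add, Finset.sum_erase_add _ _ (Finset.mem_univ _), hmix,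
      ← h.lin.add_univ hui hwi, ← h1]
  have hrep : ∀ᵐ x, ∀ S : Finset (Fin m), S ≠ Finset.univ → x ∈ hcube c s →
      T (mix S) x = ∫ y : Fin m → Rn n, K x y * ∏ j, mix S j (y j) := by
    rw [ae_all_iff]
    intro S
    filter_upwards [h.rep (mix S) (hmi S) (hmc S)] with x hx hS hxP
    refine hx fun hall => ?_
    obtain ⟨j, hj⟩ : ∃ j, j ∉ S := by
      by_contra! hc
      exact hS (Finset.eq_univ_iff_forall.2 hc)
    have h1 : tsupport (mix S j) ⊆ (ball c (4 * n * s))ᶜ := by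
      refine closure_minimal ?_ isOpen_ball.isClosed_compl
      intro y hy
      simp only [hmix, if_neg hj] at hy
      exact fun hyb => (indicator_apply_ne_zero.1 hy).1 (ball_subset_closedBall hyb)
    refine h1 (mem_iInter.1 hall j) ?_
    rw [mem_ball, dist_eq_norm]
    have := ctr_mem_closedBall_of_mem_hcube hs hxP
    nlinarith
  have hvolP : volume (hcube c s) = ENNReal.ofReal s ^ n := volume_hcube c s
  have hsn : 0 < ENNReal.ofReal s ^ n := by positivity
  have hsnt : ENNReal.ofReal s ^ n ≠ ∞ := by finiteness
  obtain ⟨z0, hz0, hz0E⟩ : ∃ z ∈ hcube c s, z ∉ E := by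
    by_contra! hc
    have h1 : ENNReal.ofReal s ^ n ≤ ENNReal.ofReal s ^ n / 2 := by
      rw [← hvolP]
      conv_rhs => rw [hvolP]
      exact (measure_mono (subset_inter hc subset_rfl)).trans hE
    exact absurd (ENNReal.half_lt_self hsn.ne' hsnt) (not_lt.2 h1)
  have hu1 : ∀ j, ∫⁻ y, ‖u j y‖ₑ ≤ ENNReal.ofReal (Y * (5 * n) ^ n * s ^ n) := fun j => by
    calc ∫⁻ y, ‖u j y‖ₑ = ∫⁻ y in B, ‖v j y‖ₑ := by
          rw [← lintegral_indicator hBm]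
          refine lintegral_congr fun y => ?_
          exact enorm_indicator_eq_indicator_enorm _ _
      _ ≤ ∫⁻ y in closedBall z0 (5 * n * s), ‖v j y‖ₑ := by
          refine lintegral_mono_set (closedBall_subset_closedBall' ?_)
          rw [dist_comm, dist_eq_norm]
          have := ctr_mem_closedBall_of_mem_hcube hs hz0
          linarith
      _ ≤ ENNReal.ofReal Y * ENNReal.ofReal (5 * n * s) ^ n := hEY z0 hz0E j _ (by positivity)
      _ = _ := by
          rw [← ENNReal.ofReal_pow (by positivity), ← ENNReal.ofReal_mul hY.le]
          congr 1
          ring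
  have hwk := h.volume_lt_abs_le (q := 4) hui (by positivity : 0 ≤ s ^ n)
    (by positivity : 0 < Y * (5 * n) ^ n) (by norm_num) hu1
  obtain ⟨z, hzP, hzE, hzu, hzr⟩ : ∃ z ∈ hcube c s, z ∉ E ∧
      |T u z| ≤ (4 * (Y * (5 * n) ^ n)) ^ m * A ∧
      ∀ S : Finset (Fin m), S ≠ Finset.univ →
        T (mix S) z = ∫ y : Fin m → Rn n, K z y * ∏ j, mix S j (y j) := by
    by_contra! hc
    have hsub : hcube c s ⊆ (E ∩ hcube c s) ∪ ({x | (4 * (Y * (5 * n) ^ n)) ^ m * A < |T u x|} ∪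
        {x | ¬ ∀ S : Finset (Fin m), S ≠ Finset.univ → x ∈ hcube c s →
          T (mix S) x = ∫ y : Fin m → Rn n, K x y * ∏ j, mix S j (y j)}) := by
      intro z hz
      by_cases h1 : z ∈ E
      · exact Or.inl ⟨h1, hz⟩
      by_cases h2 : |T u z| ≤ (4 * (Y * (5 * n) ^ n)) ^ m * A
      · right; right
        obtain ⟨S, hS, hne⟩ := hc z hz h1 h2
        exact fun hall => hne (hall S hS hz)
      · right; left
        exact not_le.1 h2
    have h4 : ENNReal.ofReal (s ^ n / 4) = ENNReal.ofReal s ^ n / 4 := by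
      rw [ENNReal.ofReal_div_of_pos (by norm_num), ENNReal.ofReal_pow hs.le,
        ENNReal.ofReal_ofNat]
    have hle : ENNReal.ofReal s ^ n ≤
        ENNReal.ofReal s ^ n / 2 + (ENNReal.ofReal s ^ n / 4 + 0) := by
      conv_lhs => rw [← hvolP]
      refine (measure_mono hsub).trans ((measure_union_le _ _).trans (add_le_add hE ?_))
      refine (measure_union_le _ _).trans (add_le_add (hwk.trans h4.le) ?_)
      exact (ae_iff.1 hrep).le
    rw [add_zero] at hle
    have hlt : ENNReal.ofReal s ^ n / 2 + ENNReal.ofReal s ^ n / 4 < ENNReal.ofReal s ^ n := by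
      conv_rhs => rw [← ENNReal.add_halves (ENNReal.ofReal s ^ n)]
      refine ENNReal.add_lt_add_left (by finiteness) ?_
      exact ENNReal.div_lt_div_left hsn.ne' hsnt (by norm_num)
    exact absurd hle (not_le.2 hlt)
  set e : ℝ := A * (2 ^ n * Y) ^ m * σ.toReal with he
  have he0 : 0 ≤ e := by positivity
  filter_upwards [hrep] with x hxr hxP
  have hdiff : ∀ S ∈ (Finset.univ : Finset (Finset (Fin m))).erase Finset.univ,
      |T (mix S) z - T (mix S) x| ≤ e := fun S hS => by
    have hS' := Finset.ne_of_mem_erase hS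
    obtain ⟨j, hj⟩ : ∃ j, j ∉ S := by
      by_contra! hc
      exact hS' (Finset.eq_univ_iff_forall.2 hc)
    rw [hzr S hS', hxr S hS' hxP]
    have h1 := h.enorm_integral_ker_sub_le (hmi S) (x := x) (z := z) (L := 2 * n * s)
      (by positivity) (by linarith [norm_sub_le_of_mem_hcube hzP hxP]) (j := j)
      (fun y hy => by
        simp only [hmix, if_neg hj] at hy
        have hyB := (indicator_apply_ne_zero.1 hy).1
        rw [mem_compl_iff, hB, mem_closedBall, dist_eq_norm, not_le] at hyB
        have h2 := ctr_mem_closedBall_of_mem_hcube hs hzP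
        have h3 := norm_sub_le_norm_sub_add_norm_sub y z c
        rw [norm_sub_rev y z] at h3
        nlinarith)
      (Y := ENNReal.ofReal Y)
      (fun i R hR => (lintegral_mono fun y => hmle S i y).trans (hEY z hzE i R hR))
    rw [Real.enorm_eq_ofReal_abs] at h1
    rw [← ENNReal.ofReal_le_ofReal_iff he0]
    refine h1.trans (le_of_eq ?_)
    rw [he, ENNReal.ofReal_mul (by positivity), ENNReal.ofReal_mul hA.le,
      ENNReal.ofReal_pow (by positivity), ENNReal.ofReal_mul (by positivity),
      ENNReal.ofReal_pow (by norm_num), ENNReal.ofReal_ofNat, ENNReal.ofReal_toReal hσt]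
  have hsum : |(T v z - T u z) - (T v x - T u x)| ≤ 2 ^ m * e := by
    rw [hdec, hdec, ← Finset.sum_sub_distrib]
    refine (Finset.abs_sum_le_sum_abs _ _).trans ((Finset.sum_le_sum hdiff).trans ?_)
    rw [Finset.sum_const, nsmul_eq_mul]
    gcongr
    calc ((Finset.univ.erase Finset.univ : Finset (Finset (Fin m))).card : ℝ)
        ≤ ((Finset.univ : Finset (Finset (Fin m))).card : ℝ) := by
          exact_mod_cast Finset.card_le_card (Finset.erase_subset _ _)
      _ = 2 ^ m := by simp
  have h5 := hEa z hzE
  rw [abs_le] at hsum h5 hzu ⊢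
  constructor <;> linarith [hsum.1, hsum.2, h5.1, h5.2, hzu.1, hzu.2]

end CZ

/-- One step of the stopping-time construction for a family of input tuples. -/
lemma CZ.exists_step {n m : ℕ} (hn : 1 ≤ n) (hm : 1 ≤ m) (ω : ℝ → ℝ) :
    ∃ κ : ℝ, 0 < κ ∧ ∀ (A : ℝ) (K : Rn n → (Fin m → Rn n) → ℝ)
      (T : (Fin m → Rn n → ℝ) → Rn n → ℝ), CZ A ω K T →
      ∀ (c : Rn n) (l Γ : ℝ), 0 < l → 0 < Γ → ∀ v : Finset (Fin m) → Fin m → Rn n → ℝ,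
        (∀ S j, Integrable (v S j)) → (∀ S j, HasCompactSupport (v S j)) →
        (∀ S j, ∫⁻ y, ‖v S j y‖ₑ ≤ ENNReal.ofReal (Γ * l ^ n)) →
        ∃ (ι : Type) (_ : Countable ι) (ctr : ι → Rn n) (s : ι → ℝ),
          (∀ i, 0 < s i ∧ s i ≤ l ∧ hcube (ctr i) (s i) ⊆ hcube c l) ∧
          Pairwise (fun i j => Disjoint (hcube (ctr i) (s i)) (hcube (ctr j) (s j))) ∧
          ∑' i, ENNReal.ofReal (s i) ^ n ≤ ENNReal.ofReal l ^ n / 2 ∧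
          (∀ S, ∀ x ∈ hcube c l, x ∉ ⋃ i, hcube (ctr i) (s i) → |T (v S) x| ≤ κ * A * Γ ^ m) ∧
          ∀ i S, ∀ᵐ x, x ∈ hcube (ctr i) (s i) →
            |T (v S) x - T (fun j => (closedBall (ctr i) (4 * n * s i)).indicator (v S j)) x| ≤
              κ * A * Γ ^ m := by
  obtain ⟨C, hC1, hC⟩ := volume_maxSet_le hn
  set σ := ∑' p : ℕ, ENNReal.ofReal (ω ((1 / 2) ^ p)) with hσ
  set q : ℝ := 2 ^ m * 2 ^ (n + 4) with hq
  set κ1 : ℝ := C * (2 ^ m * m * 2 ^ (n + 4)) with hκ1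
  have hm0 : (0 : ℝ) < m := by exact_mod_cast hm
  have hC0 : (0 : ℝ) < C := lt_of_lt_of_le one_pos (by exact_mod_cast hC1)
  have hq0 : 0 < q := by positivity
  have hκ0 : 0 < κ1 := by positivity
  set κ2 : ℝ := (4 * (κ1 * (5 * n) ^ n)) ^ m + 2 ^ m * ((2 ^ n * κ1) ^ m * σ.toReal) with hκ2
  have hκ2p : 0 ≤ κ2 := by positivity
  refine ⟨q ^ m + κ2, by positivity, ?_⟩
  intro A K T h c l Γ hl hΓ v hv hvc hvl
  have hA := h.pos
  set E : Set (Rn n) := (⋃ S : Finset (Fin m), {x | (q * Γ) ^ m * A < |T (v S) x|}) ∪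
    ⋃ S : Finset (Fin m), ⋃ j : Fin m, maxSet (fun y => ‖v S j y‖ₑ) (ENNReal.ofReal (κ1 * Γ))
    with hEdef
  have hE1 : volume (⋃ S : Finset (Fin m), {x | (q * Γ) ^ m * A < |T (v S) x|}) ≤
      ENNReal.ofReal (l ^ n / 2 ^ (n + 4)) := by
    refine (measure_iUnion_fintype_le _ _).trans ?_
    refine (Finset.sum_le_sum fun S _ =>
      h.volume_lt_abs_le (hv S) (by positivity) hΓ hq0 (hvl S)).trans ?_
    rw [Finset.sum_const, nsmul_eq_mul, ← ENNReal.ofReal_natCast,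
      ← ENNReal.ofReal_mul (by positivity)]
    apply ENNReal.ofReal_le_ofReal
    simp only [Finset.card_univ, Fintype.card_finset, Fintype.card_fin, hq]
    push_cast
    apply le_of_eq
    field_simp
  have hE2 : volume (⋃ S : Finset (Fin m), ⋃ j : Fin m,
      maxSet (fun y => ‖v S j y‖ₑ) (ENNReal.ofReal (κ1 * Γ))) ≤
      ENNReal.ofReal (l ^ n / 2 ^ (n + 4)) := by
    have h1 : ∀ S j, volume (maxSet (fun y => ‖v S j y‖ₑ) (ENNReal.ofReal (κ1 * Γ))) ≤
        ENNReal.ofReal (C * (Γ * l ^ n / (κ1 * Γ))) := fun S j => by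
      refine (hC _ _ (by positivity) (hv S j).2.ne).trans ?_
      rw [ENNReal.ofReal_mul hC0.le, ENNReal.ofReal_coe_nnreal,
        ENNReal.ofReal_div_of_pos (by positivity)]
      gcongr
      exact hvl S j
    refine (measure_iUnion_fintype_le _ _).trans ?_
    refine (Finset.sum_le_sum fun S _ => (measure_iUnion_fintype_le _ _).trans
      (Finset.sum_le_sum fun j _ => h1 S j)).trans ?_
    rw [Finset.sum_const, Finset.sum_const, nsmul_eq_mul, nsmul_eq_mul, ← ENNReal.ofReal_natCast,
      ← ENNReal.ofReal_natCast, ← ENNReal.ofReal_mul (by positivity),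
      ← ENNReal.ofReal_mul (by positivity)]
    apply ENNReal.ofReal_le_ofReal
    simp only [Finset.card_univ, Fintype.card_finset, Fintype.card_fin, hκ1]
    push_cast
    apply le_of_eq
    field_simp
  have hE : volume (E ∩ hcube c l) ≤ ENNReal.ofReal l ^ n / 2 ^ (n + 3) := by
    refine (measure_mono inter_subset_left).trans ((measure_union_le _ _).trans
      ((add_le_add hE1 hE2).trans ?_))
    rw [← ENNReal.ofReal_add (by positivity) (by positivity), ← ENNReal.ofReal_pow hl.le,
      ← ENNReal.ofReal_ofNat, ← ENNReal.ofReal_pow (by norm_num),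
      ← ENNReal.ofReal_div_of_pos (by positivity)]
    apply ENNReal.ofReal_le_ofReal
    apply le_of_eq
    rw [pow_succ 2 (n + 3)]
    field_simp
    norm_num
  obtain ⟨ι, hι, ctr, s, h1, h2, h3, h4⟩ := exists_local_stopping hn c hl E hE
  have hEa : ∀ S x, x ∉ E → |T (v S) x| ≤ (q * Γ) ^ m * A := fun S x hx => by
    by_contra! hc
    exact hx (Or.inl (mem_iUnion.2 ⟨S, hc⟩))
  refine ⟨ι, hι, ctr, s, fun i => ⟨(h1 i).1, (h1 i).2.1, (h1 i).2.2.1⟩, h2, h3, ?_, ?_⟩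
  · intro S x hx hxU
    refine (hEa S x fun hxE => hxU (h4 ⟨hxE, hx⟩)).trans ?_
    calc (q * Γ) ^ m * A = q ^ m * A * Γ ^ m := by ring
      _ ≤ _ := by gcongr; linarith
  · intro i S
    filter_upwards [h.ae_abs_sub_le_on_hcube (h1 i).1 (hv S) (hvc S) (h1 i).2.2.2
      (by positivity : 0 < κ1 * Γ) (hEa S) (fun x hx j R hR =>
        lintegral_closedBall_le_of_notMem_maxSet (fun hxm => hx (Or.inr
          (mem_iUnion₂.2 ⟨S, j, hxm⟩))) hR)] with x hx hxP
    refine (hx hxP).trans (le_of_eq ?_)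
    rw [hκ2]
    simp only [mul_pow]
    ring

/-! ### Truncated commutators: iterating the stopping construction -/

lemma MultilinM.affine {n m : ℕ} {T : (Fin m → Rn n → ℝ) → Rn n → ℝ} (hT : MultilinM T)
    (r : Fin m → ℝ) {p q : Fin m → Rn n → ℝ} (hp : ∀ j, Integrable (p j))
    (hq : ∀ j, Integrable (q j)) (x : Rn n) :
    T (fun j y => r j * p j y + q j y) x =
      ∑ S : Finset (Fin m), (∏ j ∈ S, r j) * T (fun j => if j ∈ S then p j else q j) x := by
  rw [hT.add_univ (fun j => (hp j).const_mul (r j)) hq]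
  refine Finset.sum_congr rfl fun S _ => ?_
  have h1 := hT.smul_univ (fun j => if j ∈ S then r j else 1)
    (p := fun j => if j ∈ S then p j else q j) (fun j => by split_ifs; exacts [hp j, hq j]) x
  rw [Finset.prod_ite_mem, Finset.univ_inter] at h1
  rw [← h1]
  congr 1
  funext j y
  split_ifs <;> simp

/-- The inputs of a commutator taken in the slots `J` only. -/
def commSlot {n m : ℕ} (J : Finset (Fin m)) (b g : Fin m → Rn n → ℝ) (x : Rn n) :
    Fin m → Rn n → ℝ :=
  fun j y => if j ∈ J then b j x * g j y - b j y * g j y else g j y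

/-- The input tuples arising from expanding a partial commutator around the constants `a`. -/
def commMix {n m : ℕ} (J : Finset (Fin m)) (b g : Fin m → Rn n → ℝ) (a : Fin m → ℝ)
    (S : Finset (Fin m)) (j : Fin m) (y : Rn n) : ℝ :=
  if j ∈ S then g j y else if j ∈ J then -((b j y - a j) * g j y) else 0

lemma integrable_commMix {n m : ℕ} {J : Finset (Fin m)} {b g : Fin m → Rn n → ℝ}
    (hg : ∀ j, Integrable (g j)) (hbg : ∀ j, Integrable fun y => b j y * g j y)
    (a : Fin m → ℝ) (S : Finset (Fin m)) (j : Fin m) : Integrable (commMix J b g a S j) := by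
  unfold commMix
  split_ifs
  · exact hg j
  · refine (((hbg j).sub ((hg j).const_mul (a j))).neg).congr (Eventually.of_forall fun y => ?_)
    simp only [Pi.neg_apply, Pi.sub_apply]
    ring
  · exact integrable_zero _ _ _

lemma commSlot_expand {n m : ℕ} {T : (Fin m → Rn n → ℝ) → Rn n → ℝ} (hT : MultilinM T)
    {J : Finset (Fin m)} {b g : Fin m → Rn n → ℝ}
    (hg : ∀ j, Integrable (g j)) (hbg : ∀ j, Integrable fun y => b j y * g j y)
    (a : Fin m → ℝ) {B : Set (Rn n)} (hB : MeasurableSet B) (x : Rn n) :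
    T (fun j => B.indicator (commSlot J b g x j)) x =
      ∑ S : Finset (Fin m), (∏ j ∈ S, if j ∈ J then b j x - a j else 1) *
        T (fun j => B.indicator (commMix J b g a S j)) x := by
  have h1 := hT.affine (fun j => if j ∈ J then b j x - a j else 1)
    (p := fun j => B.indicator (commMix J b g a Finset.univ j))
    (q := fun j => B.indicator (commMix J b g a ∅ j))
    (fun j => (integrable_commMix hg hbg a _ j).indicator hB)
    (fun j => (integrable_commMix hg hbg a _ j).indicator hB) x
  have h2 : ∀ S : Finset (Fin m), (fun j => if j ∈ S then
      B.indicator (commMix J b g a Finset.univ j) else B.indicator (commMix J b g a ∅ j)) =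
      fun j => B.indicator (commMix J b g a S j) := fun S => by
    funext j
    by_cases hj : j ∈ S
    · rw [if_pos hj]
      congr 1
      funext y
      simp [commMix, hj]
    · rw [if_neg hj]
      congr 1
      funext y
      simp [commMix, hj]
  simp only [h2] at h1
  rw [← h1]
  congr 1
  funext j y
  by_cases hy : y ∈ B
  · simp only [hy, indicator_of_mem, commSlot, commMix, Finset.mem_univ, if_true,
      Finset.notMem_empty, if_false]
    split_ifs <;> ring
  · simp [hy]

lemma abs_sum_prod_mul_le {m : ℕ} (r t : Fin m → ℝ) (hrt : ∀ j, |r j| ≤ t j)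
    (F : Finset (Fin m) → ℝ) {W : ℝ} (hF : ∀ S, |F S| ≤ W) :
    |∑ S : Finset (Fin m), (∏ j ∈ S, r j) * F S| ≤ (∏ j, (1 + t j)) * W := by
  have h1 : ∏ j, (1 + t j) = ∑ S : Finset (Fin m), ∏ j ∈ S, t j := by
    rw [Finset.prod_one_add, Finset.powerset_univ]
  rw [h1, Finset.sum_mul]
  refine (Finset.abs_sum_le_sum_abs _ _).trans (Finset.sum_le_sum fun S _ => ?_)
  rw [abs_mul, Finset.abs_prod]
  exact mul_le_mul (Finset.prod_le_prod (fun _ _ => abs_nonneg _) fun j _ => hrt j) (hF S)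
    (abs_nonneg _) (Finset.prod_nonneg fun j _ => (abs_nonneg _).trans (hrt j))

lemma lintegral_hcube_prod_osc_le {n m : ℕ} (hn : 1 ≤ n) {M : ℝ} (hM : 0 < M) :
    ∃ C : ℝ≥0, ∀ b : Fin m → Rn n → ℝ, (∀ j, LocallyIntegrable (b j) volume) →
      (∀ j, OscBound (b j) M) → ∀ c l, 0 < l →
        ∫⁻ x in hcube c l, ∏ j, (2 + ‖b j x - avgOn (b j) (cube c l)‖ₑ) ≤
          C * ENNReal.ofReal l ^ n := by
  obtain ⟨C, hC⟩ := lintegral_cube_osc_pow_le hn hM m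
  have hpow : ∀ s : ℝ≥0∞, (2 + s) ^ m ≤ 3 ^ m * (1 + s ^ m) := fun s => by
    rcases le_total s 1 with hs | hs
    · calc (2 + s) ^ m ≤ (2 + 1) ^ m := by gcongr
        _ = 3 ^ m * 1 := by norm_num
        _ ≤ _ := by gcongr; exact le_self_add
    · calc (2 + s) ^ m ≤ (2 * s + s) ^ m := by
            gcongr
            exact le_mul_of_one_le_right' hs
        _ = 3 ^ m * s ^ m := by rw [← mul_pow]; ring
        _ ≤ _ := by gcongr; exact le_add_self
  have hprod : ∀ s : Fin m → ℝ≥0∞, ∏ j, (2 + s j) ≤ 1 + ∑ j, 3 ^ m * (1 + s j ^ m) := fun s => by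
    rcases isEmpty_or_nonempty (Fin m) with hm | hm
    · simp
    obtain ⟨i, -, hi⟩ := Finset.exists_max_image Finset.univ s Finset.univ_nonempty
    calc ∏ j, (2 + s j) ≤ ∏ _j : Fin m, (2 + s i) :=
          Finset.prod_le_prod' fun j _ => add_le_add_right (hi j (Finset.mem_univ j)) _
      _ = (2 + s i) ^ m := by simp
      _ ≤ 3 ^ m * (1 + s i ^ m) := hpow _
      _ ≤ ∑ j, 3 ^ m * (1 + s j ^ m) :=
          Finset.single_le_sum (f := fun j => 3 ^ m * (1 + s j ^ m)) (fun _ _ => zero_le)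
            (Finset.mem_univ i)
      _ ≤ _ := le_add_self
  refine ⟨1 + m * (3 ^ m * (1 + C)), fun b hb hbM c l hl => ?_⟩
  have hmeas : ∀ j, AEMeasurable (fun x => ‖b j x - avgOn (b j) (cube c l)‖ₑ ^ m)
      (volume.restrict (hcube c l)) := fun j =>
    (((hb j).aestronglyMeasurable.aemeasurable.sub_const _).enorm.pow_const m).restrict
  calc ∫⁻ x in hcube c l, ∏ j, (2 + ‖b j x - avgOn (b j) (cube c l)‖ₑ)
      ≤ ∫⁻ x in hcube c l, (1 + ∑ j, 3 ^ m * (1 + ‖b j x - avgOn (b j) (cube c l)‖ₑ ^ m)) :=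
        lintegral_mono fun x => hprod _
    _ = ENNReal.ofReal l ^ n + ∑ j, 3 ^ m * (ENNReal.ofReal l ^ n +
          ∫⁻ x in hcube c l, ‖b j x - avgOn (b j) (cube c l)‖ₑ ^ m) := by
        rw [lintegral_add_left measurable_const, setLIntegral_one, volume_hcube,
          lintegral_finsetSum' _ fun j _ => ((hmeas j).const_add _).const_mul _]
        congr 1
        refine Finset.sum_congr rfl fun j _ => ?_
        rw [lintegral_const_mul'' _ ((hmeas j).const_add _), lintegral_add_left measurable_const,
          setLIntegral_one, volume_hcube]
    _ ≤ ENNReal.ofReal l ^ n + ∑ _j : Fin m, 3 ^ m * (ENNReal.ofReal l ^ n +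
          C * ENNReal.ofReal l ^ n) := by
        gcongr with j
        have := hC (b j) (hb j) (hbM j) c l hl 0
        simp only [pow_zero, one_mul, Nat.cast_zero, add_zero, one_pow, mul_one] at this
        exact (lintegral_mono_set (hcube_subset_cube c l)).trans this
    _ = _ := by
        rw [Finset.sum_const, Finset.card_univ, Fintype.card_fin, nsmul_eq_mul]
        push_cast
        ring

lemma commSlot_localize_ae {n m : ℕ} {T : (Fin m → Rn n → ℝ) → Rn n → ℝ} (hT : MultilinM T)
    {J : Finset (Fin m)} {b g : Fin m → Rn n → ℝ}
    (hg : ∀ j, Integrable (g j)) (hbg : ∀ j, Integrable fun y => b j y * g j y)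
    (a : Fin m → ℝ) {B : Set (Rn n)} (hB : MeasurableSet B) {x : Rn n} {W : ℝ}
    (h : ∀ S, |T (fun j => B.indicator (commMix J b g a S j)) x| ≤ W) :
    ‖T (fun j => B.indicator (commSlot J b g x j)) x‖ₑ ≤
      (∏ j, (2 + ‖b j x - a j‖ₑ)) * ENNReal.ofReal W := by
  have hW : 0 ≤ W := (abs_nonneg _).trans (h ∅)
  rw [commSlot_expand hT hg hbg a hB, Real.enorm_eq_ofReal_abs]
  have h1 := abs_sum_prod_mul_le (fun j => if j ∈ J then b j x - a j else 1)
    (fun j => 1 + |b j x - a j|) (fun j => by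
      split_ifs
      · linarith
      · rw [abs_one]; linarith [abs_nonneg (b j x - a j)])
    (fun S => T (fun j => B.indicator (commMix J b g a S j)) x) h
  refine (ENNReal.ofReal_le_ofReal h1).trans (le_of_eq ?_)
  rw [ENNReal.ofReal_mul (Finset.prod_nonneg fun j _ => by positivity),
    ENNReal.ofReal_prod_of_nonneg fun j _ => by positivity]
  congr 1
  refine Finset.prod_congr rfl fun j _ => ?_
  rw [← add_assoc, one_add_one_eq_two, ENNReal.ofReal_add (by norm_num) (abs_nonneg _),
    ENNReal.ofReal_ofNat, Real.enorm_eq_ofReal_abs]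

lemma commSlot_localize_sub {n m : ℕ} {T : (Fin m → Rn n → ℝ) → Rn n → ℝ} (hT : MultilinM T)
    {J : Finset (Fin m)} {b g : Fin m → Rn n → ℝ}
    (hg : ∀ j, Integrable (g j)) (hbg : ∀ j, Integrable fun y => b j y * g j y)
    (a : Fin m → ℝ) {B B' : Set (Rn n)} (hB : MeasurableSet B) (hB' : MeasurableSet B')
    {x : Rn n} {W : ℝ}
    (h : ∀ S, |T (fun j => B.indicator (commMix J b g a S j)) x -
      T (fun j => B'.indicator (commMix J b g a S j)) x| ≤ W) :
    ‖T (fun j => B.indicator (commSlot J b g x j)) x‖ₑ ≤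
      (∏ j, (2 + ‖b j x - a j‖ₑ)) * ENNReal.ofReal W +
        ‖T (fun j => B'.indicator (commSlot J b g x j)) x‖ₑ := by
  have hW : 0 ≤ W := (abs_nonneg _).trans (h ∅)
  have h1 := abs_sum_prod_mul_le (fun j => if j ∈ J then b j x - a j else 1)
    (fun j => 1 + |b j x - a j|) (fun j => by
      split_ifs
      · linarith
      · rw [abs_one]; linarith [abs_nonneg (b j x - a j)])
    (fun S => T (fun j => B.indicator (commMix J b g a S j)) x -
      T (fun j => B'.indicator (commMix J b g a S j)) x) h
  simp only [mul_sub, Finset.sum_sub_distrib] at h1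
  rw [← commSlot_expand hT hg hbg a hB, ← commSlot_expand hT hg hbg a hB'] at h1
  have h2 : ∀ p q : ℝ, ‖p‖ₑ ≤ ‖p - q‖ₑ + ‖q‖ₑ := fun p q => by
    calc ‖p‖ₑ = ‖(p - q) + q‖ₑ := by rw [sub_add_cancel]
      _ ≤ _ := enorm_add_le _ _
  refine (h2 _ (T (fun j => B'.indicator (commSlot J b g x j)) x)).trans ?_
  gcongr
  rw [Real.enorm_eq_ofReal_abs]
  refine (ENNReal.ofReal_le_ofReal h1).trans (le_of_eq ?_)
  rw [ENNReal.ofReal_mul (Finset.prod_nonneg fun j _ => by positivity),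
    ENNReal.ofReal_prod_of_nonneg fun j _ => by positivity]
  congr 1
  refine Finset.prod_congr rfl fun j _ => ?_
  rw [← add_assoc, one_add_one_eq_two, ENNReal.ofReal_add (by norm_num) (abs_nonneg _),
    ENNReal.ofReal_ofNat, Real.enorm_eq_ofReal_abs]

lemma CZ.exists_iterate {n m : ℕ} (hn : 1 ≤ n) (hm : 1 ≤ m) (ω : ℝ → ℝ) {M : ℝ} (hM : 0 < M) :
    ∃ C : ℝ≥0, ∀ (A : ℝ) (K : Rn n → (Fin m → Rn n) → ℝ)
      (T : (Fin m → Rn n → ℝ) → Rn n → ℝ), CZ A ω K T →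
      ∀ (J : Finset (Fin m)) (b g : Fin m → Rn n → ℝ), (∀ j, LocallyIntegrable (b j) volume) →
      (∀ j, OscBound (b j) M) → (∀ j, Integrable (g j)) → (∀ j, HasCompactSupport (g j)) →
      (∀ j, Integrable fun y => b j y * g j y) → ∀ V : Rn n → ℝ≥0∞,
      (∀ c l, 0 < l → ∃ Γ, 0 < Γ ∧
        (∀ j, ∫⁻ y in closedBall c (4 * n * l), ‖g j y‖ₑ ≤ ENNReal.ofReal (Γ * l ^ n)) ∧
        (∀ j, ∫⁻ y in closedBall c (4 * n * l), ‖(b j y - avgOn (b j) (cube c l)) * g j y‖ₑ ≤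
          ENNReal.ofReal (Γ * l ^ n)) ∧ ∀ x ∈ hcube c l, ENNReal.ofReal (A * Γ ^ m) ≤ V x) →
      ∀ (N : ℕ) (c : Rn n) (l : ℝ), 0 < l → ∃ R, MeasurableSet R ∧ R ⊆ hcube c l ∧
        volume R ≤ ENNReal.ofReal l ^ n / 2 ^ N ∧
        ∫⁻ x in hcube c l \ R,
          ‖T (fun j => (closedBall c (4 * n * l)).indicator (commSlot J b g x j)) x‖ₑ ≤
          C * ∫⁻ x in hcube c l, V x := by
  obtain ⟨κ, hκ, hstep⟩ := CZ.exists_step hn hm ω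
  obtain ⟨Cp, hCp⟩ := lintegral_hcube_prod_osc_le (m := m) hn hM
  refine ⟨Cp * κ.toNNReal * 2, ?_⟩
  intro A K T h J b g hb hbM hg hgc hbg V hV N
  have hA := h.pos
  induction N with
  | zero =>
    intro c l hl
    refine ⟨hcube c l, measurableSet_hcube c l, subset_rfl, ?_, ?_⟩
    · rw [volume_hcube, pow_zero, div_one]
    · simp
  | succ N ih =>
    intro c l hl
    obtain ⟨Γ, hΓ, hg1, hg2, hVΓ⟩ := hV c l hl
    set B := closedBall c (4 * n * l) with hB
    have hBm : MeasurableSet B := measurableSet_closedBall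
    set a : Fin m → ℝ := fun j => avgOn (b j) (cube c l) with ha
    have hmixc : ∀ S j, HasCompactSupport (commMix J b g a S j) := fun S j =>
      (hgc j).mono fun y hy hy0 => hy (by simp [commMix, hy0])
    obtain ⟨ι, hι, ctr, s, hs, hdis, hsum, hout, hin⟩ := hstep A K T h c l Γ hl hΓ
      (fun S j => B.indicator (commMix J b g a S j))
      (fun S j => (integrable_commMix hg hbg a S j).indicator hBm)
      (fun S j => (hmixc S j).mono fun y hy => (indicator_apply_ne_zero.1 hy).2)
      (fun S j => by
        have h1 : ∫⁻ y, ‖B.indicator (commMix J b g a S j) y‖ₑ =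
            ∫⁻ y in B, ‖commMix J b g a S j y‖ₑ := by
          rw [← lintegral_indicator hBm]
          exact lintegral_congr fun y => enorm_indicator_eq_indicator_enorm _ _
        rw [h1]
        by_cases hS : j ∈ S
        · simpa only [commMix, hS, if_true] using hg1 j
        by_cases hJ : j ∈ J
        · simpa only [commMix, hS, if_false, hJ, if_true, enorm_neg] using hg2 j
        · simp [commMix, hS, hJ])
    choose R hRm hRs hRv hRi using fun i => ih (ctr i) (s i) (hs i).1
    have hn4 : (n : ℝ) ≤ 4 * n := by linarith [(Nat.cast_nonneg n : (0:ℝ) ≤ n)]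
    have hBi : ∀ i, closedBall (ctr i) (4 * n * s i) ⊆ B := fun i =>
      closedBall_subset_of_hcube_subset (hs i).1 (hs i).2.2 hn4 (hs i).2.1
    set Q : Set (Rn n) := ⋃ i, hcube (ctr i) (s i) with hQ
    have hQm : MeasurableSet Q := MeasurableSet.iUnion fun i => measurableSet_hcube _ _
    have hQP : Q ⊆ hcube c l := iUnion_subset fun i => (hs i).2.2
    set W : ℝ := κ * A * Γ ^ m with hW
    set G : Rn n → ℝ≥0∞ := fun x => (∏ j, (2 + ‖b j x - a j‖ₑ)) * ENNReal.ofReal W with hG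
    have hGm : AEMeasurable G := by
      refine AEMeasurable.mul_const ?_ _
      exact Finset.aemeasurable_fun_prod _ fun j _ =>
        ((hb j).aestronglyMeasurable.aemeasurable.sub_const _).enorm.const_add _
    set U : Set (Rn n) → Rn n → ℝ≥0∞ := fun B' x =>
      ‖T (fun j => B'.indicator (commSlot J b g x j)) x‖ₑ with hU
    have hvolQ : volume Q ≤ ENNReal.ofReal l ^ n / 2 := by
      refine (measure_iUnion_le _).trans (le_trans (le_of_eq ?_) hsum)
      exact tsum_congr fun i => volume_hcube _ _
    have hGP : ∫⁻ x in hcube c l, G x ≤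
        (Cp * κ.toNNReal * 2 : ℝ≥0) * ∫⁻ x in hcube c l \ Q, V x := by
      have e1 : ENNReal.ofReal W = κ.toNNReal * ENNReal.ofReal (A * Γ ^ m) := by
        rw [hW, mul_assoc, ENNReal.ofReal_mul hκ.le]; rfl
      have e2 : ENNReal.ofReal l ^ n ≤ 2 * volume (hcube c l \ Q) := by
        have h1 : ENNReal.ofReal l ^ n ≤ volume (hcube c l \ Q) + ENNReal.ofReal l ^ n / 2 := by
          rw [← volume_hcube c l]
          conv_lhs => rw [← sdiff_union_of_subset hQP]
          refine (measure_union_le _ _).trans (add_le_add_right ?_ _)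
          rwa [volume_hcube]
        have h2 : ENNReal.ofReal l ^ n / 2 ≤ volume (hcube c l \ Q) := by
          have h3 : ENNReal.ofReal l ^ n / 2 + ENNReal.ofReal l ^ n / 2 ≤
              volume (hcube c l \ Q) + ENNReal.ofReal l ^ n / 2 := by
            rwa [ENNReal.add_halves]
          exact (ENNReal.add_le_add_iff_right (by finiteness)).1 h3
        rwa [ENNReal.div_le_iff_le_mul (by simp) (by simp), mul_comm] at h2
      have e3 : volume (hcube c l \ Q) * ENNReal.ofReal (A * Γ ^ m) ≤
          ∫⁻ x in hcube c l \ Q, V x := by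
        rw [mul_comm, ← setLIntegral_const]
        exact setLIntegral_mono' ((measurableSet_hcube c l).diff hQm) fun x hx => hVΓ x hx.1
      calc ∫⁻ x in hcube c l, G x
          = (∫⁻ x in hcube c l, ∏ j, (2 + ‖b j x - a j‖ₑ)) * ENNReal.ofReal W :=
            lintegral_mul_const' _ _ ENNReal.ofReal_ne_top
        _ ≤ (Cp * (2 * volume (hcube c l \ Q))) * ENNReal.ofReal W := by
            gcongr
            exact (hCp b hb hbM c l hl).trans (mul_le_mul_right e2 _)
        _ = (Cp * κ.toNNReal * 2 : ℝ≥0) *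
            (volume (hcube c l \ Q) * ENNReal.ofReal (A * Γ ^ m)) := by
            rw [e1]; push_cast; ring
        _ ≤ _ := by gcongr
    have hadd : ∀ f : Rn n → ℝ≥0∞, (∫⁻ x in Q, f x) + ∫⁻ x in hcube c l \ Q, f x =
        ∫⁻ x in hcube c l, f x := fun f => by
      have := lintegral_inter_add_sdiff (μ := volume) f (hcube c l) hQm
      rwa [inter_eq_right.2 hQP] at this
    have hind : ∀ S i, (fun j => (closedBall (ctr i) (4 * n * s i)).indicator
        (B.indicator (commMix J b g a S j))) =
        fun j => (closedBall (ctr i) (4 * n * s i)).indicator (commMix J b g a S j) := fun S i => by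
      funext j
      rw [indicator_indicator, inter_eq_left.2 (hBi i)]
    have hGout : ∀ x ∈ hcube c l \ Q, U B x ≤ G x := fun x hx =>
      commSlot_localize_ae h.lin hg hbg a hBm fun S => hout S x hx.1 hx.2
    have hGin : ∀ i, ∀ᵐ x, x ∈ hcube (ctr i) (s i) →
        U B x ≤ G x + U (closedBall (ctr i) (4 * n * s i)) x := fun i => by
      filter_upwards [ae_all_iff.2 (hin i)] with x hx hxP
      refine commSlot_localize_sub h.lin hg hbg a hBm measurableSet_closedBall fun S => ?_
      have := hx S hxP
      rwa [hind S i] at this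
    refine ⟨⋃ i, R i, MeasurableSet.iUnion hRm,
      iUnion_subset fun i => (hRs i).trans (hs i).2.2, ?_, ?_⟩
    · calc volume (⋃ i, R i) ≤ ∑' i, ENNReal.ofReal (s i) ^ n / 2 ^ N :=
            (measure_iUnion_le _).trans (ENNReal.tsum_le_tsum hRv)
        _ = (∑' i, ENNReal.ofReal (s i) ^ n) / 2 ^ N := by
            simp only [div_eq_mul_inv, ENNReal.tsum_mul_right]
        _ ≤ ENNReal.ofReal l ^ n / 2 / 2 ^ N := by gcongr
        _ = _ := by
            rw [div_eq_mul_inv, div_eq_mul_inv, div_eq_mul_inv, mul_assoc, pow_succ',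
              ENNReal.mul_inv (by simp) (by simp)]
    · have hsplit : hcube c l \ ⋃ i, R i ⊆
          (hcube c l \ Q) ∪ ⋃ i, (hcube (ctr i) (s i) \ R i) := by
        intro x hx
        by_cases hxQ : x ∈ Q
        · obtain ⟨i, hi⟩ := mem_iUnion.1 hxQ
          exact Or.inr (mem_iUnion.2 ⟨i, hi, fun hr => hx.2 (mem_iUnion.2 ⟨i, hr⟩)⟩)
        · exact Or.inl ⟨hx.1, hxQ⟩
      calc ∫⁻ x in hcube c l \ ⋃ i, R i, U B x
          ≤ ∫⁻ x in (hcube c l \ Q) ∪ ⋃ i, (hcube (ctr i) (s i) \ R i), U B x :=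
            lintegral_mono_set hsplit
        _ ≤ (∫⁻ x in hcube c l \ Q, U B x) +
            ∑' i, ∫⁻ x in hcube (ctr i) (s i) \ R i, U B x :=
            (lintegral_union_le _ _ _).trans (add_le_add_right (lintegral_iUnion_le _ _) _)
        _ ≤ (∫⁻ x in hcube c l \ Q, G x) + ∑' i, ((∫⁻ x in hcube (ctr i) (s i), G x) +
            ∫⁻ x in hcube (ctr i) (s i) \ R i, U (closedBall (ctr i) (4 * n * s i)) x) := by
            gcongr ?_ + ∑' i, ?_ with i
            · exact setLIntegral_mono' ((measurableSet_hcube c l).diff hQm) hGout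
            · calc ∫⁻ x in hcube (ctr i) (s i) \ R i, U B x
                  ≤ ∫⁻ x in hcube (ctr i) (s i) \ R i,
                      (G x + U (closedBall (ctr i) (4 * n * s i)) x) := by
                    refine setLIntegral_mono_ae' ((measurableSet_hcube _ _).diff (hRm i)) ?_
                    filter_upwards [hGin i] with x hx hxP using hx hxP.1
                _ = (∫⁻ x in hcube (ctr i) (s i) \ R i, G x) +
                    ∫⁻ x in hcube (ctr i) (s i) \ R i,
                      U (closedBall (ctr i) (4 * n * s i)) x := lintegral_add_left' hGm.restrict _
                _ ≤ _ := by gcongr; exact sdiff_subset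
        _ ≤ (∫⁻ x in hcube c l \ Q, G x) + ((∑' i, ∫⁻ x in hcube (ctr i) (s i), G x) +
            ∑' i, (Cp * κ.toNNReal * 2 : ℝ≥0) * ∫⁻ x in hcube (ctr i) (s i), V x) := by
            rw [← ENNReal.tsum_add]
            gcongr with i
            exact hRi i
        _ = (∫⁻ x in hcube c l, G x) +
            (Cp * κ.toNNReal * 2 : ℝ≥0) * ∫⁻ x in Q, V x := by
            rw [← add_assoc, ENNReal.tsum_mul_left,
              ← lintegral_iUnion (fun i => measurableSet_hcube _ _) hdis,
              ← lintegral_iUnion (fun i => measurableSet_hcube _ _) hdis, add_comm (lintegral _ _),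
              ← hadd G]
        _ ≤ (Cp * κ.toNNReal * 2 : ℝ≥0) * (∫⁻ x in hcube c l \ Q, V x) +
            (Cp * κ.toNNReal * 2 : ℝ≥0) * ∫⁻ x in Q, V x := by gcongr
        _ = _ := by
            rw [← mul_add, add_comm (lintegral _ _), hadd V]

lemma ENNReal_le_add_pow_four {s N : ℝ≥0∞} (hN : N ≠ 0) (hN' : N ≠ ∞) :
    s ≤ N + s ^ 4 / N ^ 3 := by
  rcases le_total s N with h | h
  · exact h.trans le_self_add
  · refine le_trans ?_ le_add_self
    rw [ENNReal.le_div_iff_mul_le (Or.inl (by positivity)) (Or.inl (by finiteness))]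
    calc s * N ^ 3 ≤ s * s ^ 3 := by gcongr
      _ = s ^ 4 := by ring

lemma exists_commutator_majorant {n m : ℕ} (hn : 1 ≤ n) (hm : 2 ≤ m) {M : ℝ} (hM : 0 < M) :
    ∃ C : ℝ, 0 < C ∧ ∀ (b g : Fin m → Rn n → ℝ), (∀ j, LocallyIntegrable (b j) volume) →
      (∀ j, OscBound (b j) M) → (∀ j, Integrable (g j)) → ∀ A a I : ℝ, 0 < A → 0 < a → 0 < I →
      (∀ j, ∀ᵐ x, |g j x| ≤ a) → (∀ j, ∫⁻ y, ‖g j y‖ₑ ≤ ENNReal.ofReal I) →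
      ∃ V : Rn n → ℝ≥0∞, ∫⁻ x, V x ≤ ENNReal.ofReal (C * (A * a ^ (m - 1) * I)) ∧
        ∀ c l, 0 < l → ∃ Γ, 0 < Γ ∧
          (∀ j, ∫⁻ y in closedBall c (4 * n * l), ‖g j y‖ₑ ≤ ENNReal.ofReal (Γ * l ^ n)) ∧
          (∀ j, ∫⁻ y in closedBall c (4 * n * l),
            ‖(b j y - avgOn (b j) (cube c l)) * g j y‖ₑ ≤ ENNReal.ofReal (Γ * l ^ n)) ∧
          ∀ x ∈ hcube c l, ENNReal.ofReal (A * Γ ^ m) ≤ V x := by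
  obtain ⟨C1, hC1, hmax⟩ := volume_maxSet_le hn
  obtain ⟨C4, hC4⟩ := lintegral_cube_osc_pow_le hn hM 4
  have hn1 : (1 : ℝ) ≤ n := by exact_mod_cast hn
  set v1 : ℝ := (volume (ball (0 : Rn n) 1)).toReal with hv1
  have hv1t : volume (ball (0 : Rn n) 1) ≠ ∞ := measure_ball_lt_top.ne
  set C5 : ℝ := 16 * (5 * n) ^ n + (m + 1) * (4 * n) ^ n * v1 with hC5
  have hC5p : 0 < C5 := by positivity
  set C6 : ℝ := C5 + C4 * (1 + 8 * n) ^ 4 * (2 ^ (8 * n)) ^ n with hC6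
  have hC6p : 0 < C6 := by positivity
  have hC1p : (0 : ℝ) < C1 := lt_of_lt_of_le one_pos (by exact_mod_cast hC1)
  refine ⟨2 * (C6 ^ m * (C1 * (m + 1))), by positivity, ?_⟩
  intro b g hb hbM hg A a I hA ha hI hga hgI
  obtain ⟨ρ, hρ0, hρm, hρI⟩ := exists_pos_lintegral_lt_of_sigmaFinite (volume : Measure (Rn n))
    (ε := ENNReal.ofReal I) (by positivity)
  set u : Rn n → ℝ≥0∞ := fun x => (∑ j, ‖g j x‖ₑ) + min (ρ x : ℝ≥0∞) (ENNReal.ofReal a) with hu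
  have hgm : ∀ j, AEMeasurable (fun x => ‖g j x‖ₑ) := fun j => (hg j).1.aemeasurable.enorm
  have hρm' : Measurable fun x => min (ρ x : ℝ≥0∞) (ENNReal.ofReal a) :=
    hρm.coe_nnreal_ennreal.min measurable_const
  have hum : AEMeasurable u := (Finset.aemeasurable_fun_sum _ fun j _ => hgm j).add
    hρm'.aemeasurable
  have hu0 : ∀ x, 0 < u x := fun x => by
    refine lt_of_lt_of_le ?_ le_add_self
    exact lt_min (by exact_mod_cast hρ0 x) (by positivity)
  have hgu : ∀ j x, ‖g j x‖ₑ ≤ u x := fun j x =>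
    (Finset.single_le_sum (f := fun j => ‖g j x‖ₑ) (fun _ _ => zero_le)
      (Finset.mem_univ j)).trans le_self_add
  have hua : ∀ᵐ x, u x ≤ (m + 1) * ENNReal.ofReal a := by
    filter_upwards [ae_all_iff.2 hga] with x hx
    calc u x ≤ (∑ _j : Fin m, ENNReal.ofReal a) + ENNReal.ofReal a := by
          refine add_le_add (Finset.sum_le_sum fun j _ => ?_) (min_le_right _ _)
          rw [Real.enorm_eq_ofReal_abs]
          exact ENNReal.ofReal_le_ofReal (hx j)
      _ = _ := by simp [add_mul]
  have huI : ∫⁻ x, u x ≤ (m + 1) * ENNReal.ofReal I := by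
    calc ∫⁻ x, u x = (∑ j, ∫⁻ x, ‖g j x‖ₑ) + ∫⁻ x, min (ρ x : ℝ≥0∞) (ENNReal.ofReal a) := by
          rw [lintegral_add_right _ hρm', lintegral_finsetSum' _ fun j _ => hgm j]
      _ ≤ (∑ _j : Fin m, ENNReal.ofReal I) + ENNReal.ofReal I := by
          refine add_le_add (Finset.sum_le_sum fun j _ => hgI j) ?_
          exact (lintegral_mono fun x => min_le_left _ _).trans hρI.le
      _ = _ := by simp [add_mul]
  have hut : ∫⁻ x, u x ≠ ∞ := ne_top_of_le_ne_top (by finiteness) huI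
  set D : ℕ → Set (Rn n) := fun k =>
    toMeasurable volume (maxSet u (ENNReal.ofReal ((1 / 16) ^ k * a))) with hD
  have hDm : ∀ k, MeasurableSet (D k) := fun k => measurableSet_toMeasurable _ _
  set β : ℕ → ℝ := fun k => A * (C6 ^ m * (1 / 64) ^ k * a ^ m) with hβ
  refine ⟨fun x => ∑' k, (D k).indicator (fun _ => ENNReal.ofReal (β k)) x, ?_, ?_⟩
  · rw [lintegral_tsum fun k => (measurable_const.indicator (hDm k)).aemeasurable]
    calc ∑' k, ∫⁻ x, (D k).indicator (fun _ => ENNReal.ofReal (β k)) x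
        ≤ ∑' k, ENNReal.ofReal (C6 ^ m * (C1 * (m + 1)) * (A * a ^ (m - 1) * I)) *
            ENNReal.ofReal ((1 / 2) ^ k) := by
          refine ENNReal.tsum_le_tsum fun k => ?_
          rw [lintegral_indicator_const (hDm k), hD, measure_toMeasurable]
          have h1 := hmax u (ENNReal.ofReal ((1 / 16) ^ k * a)) (by positivity) hut
          calc ENNReal.ofReal (β k) * volume (maxSet u (ENNReal.ofReal ((1 / 16) ^ k * a)))
              ≤ ENNReal.ofReal (β k) * (C1 * ((m + 1) * ENNReal.ofReal I /
                  ENNReal.ofReal ((1 / 16) ^ k * a))) := by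
                gcongr
                exact h1.trans (by gcongr)
            _ = ENNReal.ofReal (β k * (C1 * ((m + 1) * I / ((1 / 16) ^ k * a)))) := by
                have hβ0 : 0 ≤ β k := by simp only [hβ]; positivity
                rw [ENNReal.ofReal_mul (p := β k) hβ0, ENNReal.ofReal_mul hC1p.le,
                  ENNReal.ofReal_div_of_pos (by positivity),
                  ENNReal.ofReal_mul (p := (m : ℝ) + 1) (by positivity),
                  ENNReal.ofReal_coe_nnreal, ENNReal.ofReal_add (by positivity) (by positivity),
                  ENNReal.ofReal_natCast, ENNReal.ofReal_one]
            _ ≤ _ := by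
                rw [← ENNReal.ofReal_mul (by positivity)]
                apply ENNReal.ofReal_le_ofReal
                have e1 : a ^ m = a ^ (m - 1) * a := by
                  rw [← pow_succ]; congr 1; omega
                have e2 : β k * (C1 * ((m + 1) * I / ((1 / 16) ^ k * a))) =
                    C6 ^ m * (C1 * (m + 1)) * (A * a ^ (m - 1) * I) * (1 / 4) ^ k := by
                  have e3 : (1 / 64 : ℝ) ^ k = (1 / 16) ^ k * (1 / 4) ^ k := by
                    rw [← mul_pow]; norm_num
                  rw [hβ]
                  simp only [e1, e3]
                  field_simp
                rw [e2]
                gcongr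
                norm_num
      _ = _ := by
          rw [ENNReal.tsum_mul_left, ← ENNReal.ofReal_tsum_of_nonneg (fun k => by positivity)
            summable_geometric_two, tsum_geometric_two, ← ENNReal.ofReal_mul (by positivity)]
          congr 1
          ring
  · intro c l hl
    set B := closedBall c (4 * n * l) with hB
    set Iv := ∫⁻ y in B, u y with hIv
    have hIvt : Iv ≠ ∞ := ne_top_of_le_ne_top hut (setLIntegral_le_lintegral _ _)
    have hBv : volume B = ENNReal.ofReal ((4 * n * l) ^ n * v1) := by
      rw [hB, volume_closedBall_Rn c (by positivity), ENNReal.ofReal_mul (p := (4 * n * l) ^ n)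
        (by positivity), ENNReal.ofReal_pow (by positivity), hv1, ENNReal.ofReal_toReal hv1t]
    have hIv0 : 0 < Iv := by
      rw [pos_iff_ne_zero, hIv, Ne, lintegral_eq_zero_iff' hum.restrict]
      intro h0
      have h1 : volume B = 0 := by
        have h2 : ∀ᵐ x ∂volume.restrict B, False := by
          filter_upwards [h0] with x hx using (hu0 x).ne' hx
        simpa [ae_iff] using h2
      rw [hB, volume_closedBall_Rn c (by positivity)] at h1
      have : volume (ball (0 : Rn n) 1) ≠ 0 := (measure_ball_pos _ _ one_pos).ne'
      have h3 : ENNReal.ofReal (4 * n * l) ^ n ≠ 0 := by positivity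
      exact mul_ne_zero h3 this h1
    have hex : ∃ k : ℕ, (1 / 16) ^ k * a * (5 * n * l) ^ n < Iv.toReal := by
      have h1 : 0 < Iv.toReal := ENNReal.toReal_pos hIv0.ne' hIvt
      have h2 : 0 < a * (5 * n * l) ^ n := by positivity
      obtain ⟨k, hk⟩ := exists_pow_lt_of_lt_one (div_pos h1 h2) (by norm_num : (1 / 16 : ℝ) < 1)
      refine ⟨k, ?_⟩
      rwa [lt_div_iff₀ h2, ← mul_assoc] at hk
    classical
    set k := Nat.find hex with hk
    have hk1 := Nat.find_spec hex
    have hIle : Iv ≤ ENNReal.ofReal (C5 * (1 / 16) ^ k * a * l ^ n) := by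
      rcases Nat.eq_zero_or_pos k with h0 | h0
      · calc Iv ≤ ∫⁻ _ in B, (m + 1) * ENNReal.ofReal a := lintegral_mono_ae (ae_restrict_of_ae hua)
          _ = ENNReal.ofReal ((m + 1) * a * ((4 * n * l) ^ n * v1)) := by
              rw [setLIntegral_const, hBv,
                ENNReal.ofReal_mul (p := (m + 1) * a) (by positivity),
                ENNReal.ofReal_mul (p := (m : ℝ) + 1) (by positivity),
                ENNReal.ofReal_add (by positivity)
                (by positivity), ENNReal.ofReal_natCast, ENNReal.ofReal_one]
          _ ≤ _ := by
              apply ENNReal.ofReal_le_ofReal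
              rw [h0, pow_zero, mul_one, hC5]
              calc (m + 1) * a * ((4 * n * l) ^ n * v1)
                  = ((m + 1) * (4 * n) ^ n * v1) * a * l ^ n := by ring
                _ ≤ _ := by
                    gcongr
                    exact le_add_of_nonneg_left (by positivity)
      · have h1 := Nat.find_min hex (m := k - 1) (by omega)
        rw [not_lt] at h1
        rw [← ENNReal.ofReal_toReal hIvt]
        apply ENNReal.ofReal_le_ofReal
        refine h1.trans ?_
        have e1 : (1 / 16 : ℝ) ^ (k - 1) = 16 * (1 / 16) ^ k := by
          obtain ⟨k', hk'⟩ : ∃ k', k = k' + 1 := ⟨k - 1, by omega⟩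
          rw [hk', Nat.add_sub_cancel, pow_succ]; ring
        rw [e1]
        calc 16 * (1 / 16) ^ k * a * (5 * n * l) ^ n
            = (16 * (5 * n) ^ n) * (1 / 16) ^ k * a * l ^ n := by ring
          _ ≤ _ := by
              gcongr
              exact le_add_of_nonneg_right (by positivity)
    have hmem : ∀ x ∈ hcube c l, x ∈ D k := fun x hx => by
      refine subset_toMeasurable _ _ ⟨5 * n * l, by positivity, ?_⟩
      calc ENNReal.ofReal ((1 / 16) ^ k * a) * ENNReal.ofReal (5 * n * l) ^ n
          = ENNReal.ofReal ((1 / 16) ^ k * a * (5 * n * l) ^ n) := by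
            rw [← ENNReal.ofReal_pow (by positivity), ← ENNReal.ofReal_mul (by positivity)]
        _ < Iv := (ENNReal.ofReal_lt_iff_lt_toReal (by positivity) hIvt).2 hk1
        _ ≤ _ := by
            refine lintegral_mono_set (closedBall_subset_closedBall' ?_)
            rw [dist_comm, dist_eq_norm]
            have := ctr_mem_closedBall_of_mem_hcube hl hx
            linarith
    have hgB : ∀ j, ∫⁻ y in B, ‖g j y‖ₑ ≤ ENNReal.ofReal (C5 * (1 / 16) ^ k * a * l ^ n) :=
      fun j => (lintegral_mono fun y => hgu j y).trans hIle
    have h8 : (1 / 16 : ℝ) ^ k = (1 / 8) ^ k * (1 / 2) ^ k := by rw [← mul_pow]; norm_num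
    refine ⟨C6 * (1 / 8) ^ k * a, by positivity, fun j => ?_, fun j => ?_, fun x hx => ?_⟩
    · refine (hgB j).trans (ENNReal.ofReal_le_ofReal ?_)
      gcongr
      · exact le_add_of_nonneg_right (by positivity)
      · norm_num
    · set d : Rn n → ℝ≥0∞ := fun y => ‖b j y - avgOn (b j) (cube c l)‖ₑ with hd
      have hN : (2 : ℝ≥0∞) ^ k ≠ 0 := by positivity
      have hN' : (2 : ℝ≥0∞) ^ k ≠ ∞ := by finiteness
      have hBc : B ⊆ cube c (2 ^ (8 * n) * l) := by
        refine (closedBall_subset_cube c _).trans (cube_subset_cube c ?_)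
        have : ((8 * n : ℕ) : ℝ) ≤ 2 ^ (8 * n) := by
          exact_mod_cast (Nat.lt_two_pow_self).le
        push_cast at this
        nlinarith
      have hosc := hC4 (b j) (hb j) (hbM j) c l hl (8 * n)
      calc ∫⁻ y in B, ‖(b j y - avgOn (b j) (cube c l)) * g j y‖ₑ
          ≤ ∫⁻ y in B, (2 ^ k * ‖g j y‖ₑ + ENNReal.ofReal a / (2 ^ k) ^ 3 * d y ^ 4) := by
            refine lintegral_mono_ae (ae_restrict_of_ae ?_)
            filter_upwards [hga j] with y hy
            have hy' : ‖g j y‖ₑ ≤ ENNReal.ofReal a := by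
              rw [Real.enorm_eq_ofReal_abs]
              exact ENNReal.ofReal_le_ofReal hy
            rw [enorm_mul]
            calc d y * ‖g j y‖ₑ ≤ (2 ^ k + d y ^ 4 / (2 ^ k) ^ 3) * ‖g j y‖ₑ := by
                  gcongr
                  exact ENNReal_le_add_pow_four hN hN'
              _ = 2 ^ k * ‖g j y‖ₑ + d y ^ 4 / (2 ^ k) ^ 3 * ‖g j y‖ₑ := add_mul _ _ _
              _ ≤ 2 ^ k * ‖g j y‖ₑ + d y ^ 4 / (2 ^ k) ^ 3 * ENNReal.ofReal a := by gcongr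
              _ = _ := by rw [div_eq_mul_inv, div_eq_mul_inv]; ring
        _ = 2 ^ k * (∫⁻ y in B, ‖g j y‖ₑ) +
              ENNReal.ofReal a / (2 ^ k) ^ 3 * ∫⁻ y in B, d y ^ 4 := by
            rw [lintegral_add_left' ((hgm j).const_mul _).restrict,
              lintegral_const_mul' _ _ hN', lintegral_const_mul' _ _ (by finiteness)]
        _ ≤ 2 ^ k * ENNReal.ofReal (C5 * (1 / 16) ^ k * a * l ^ n) +
              ENNReal.ofReal a / (2 ^ k) ^ 3 * (C4 * (1 + (8 * n : ℕ)) ^ 4 *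
                ENNReal.ofReal (2 ^ (8 * n) * l) ^ n) := by
            gcongr
            · exact hgB j
            · exact (lintegral_mono_set hBc).trans hosc
        _ = ENNReal.ofReal (2 ^ k * (C5 * (1 / 16) ^ k * a * l ^ n) +
              a / (2 ^ k) ^ 3 * (C4 * (1 + 8 * n) ^ 4 * (2 ^ (8 * n) * l) ^ n)) := by
            rw [ENNReal.ofReal_add (by positivity) (by positivity),
              ENNReal.ofReal_mul (p := 2 ^ k) (by positivity),
              ENNReal.ofReal_mul (p := a / (2 ^ k) ^ 3)
              (by positivity), ENNReal.ofReal_mul (p := C4 * (1 + 8 * n) ^ 4) (by positivity),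
              ENNReal.ofReal_mul (p := (C4 : ℝ)) (by positivity),
              ENNReal.ofReal_div_of_pos (by positivity)]
            simp only [ENNReal.ofReal_pow, zero_le_two, pow_nonneg, ENNReal.ofReal_ofNat,
              ENNReal.ofReal_coe_nnreal,
              ENNReal.ofReal_pow (show (0:ℝ) ≤ 2 ^ (8 * n) * l by positivity),
              ENNReal.ofReal_pow (show (0:ℝ) ≤ 1 + 8 * n by positivity)]
            rw [ENNReal.ofReal_add zero_le_one (by positivity), ENNReal.ofReal_one,
              ENNReal.ofReal_mul (p := 8) (by norm_num), ENNReal.ofReal_ofNat,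
              ENNReal.ofReal_natCast]
            push_cast
            rfl
        _ ≤ _ := by
            apply ENNReal.ofReal_le_ofReal
            apply le_of_eq
            rw [hC6, h8]
            have e1 : (2 : ℝ) ^ k * (1 / 2) ^ k = 1 := by rw [← mul_pow]; norm_num
            have e2 : a / ((2 : ℝ) ^ k) ^ 3 = (1 / 8) ^ k * a := by
              rw [← pow_mul, mul_comm k 3, pow_mul, one_div, inv_pow]
              norm_num
              rw [div_eq_inv_mul]
            rw [e2, mul_pow]
            linear_combination C5 * (1 / 8) ^ k * a * l ^ n * e1
    · refine le_trans ?_ (ENNReal.le_tsum k)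
      rw [indicator_of_mem (hmem x hx)]
      apply ENNReal.ofReal_le_ofReal
      rw [hβ]
      dsimp only
      rw [mul_pow, mul_pow]
      gcongr
      rw [← pow_mul, mul_comm k m, pow_mul]
      gcongr
      calc (1 / 8 : ℝ) ^ m ≤ (1 / 8) ^ 2 := pow_le_pow_of_le_one (by norm_num) (by norm_num) hm
        _ = 1 / 64 := by norm_num

/-! ### The weak type bound for truncated commutators of bounded functions -/

lemma aemeasurable_commSlot {n m : ℕ} {A : ℝ} {ω : ℝ → ℝ} {K : Rn n → (Fin m → Rn n) → ℝ}
    {T : (Fin m → Rn n → ℝ) → Rn n → ℝ} (h : CZ A ω K T) {J : Finset (Fin m)}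
    {b g : Fin m → Rn n → ℝ} (hb : ∀ j, LocallyIntegrable (b j) volume)
    (hg : ∀ j, Integrable (g j)) (hbg : ∀ j, Integrable fun y => b j y * g j y) :
    AEMeasurable (fun x => T (commSlot J b g x) x) := by
  have h1 := fun x => commSlot_expand (J := J) h.lin hg hbg 0 MeasurableSet.univ x
  simp only [indicator_univ] at h1
  have h1' : ∀ x, T (commSlot J b g x) x =
      ∑ S : Finset (Fin m), (∏ j ∈ S, if j ∈ J then b j x - (0 : Fin m → ℝ) j else 1) *
        T (commMix J b g 0 S) x := h1
  simp only [h1']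
  refine Finset.aemeasurable_fun_sum _ fun S _ => AEMeasurable.mul ?_
    (h.meas _ fun j => integrable_commMix hg hbg 0 S j).aemeasurable
  refine Finset.aemeasurable_fun_prod _ fun j _ => ?_
  split_ifs
  · exact (hb j).aestronglyMeasurable.aemeasurable.sub aemeasurable_const
  · exact aemeasurable_const

lemma volume_le_of_inter_hcube {n : ℕ} {E : Set (Rn n)} {W : ℝ≥0∞} (L : ℝ)
    (h : ∀ l, L ≤ l → 0 < l → volume (E ∩ hcube 0 l) ≤ W) : volume E ≤ W := by
  set L' := max L 1
  have hmono : Monotone fun k : ℕ => E ∩ hcube (0 : Rn n) (L' + k) := by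
    intro k k' hk x hx
    have hk' : (k : ℝ) ≤ k' := by exact_mod_cast hk
    exact ⟨hx.1, fun i => ⟨by linarith [(hx.2 i).1], by linarith [(hx.2 i).2]⟩⟩
  have hU : ⋃ k : ℕ, E ∩ hcube (0 : Rn n) (L' + k) = E := by
    refine Subset.antisymm (iUnion_subset fun k => inter_subset_left) fun x hx => ?_
    obtain ⟨k, hk⟩ := exists_nat_gt (2 * ‖x‖)
    refine mem_iUnion.2 ⟨k, hx, fun i => ?_⟩
    have h1 : |x i| ≤ ‖x‖ := PiLp.norm_apply_le x i
    have h2 : (1 : ℝ) ≤ L' := le_max_right _ _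
    rw [abs_le] at h1
    simp only [PiLp.zero_apply]
    constructor <;> linarith [h1.1, h1.2]
  rw [← hU, hmono.measure_iUnion]
  have h2 : (1 : ℝ) ≤ L' := le_max_right _ _
  exact iSup_le fun k => h _ ((le_max_left _ _).trans (by linarith [k.cast_nonneg (α := ℝ)]))
    (by linarith [k.cast_nonneg (α := ℝ)])

lemma CZ.exists_volume_commSlot_le {n m : ℕ} (hn : 1 ≤ n) (hm : 2 ≤ m) (ω : ℝ → ℝ) {M : ℝ}
    (hM : 0 < M) :
    ∃ C : ℝ, 0 < C ∧ ∀ (A : ℝ) (K : Rn n → (Fin m → Rn n) → ℝ)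
      (T : (Fin m → Rn n → ℝ) → Rn n → ℝ), CZ A ω K T →
      ∀ (J : Finset (Fin m)) (b g : Fin m → Rn n → ℝ), (∀ j, LocallyIntegrable (b j) volume) →
      (∀ j, OscBound (b j) M) → (∀ j, Integrable (g j)) → (∀ j, HasCompactSupport (g j)) →
      (∀ j, Integrable fun y => b j y * g j y) → ∀ a I : ℝ, 0 < a → 0 < I →
      (∀ j, ∀ᵐ x, |g j x| ≤ a) → (∀ j, ∫⁻ y, ‖g j y‖ₑ ≤ ENNReal.ofReal I) → ∀ t, 0 < t →
      volume {x | t < |T (commSlot J b g x) x|} ≤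
        ENNReal.ofReal (C * (A * a ^ (m - 1) * I) / t) := by
  obtain ⟨C, hC⟩ := CZ.exists_iterate hn (by omega : 1 ≤ m) ω hM
  obtain ⟨C', hC'0, hC'⟩ := exists_commutator_majorant hn hm hM
  refine ⟨(C + 1) * C', by positivity, ?_⟩
  intro A K T h J b g hb hbM hg hgc hbg a I ha hI hga hgI t ht
  have hA := h.pos
  have hn1 : (1 : ℝ) ≤ n := by exact_mod_cast hn
  obtain ⟨V, hVi, hV⟩ := hC' b g hb hbM hg A a I hA ha hI hga hgI
  have hit := hC A K T h J b g hb hbM hg hgc hbg V hV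
  obtain ⟨r, hr⟩ : ∃ r, ∀ j, tsupport (g j) ⊆ closedBall 0 r := by
    choose r hr using fun j => (hgc j).isCompact.isBounded.subset_closedBall 0
    obtain ⟨r', hr'⟩ := (Set.finite_range r).bddAbove
    exact ⟨r', fun j => (hr j).trans (closedBall_subset_closedBall (hr' (mem_range_self j)))⟩
  have hUm := aemeasurable_commSlot (J := J) h hb hg hbg
  refine volume_le_of_inter_hcube r fun l hrl hl => ?_
  have hind : ∀ x, (fun j => (closedBall 0 (4 * n * l)).indicator (commSlot J b g x j)) =
      commSlot J b g x := fun x => by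
    funext j
    refine indicator_eq_self.2 fun y hy => ?_
    have h1 : y ∈ tsupport (g j) := by
      refine subset_tsupport _ fun h0 => hy ?_
      simp [commSlot, h0]
    exact closedBall_subset_closedBall (by nlinarith) (hr j h1)
  have hit0 := fun N => hit N 0 l hl
  simp only [hind] at hit0
  have hmain : ∀ N : ℕ, volume ({x | t < |T (commSlot J b g x) x|} ∩ hcube 0 l) ≤
      ENNReal.ofReal l ^ n * (1 / 2) ^ N + C * (∫⁻ x, V x) / ENNReal.ofReal t := by
    intro N
    obtain ⟨R, hRm, hRs, hRv, hRi⟩ := hit0 N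
    have hsub : {x | t < |T (commSlot J b g x) x|} ∩ hcube 0 l ⊆
        R ∪ {x | ENNReal.ofReal t ≤ ‖T (commSlot J b g x) x‖ₑ} ∩ (hcube 0 l \ R) := by
      intro x hx
      by_cases hxR : x ∈ R
      · exact Or.inl hxR
      · refine Or.inr ⟨?_, hx.2, hxR⟩
        show ENNReal.ofReal t ≤ _
        rw [Real.enorm_eq_ofReal_abs]
        exact ENNReal.ofReal_le_ofReal (le_of_lt hx.1)
    have hPm : MeasurableSet (hcube (0 : Rn n) l \ R) := (measurableSet_hcube _ _).diff hRm
    refine (measure_mono hsub).trans ((measure_union_le _ _).trans (add_le_add ?_ ?_))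
    · refine hRv.trans (le_of_eq ?_)
      rw [div_eq_mul_inv, one_div, ENNReal.inv_pow]
    · rw [← Measure.restrict_apply' hPm]
      refine (meas_ge_le_lintegral_div hUm.enorm.restrict (by positivity)
        ENNReal.ofReal_ne_top).trans ?_
      refine ENNReal.div_le_div_right (hRi.trans ?_) _
      gcongr
      exact Measure.restrict_le_self
  have hlim : Tendsto (fun N : ℕ => ENNReal.ofReal l ^ n * (1 / 2) ^ N +
      C * (∫⁻ x, V x) / ENNReal.ofReal t) atTop
      (𝓝 (ENNReal.ofReal l ^ n * 0 + C * (∫⁻ x, V x) / ENNReal.ofReal t)) := by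
    refine Tendsto.add_const _ (ENNReal.Tendsto.const_mul ?_ (Or.inr (by finiteness)))
    refine ENNReal.tendsto_pow_atTop_nhds_zero_of_lt_one ?_
    rw [one_div]
    exact ENNReal.inv_lt_one.2 (by norm_num)
  refine (ge_of_tendsto' hlim hmain).trans ?_
  rw [mul_zero, zero_add]
  have hX : 0 ≤ C' * (A * a ^ (m - 1) * I) := by positivity
  calc C * (∫⁻ x, V x) / ENNReal.ofReal t
      ≤ ENNReal.ofReal C * ENNReal.ofReal (C' * (A * a ^ (m - 1) * I)) / ENNReal.ofReal t := by
        rw [ENNReal.ofReal_coe_nnreal]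
        gcongr
    _ = ENNReal.ofReal (C * (C' * (A * a ^ (m - 1) * I)) / t) := by
        rw [ENNReal.ofReal_div_of_pos ht, ← ENNReal.ofReal_mul (by positivity)]
    _ ≤ _ := by
        apply ENNReal.ofReal_le_ofReal
        rw [mul_assoc ((C : ℝ) + 1)]
        gcongr
        linarith

/-- A `CZ` operator with one slot does not distinguish almost everywhere equal inputs. -/
lemma CZ.ae_eq_of_ae_eq {n m : ℕ} {A : ℝ} {ω : ℝ → ℝ} {K : Rn n → (Fin m → Rn n) → ℝ}
    {T : (Fin m → Rn n → ℝ) → Rn n → ℝ} (h : CZ A ω K T) (hm : m = 1) {f f' : Fin m → Rn n → ℝ}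
    (hf : ∀ j, Integrable (f j)) (hff : ∀ j, f j =ᵐ[volume] f' j) :
    ∀ᵐ x, T f x = T f' x := by
  subst hm
  have hf' : ∀ j, Integrable (f' j) := fun j => (hf j).congr (hff j)
  set d : Fin 1 → Rn n → ℝ := Function.update f 0 (fun y => f 0 y - f' 0 y) with hd
  have hdi : ∀ j, Integrable (d j) := fun j => by
    rw [Subsingleton.elim j 0, hd, Function.update_self]
    exact (hf 0).sub (hf' 0)
  have hsub := h.lin.update_sub hf hf' 0 fun j hj => absurd (Subsingleton.elim j 0) hj
  have hd0 : l1norm (d 0) = 0 := by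
    rw [l1norm, hd, Function.update_self]
    refine integral_eq_zero_of_ae ?_
    filter_upwards [hff 0] with y hy
    simp [hy]
  have hw : ∀ k : ℕ, volume {x | 1 / ((k : ℝ) + 1) < |T d x|} = 0 := fun k => by
    have := h.weak d hdi (1 / ((k : ℝ) + 1)) (by positivity)
    simpa [hd0] using this
  have h0 : ∀ᵐ x, ∀ k : ℕ, ¬ (1 / ((k : ℝ) + 1) < |T d x|) :=
    ae_all_iff.2 fun k => measure_eq_zero_iff_ae_notMem.1 (hw k)
  filter_upwards [h0] with x hx
  rw [← sub_eq_zero, hsub x]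
  by_contra hne
  obtain ⟨k, hk⟩ := exists_nat_one_div_lt (abs_pos.2 hne)
  exact hx k hk

lemma CZ.exists_volume_commSlot_le_one {n m : ℕ} {A : ℝ} {ω : ℝ → ℝ}
    {K : Rn n → (Fin m → Rn n) → ℝ} {T : (Fin m → Rn n → ℝ) → Rn n → ℝ} (h : CZ A ω K T)
    (hm : m = 1) {b : Fin m → Rn n → ℝ}
    (hcomm : ∀ f : Fin m → Rn n → ℝ, (∀ j, Measurable (f j)) →
      (∀ j, ∃ A : ℝ, ∀ x, |f j x| ≤ A) → (∀ j, HasCompactSupport (f j)) →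
      ∀ lam : ℝ, 0 < lam → volume {x | lam < |iterComm T b f x|} ≤
        ENNReal.ofReal ((A * (∏ j, l2norm (f j)) / lam) ^ ((2:ℝ)/(m:ℝ))))
    {J : Finset (Fin m)} {g : Fin m → Rn n → ℝ} (hg : ∀ j, Integrable (g j))
    (hgc : ∀ j, HasCompactSupport (g j)) (hbg : ∀ j, Integrable fun y => b j y * g j y)
    {a I : ℝ} (ha : 0 < a) (hI : 0 < I) (hga : ∀ j, ∀ᵐ x, |g j x| ≤ a)
    (hgI : ∀ j, ∫⁻ y, ‖g j y‖ₑ ≤ ENNReal.ofReal I) {t : ℝ} (ht : 0 < t) :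
    volume {x | t < |T (commSlot J b g x) x|} ≤
      ENNReal.ofReal (A * I / t + A ^ 2 * a * I / t ^ 2) := by
  subst hm
  have hA := h.pos
  have hgI' : ∀ j, l1norm (g j) ≤ I := fun j => by
    have := hgI j
    rw [← ofReal_integral_norm_eq_lintegral_enorm (hg j),
      ENNReal.ofReal_le_ofReal_iff hI.le] at this
    exact this
  by_cases hJ : (0 : Fin 1) ∈ J
  · obtain ⟨R, hR⟩ := (hgc 0).isCompact.isBounded.subset_closedBall 0
    set g₀ := (hg 0).1.mk (g 0) with hg₀
    have hg₀m : Measurable g₀ := (hg 0).1.stronglyMeasurable_mk.measurable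
    have hms : MeasurableSet ({x | |g₀ x| ≤ a} ∩ closedBall (0 : Rn n) R) :=
      (measurableSet_le hg₀m.abs measurable_const).inter measurableSet_closedBall
    set g' : Fin 1 → Rn n → ℝ := fun _ => ({x | |g₀ x| ≤ a} ∩ closedBall 0 R).indicator g₀
      with hg'
    have hgg' : ∀ j, g j =ᵐ[volume] g' j := fun j => by
      rw [Subsingleton.elim j 0]
      filter_upwards [(hg 0).1.ae_eq_mk, hga 0] with x hx hxa
      by_cases hxR : x ∈ closedBall (0 : Rn n) R
      · simp only [hg']
        rw [indicator_of_mem, hx]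
        exact ⟨show |g₀ x| ≤ a by rw [hg₀, ← hx]; exact hxa, hxR⟩
      · simp only [hg']
        rw [indicator_of_notMem fun hc => hxR hc.2]
        by_contra hne
        exact hxR (hR (subset_tsupport _ hne))
    have hg'a : ∀ j x, |g' j x| ≤ a := fun j x => by
      by_cases hx : x ∈ {x | |g₀ x| ≤ a} ∩ closedBall (0 : Rn n) R
      · simp only [hg']
        rw [indicator_of_mem hx]; exact hx.1
      · simp only [hg']
        rw [indicator_of_notMem hx, abs_zero]; exact ha.le
    have hg'i : ∀ j, Integrable (g' j) := fun j => (hg j).congr (hgg' j)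
    have hbgg' : ∀ j, (fun y => b j y * g j y) =ᵐ[volume] fun y => b j y * g' j y := fun j => by
      filter_upwards [hgg' j] with y hy
      rw [hy]
    have hbg' : ∀ j, Integrable fun y => b j y * g' j y := fun j => (hbg j).congr (hbgg' j)
    have hexp : ∀ (u : Fin 1 → Rn n → ℝ), (∀ j, Integrable (u j)) →
        (∀ j, Integrable fun y => b j y * u j y) → ∀ x,
        T (commSlot J b u x) x = b 0 x * T u x - T (fun j y => b j y * u j y) x := by
      intro u hu hbu x
      have h1 := h.lin.smul_univ (fun j => b j x) hu x
      rw [Fin.prod_univ_one] at h1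
      have h2 := h.lin.update_sub (p := fun j y => b j x * u j y) (q := fun j y => b j y * u j y)
        (fun j => (hu j).const_mul _) hbu 0 (fun j hj => absurd (Subsingleton.elim j 0) hj) x
      rw [← h1, h2]
      congr 1
      funext j y
      rw [Subsingleton.elim j 0, Function.update_self, commSlot, if_pos hJ]
    have hae : ∀ᵐ x, T (commSlot J b g x) x = iterComm T b g' x := by
      filter_upwards [h.ae_eq_of_ae_eq rfl hg hgg', h.ae_eq_of_ae_eq rfl hbg hbgg'] with x h1 h2
      rw [hexp g hg hbg, h1, h2, ← hexp g' hg'i hbg', iterComm_eq h.lin hg'i hbg']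
      congr 1
      funext j y
      rw [Subsingleton.elim j 0, commSlot, if_pos hJ]
    have hvol : volume {x | t < |T (commSlot J b g x) x|} =
        volume {x | t < |iterComm T b g' x|} := by
      apply measure_congr
      filter_upwards [hae] with x hx
      exact congrArg (fun s => t < |s|) hx
    rw [hvol]
    refine (hcomm g' (fun _ => hg₀m.indicator hms) (fun j => ⟨a, hg'a j⟩) (fun j => ?_) t ht).trans
      (ENNReal.ofReal_le_ofReal ?_)
    · refine HasCompactSupport.of_support_subset_isCompact (isCompact_closedBall 0 R)
        fun x hx => ?_
      by_contra hc
      exact hx (indicator_of_notMem (fun hx' => hc hx'.2) _)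
    · have hsq : ∫ x, g' 0 x ^ 2 ≤ a * I := by
        calc ∫ x, g' 0 x ^ 2 ≤ ∫ x, a * |g' 0 x| := by
              refine integral_mono_of_nonneg (Eventually.of_forall fun x => sq_nonneg _)
                ((hg'i 0).abs.const_mul a) (Eventually.of_forall fun x => ?_)
              show g' 0 x ^ 2 ≤ a * |g' 0 x|
              rw [← sq_abs, sq]
              exact mul_le_mul_of_nonneg_right (hg'a 0 x) (abs_nonneg _)
          _ = a * l1norm (g 0) := by
              rw [integral_const_mul, l1norm]
              congr 1
              refine integral_congr_ae ?_
              filter_upwards [hgg' 0] with x hx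
              rw [hx]
          _ ≤ a * I := by gcongr; exact hgI' 0
      have h0 : 0 ≤ ∫ x, g' 0 x ^ 2 := integral_nonneg fun x => sq_nonneg _
      have hl2 : l2norm (g' 0) ^ 2 = ∫ x, g' 0 x ^ 2 := by
        rw [l2norm, ← Real.rpow_natCast, ← Real.rpow_mul h0]
        norm_num
      have e1 : (A * (∏ j, l2norm (g' j)) / t) ^ ((2 : ℝ) / ((1 : ℕ) : ℝ)) =
          A ^ 2 * (∫ x, g' 0 x ^ 2) / t ^ 2 := by
        rw [Fin.prod_univ_one, Nat.cast_one, div_one, Real.rpow_two, div_pow, mul_pow, hl2]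
      rw [e1]
      calc A ^ 2 * (∫ x, g' 0 x ^ 2) / t ^ 2 ≤ A ^ 2 * (a * I) / t ^ 2 := by gcongr
        _ = A ^ 2 * a * I / t ^ 2 := by ring
        _ ≤ _ := le_add_of_nonneg_left (by positivity)
  · have e : ∀ x, commSlot J b g x = g := fun x => by
      funext j y
      rw [Subsingleton.elim j 0, commSlot, if_neg hJ]
    simp only [e]
    refine (h.weak g hg t ht).trans (ENNReal.ofReal_le_ofReal ?_)
    rw [Fin.prod_univ_one, Nat.cast_one, div_one, Real.rpow_one]
    calc A * l1norm (g 0) / t ≤ A * I / t := by gcongr; exact hgI' 0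
      _ ≤ _ := le_add_of_nonneg_right (by positivity)

/-- The weak type bound for bounded functions, at the height dictated by the exponents. -/
lemma CZ.exists_volume_commSlot_good {n m : ℕ} (hn : 1 ≤ n) (hm : 1 ≤ m) (ω : ℝ → ℝ) {M B : ℝ}
    (hM : 0 < M) (hB : 0 < B) :
    ∃ C : ℝ, 0 < C ∧ ∀ (A : ℝ) (K : Rn n → (Fin m → Rn n) → ℝ)
      (T : (Fin m → Rn n → ℝ) → Rn n → ℝ), CZ A ω K T →
      ∀ (b : Fin m → Rn n → ℝ), (∀ j, LocallyIntegrable (b j) volume) →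
      (∀ j, OscBound (b j) M) →
      (∀ f : Fin m → Rn n → ℝ, (∀ j, Measurable (f j)) →
        (∀ j, ∃ A : ℝ, ∀ x, |f j x| ≤ A) → (∀ j, HasCompactSupport (f j)) →
        ∀ lam : ℝ, 0 < lam → volume {x | lam < |iterComm T b f x|} ≤
          ENNReal.ofReal ((A * (∏ j, l2norm (f j)) / lam) ^ ((2:ℝ)/(m:ℝ)))) →
      ∀ (J : Finset (Fin m)) (g : Fin m → Rn n → ℝ),
      (∀ j, Integrable (g j)) → (∀ j, HasCompactSupport (g j)) →
      (∀ j, Integrable fun y => b j y * g j y) → ∀ α : ℝ, 0 < α →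
      (∀ j, ∀ᵐ x, |g j x| ≤ B * α) → (∀ j, ∫⁻ y, ‖g j y‖ₑ ≤ ENNReal.ofReal B) →
      volume {x | A * α ^ m < |T (commSlot J b g x) x|} ≤ ENNReal.ofReal (C / α) := by
  rcases Nat.lt_or_ge 1 m with h2 | h1
  · obtain ⟨C, hC0, hC⟩ := CZ.exists_volume_commSlot_le hn (by omega : 2 ≤ m) ω hM
    refine ⟨C * B ^ m, by positivity, ?_⟩
    intro A K T h b hb hbM _ J g hg hgc hbg α hα hga hgI
    have hA := h.pos
    refine (hC A K T h J b g hb hbM hg hgc hbg (B * α) B (by positivity) hB hga hgI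
      (A * α ^ m) (by positivity)).trans (ENNReal.ofReal_le_ofReal (le_of_eq ?_))
    obtain ⟨m', rfl⟩ : ∃ m', m = m' + 1 := ⟨m - 1, by omega⟩
    rw [Nat.add_sub_cancel, mul_pow, pow_succ, pow_succ]
    field_simp
  · have hm1 : m = 1 := by omega
    refine ⟨B + B ^ 2, by positivity, ?_⟩
    intro A K T h b hb hbM hcomm J g hg hgc hbg α hα hga hgI
    have hA := h.pos
    refine (h.exists_volume_commSlot_le_one hm1 hcomm hg hgc hbg (by positivity) hB hga hgI
      (by positivity)).trans (ENNReal.ofReal_le_ofReal (le_of_eq ?_))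
    rw [hm1]
    field_simp

/-! ### The maximal commutator -/

/-- The superlevel sets of the maximal commutator. -/
def commMaxSet {n : ℕ} (b g : Rn n → ℝ) (t : ℝ≥0∞) : Set (Rn n) :=
  {x | ∃ R : ℝ, 0 < R ∧
    t * ENNReal.ofReal R ^ n < ∫⁻ y in closedBall x R, ‖b x - b y‖ₑ * ‖g y‖ₑ}

lemma volume_lt_osc_le {n : ℕ} {b : Rn n → ℝ} (hb : LocallyIntegrable b volume) {C1 C4 : ℝ≥0}
    (hmax : ∀ (h : Rn n → ℝ≥0∞) (t : ℝ≥0∞), t ≠ 0 → (∫⁻ y, h y) ≠ ∞ →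
      volume (maxSet h t) ≤ C1 * ((∫⁻ y, h y) / t)) {z : Rn n} {l β : ℝ}
    (hC4 : ∫⁻ x in cube z l, ‖b x - β‖ₑ ^ 4 ≤ C4 * ENNReal.ofReal l ^ n) (s : ℕ) :
    volume ({x ∈ cube z l | 2 ^ s < ‖b x - β‖ₑ} ∪
      maxSet ((cube z l).indicator fun y => ‖b y - β‖ₑ ^ 4) (8 ^ s)) ≤
      (1 + C1) * C4 * ENNReal.ofReal l ^ n / 8 ^ s := by
  have hm : AEMeasurable fun x => ‖b x - β‖ₑ ^ 4 :=
    (hb.aestronglyMeasurable.aemeasurable.sub aemeasurable_const).enorm.pow_const 4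
  have hQ := measurableSet_cube z l
  have h1 : volume {x ∈ cube z l | 2 ^ s < ‖b x - β‖ₑ} ≤
      C4 * ENNReal.ofReal l ^ n / 8 ^ s := by
    calc volume {x ∈ cube z l | 2 ^ s < ‖b x - β‖ₑ}
        ≤ volume.restrict (cube z l) {x | (8 : ℝ≥0∞) ^ s ≤ ‖b x - β‖ₑ ^ 4} := by
          rw [Measure.restrict_apply' hQ]
          refine measure_mono fun x hx => ⟨?_, hx.1⟩
          show (8 : ℝ≥0∞) ^ s ≤ ‖b x - β‖ₑ ^ 4
          calc (8 : ℝ≥0∞) ^ s ≤ 16 ^ s := by gcongr; norm_num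
            _ = (2 ^ s) ^ 4 := by rw [← pow_mul, mul_comm, pow_mul]; norm_num
            _ ≤ _ := by gcongr; exact hx.2.le
      _ ≤ (∫⁻ x in cube z l, ‖b x - β‖ₑ ^ 4) / 8 ^ s :=
          meas_ge_le_lintegral_div hm.restrict (by positivity) (by finiteness)
      _ ≤ _ := ENNReal.div_le_div_right hC4 _
  have hi : ∫⁻ y, (cube z l).indicator (fun y => ‖b y - β‖ₑ ^ 4) y ≤
      C4 * ENNReal.ofReal l ^ n := by rwa [lintegral_indicator hQ]
  have h2 := hmax ((cube z l).indicator fun y => ‖b y - β‖ₑ ^ 4) (8 ^ s) (by positivity)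
    (ne_top_of_le_ne_top (by finiteness) hi)
  refine (measure_union_le _ _).trans ((add_le_add h1 (h2.trans ?_)).trans
    (le_of_eq (?_ : _ + C1 * (C4 * ENNReal.ofReal l ^ n / 8 ^ s) = _)))
  · exact mul_le_mul_right (ENNReal.div_le_div_right hi _) _
  · simp only [div_eq_mul_inv]
    ring

lemma volume_commMaxSet_le {n : ℕ} (hn : 1 ≤ n) {M : ℝ} (hM : 0 < M) :
    ∃ C : ℝ, 0 < C ∧ ∀ b g : Rn n → ℝ, LocallyIntegrable b volume → OscBound b M →
      Integrable g → ∀ a I : ℝ, 0 < a → 0 < I → (∀ᵐ x, |g x| ≤ a) →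
      ∫⁻ y, ‖g y‖ₑ ≤ ENNReal.ofReal I →
      volume (commMaxSet b g (ENNReal.ofReal (C * a))) ≤ ENNReal.ofReal (C * I / a) := by
  obtain ⟨C1, hC1, hmax⟩ := volume_maxSet_le hn
  obtain ⟨C4, hC4⟩ := lintegral_cube_osc_pow_le hn hM 4
  set v : ℝ := (volume (ball (0 : Rn n) 1)).toReal with hv
  have hv1t : volume (ball (0 : Rn n) 1) ≠ ∞ := measure_ball_lt_top.ne
  have hv0 : 0 < v := ENNReal.toReal_pos (measure_ball_pos _ _ one_pos).ne' hv1t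
  set C' : ℝ := (1 + C1) * C4 * 10 ^ n * 4 / v with hC'
  have hC'0 : 0 ≤ C' := by positivity
  refine ⟨2 * v + 1 + C', by positivity, fun b g hb hbM hg a I ha hI hga hgI => ?_⟩
  have hut : ∫⁻ y, ‖g y‖ₑ ≠ ∞ := ne_top_of_le_ne_top ENNReal.ofReal_ne_top hgI
  set t : ℕ → ℝ≥0∞ := fun s => ENNReal.ofReal (a * v * (1 / 2) ^ s) with ht
  have ht0 : ∀ s, t s ≠ 0 := fun s => by simp only [ht]; positivity
  set F : ℕ → Set (Rn n × ℝ) := fun s =>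
    {p | 0 < p.2 ∧ t (s + 1) * ENNReal.ofReal p.2 ^ n < ∫⁻ y in closedBall p.1 p.2, ‖g y‖ₑ}
    with hF
  choose u huF huc hucov husum using fun s =>
    exists_vitali_family hn (fun y => ‖g y‖ₑ) (t (s + 1)) (ht0 _) hut (F s) fun p hp => hp
  set Q : Rn n × ℝ → Set (Rn n) := fun p => cube p.1 (2 * (5 * p.2)) with hQ
  set β : Rn n × ℝ → ℝ := fun p => avgOn b (Q p) with hβ
  set Z : ℕ → Rn n × ℝ → Set (Rn n) := fun s p => {x ∈ Q p | 2 ^ s < ‖b x - β p‖ₑ} ∪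
      maxSet ((Q p).indicator fun y => ‖b y - β p‖ₑ ^ 4) (8 ^ s) with hZ
  have hcover : commMaxSet b g (ENNReal.ofReal ((2 * v + 1 + C') * a)) ⊆
      ⋃ s, ⋃ p ∈ u s, Z s p := by
    rintro x ⟨R, hR, hx⟩
    set G := ∫⁻ y in closedBall x R, ‖g y‖ₑ with hG
    have hGt : G ≠ ∞ := ne_top_of_le_ne_top hut (setLIntegral_le_lintegral _ _)
    have hG0 : G ≠ 0 := fun h0 => by
      rw [hG, lintegral_eq_zero_iff' hg.1.aemeasurable.enorm.restrict] at h0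
      have : ∫⁻ y in closedBall x R, ‖b x - b y‖ₑ * ‖g y‖ₑ = 0 := by
        rw [lintegral_congr_ae (g := fun _ => (0 : ℝ≥0∞)), lintegral_zero]
        filter_upwards [h0] with y hy
        rw [hy, Pi.zero_apply, mul_zero]
      rw [this] at hx
      exact absurd hx (not_lt.2 zero_le)
    have hGle : G ≤ t 0 * ENNReal.ofReal R ^ n := by
      calc G ≤ ∫⁻ _ in closedBall x R, ENNReal.ofReal a := by
            refine lintegral_mono_ae (ae_restrict_of_ae ?_)
            filter_upwards [hga] with y hy
            rw [Real.enorm_eq_ofReal_abs]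
            exact ENNReal.ofReal_le_ofReal hy
        _ = _ := by
            rw [setLIntegral_const, volume_closedBall_Rn x hR.le, ht]
            simp only [pow_zero, mul_one]
            rw [ENNReal.ofReal_mul ha.le, hv, ENNReal.ofReal_toReal hv1t]
            ring
    have hRn : ENNReal.ofReal R ^ n ≠ 0 := by positivity
    have hRt : ENNReal.ofReal R ^ n ≠ ∞ := by finiteness
    have hex : ∃ s, t (s + 1) * ENNReal.ofReal R ^ n < G := by
      have hlim : Tendsto (fun s : ℕ => t (s + 1) * ENNReal.ofReal R ^ n) atTop
          (𝓝 (ENNReal.ofReal (a * v * 0) * ENNReal.ofReal R ^ n)) := by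
        refine ENNReal.Tendsto.mul_const (ENNReal.tendsto_ofReal ?_) (Or.inr hRt)
        exact Tendsto.const_mul _ ((tendsto_pow_atTop_nhds_zero_of_lt_one (by norm_num)
          (by norm_num)).comp (tendsto_add_atTop_nat 1))
      rw [mul_zero, ENNReal.ofReal_zero, zero_mul] at hlim
      exact (hlim.eventually (gt_mem_nhds (pos_iff_ne_zero.2 hG0))).exists
    classical
    set s := Nat.find hex with hs
    have hs1 : t (s + 1) * ENNReal.ofReal R ^ n < G := Nat.find_spec hex
    have hs2 : G ≤ t s * ENNReal.ofReal R ^ n := by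
      rcases Nat.eq_zero_or_pos s with h0 | h0
      · rwa [h0]
      · have := Nat.find_min hex (m := s - 1) (by omega)
        rwa [not_lt, Nat.sub_add_cancel h0] at this
    obtain ⟨p, hpu, hsub⟩ := hucov s (x, R) ⟨hR, hs1⟩
    have hsubQ : closedBall x R ⊆ Q p := hsub.trans (closedBall_subset_cube _ _)
    refine mem_iUnion.2 ⟨s, mem_iUnion₂.2 ⟨p, hpu, ?_⟩⟩
    by_contra hxZ
    have hx1 : ‖b x - β p‖ₑ ≤ 2 ^ s := by
      by_contra hc
      exact hxZ (Or.inl ⟨hsubQ (mem_closedBall_self hR.le), not_le.1 hc⟩)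
    have hx2 := lintegral_closedBall_le_of_notMem_maxSet (fun hc => hxZ (Or.inr hc)) hR
    have hx3 : ∫⁻ y in closedBall x R, ‖b y - β p‖ₑ ^ 4 ≤ 8 ^ s * ENNReal.ofReal R ^ n := by
      refine le_trans (le_of_eq ?_) hx2
      refine setLIntegral_congr_fun measurableSet_closedBall fun y hy => ?_
      exact (indicator_of_mem (f := fun y => ‖b y - β p‖ₑ ^ 4) (hsubQ hy)).symm
    have h2s : (2 : ℝ≥0∞) ^ s ≠ 0 := pow_ne_zero _ two_ne_zero
    have h2s' : (2 : ℝ≥0∞) ^ s ≠ ∞ := by finiteness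
    have h2t : 2 ^ s * t s = ENNReal.ofReal (a * v) := by
      simp only [ht]
      rw [show (2 : ℝ≥0∞) ^ s = ENNReal.ofReal (2 ^ s) by
        rw [ENNReal.ofReal_pow (by norm_num), ENNReal.ofReal_ofNat],
        ← ENNReal.ofReal_mul (by positivity)]
      congr 1
      have : (2 : ℝ) ^ s * (1 / 2) ^ s = 1 := by rw [← mul_pow]; norm_num
      linear_combination a * v * this
    refine absurd hx (not_lt.2 ?_)
    calc ∫⁻ y in closedBall x R, ‖b x - b y‖ₑ * ‖g y‖ₑ
        ≤ ∫⁻ y in closedBall x R, ((2 ^ s * ‖g y‖ₑ + 2 ^ s * ‖g y‖ₑ) +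
            ENNReal.ofReal a / (2 ^ s) ^ 3 * ‖b y - β p‖ₑ ^ 4) := by
          refine lintegral_mono_ae (ae_restrict_of_ae ?_)
          filter_upwards [hga] with y hy
          have hy' : ‖g y‖ₑ ≤ ENNReal.ofReal a := by
            rw [Real.enorm_eq_ofReal_abs]
            exact ENNReal.ofReal_le_ofReal hy
          have h3 : ‖b x - b y‖ₑ ≤ ‖b x - β p‖ₑ + ‖b y - β p‖ₑ := by
            calc ‖b x - b y‖ₑ = ‖(b x - β p) - (b y - β p)‖ₑ := by congr 1; ring
              _ ≤ _ := enorm_sub_le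
          calc ‖b x - b y‖ₑ * ‖g y‖ₑ
              ≤ (2 ^ s + (2 ^ s + ‖b y - β p‖ₑ ^ 4 / (2 ^ s) ^ 3)) * ‖g y‖ₑ := by
                gcongr
                exact h3.trans (add_le_add hx1 (ENNReal_le_add_pow_four h2s h2s'))
            _ = (2 ^ s * ‖g y‖ₑ + 2 ^ s * ‖g y‖ₑ) +
                  ‖b y - β p‖ₑ ^ 4 / (2 ^ s) ^ 3 * ‖g y‖ₑ := by ring
            _ ≤ (2 ^ s * ‖g y‖ₑ + 2 ^ s * ‖g y‖ₑ) +
                  ‖b y - β p‖ₑ ^ 4 / (2 ^ s) ^ 3 * ENNReal.ofReal a := by gcongr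
            _ = _ := by rw [div_eq_mul_inv, div_eq_mul_inv]; ring
      _ = (2 ^ s * G + 2 ^ s * G) +
            ENNReal.ofReal a / (2 ^ s) ^ 3 * ∫⁻ y in closedBall x R, ‖b y - β p‖ₑ ^ 4 := by
          have hgm := (hg.1.aemeasurable.enorm.const_mul ((2 : ℝ≥0∞) ^ s)).restrict
            (s := closedBall x R)
          rw [lintegral_add_left' (f := fun y => 2 ^ s * ‖g y‖ₑ + 2 ^ s * ‖g y‖ₑ)
            (hgm.add hgm), lintegral_add_left' hgm,
            lintegral_const_mul' _ _ h2s', lintegral_const_mul' _ _ (by finiteness)]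
      _ ≤ (2 ^ s * (t s * ENNReal.ofReal R ^ n) + 2 ^ s * (t s * ENNReal.ofReal R ^ n)) +
            ENNReal.ofReal a / (2 ^ s) ^ 3 * (8 ^ s * ENNReal.ofReal R ^ n) := by gcongr
      _ = (2 ^ s * t s + 2 ^ s * t s + ENNReal.ofReal a) * ENNReal.ofReal R ^ n := by
          have h8 : ((2 : ℝ≥0∞) ^ s) ^ 3 = 8 ^ s := by
            rw [← pow_mul, mul_comm, pow_mul]; norm_num
          have h9 : ENNReal.ofReal a / 8 ^ s * (8 ^ s * ENNReal.ofReal R ^ n) =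
              ENNReal.ofReal a * ENNReal.ofReal R ^ n := by
            rw [← mul_assoc, ENNReal.div_mul_cancel (by positivity) (by finiteness)]
          rw [h8, h9]
          ring
      _ ≤ _ := by
          gcongr
          rw [h2t, ← ENNReal.ofReal_add (by positivity) (by positivity),
            ← ENNReal.ofReal_add (by positivity) (by positivity)]
          apply ENNReal.ofReal_le_ofReal
          nlinarith [mul_nonneg hC'0 ha.le]
  have hZv : ∀ s p, p ∈ u s → volume (Z s p) ≤
      (1 + C1) * C4 * 10 ^ n / 8 ^ s * ENNReal.ofReal p.2 ^ n := fun s p hp => by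
    have hp0 : 0 < p.2 := (huF s hp).1
    have h1 := hC4 b hb hbM p.1 (2 * (5 * p.2)) (by positivity) 0
    rw [pow_zero, one_mul, Nat.cast_zero, add_zero, one_pow, mul_one] at h1
    refine (volume_lt_osc_le hb hmax h1 s).trans (le_of_eq ?_)
    rw [show 2 * (5 * p.2) = 10 * p.2 by ring, ENNReal.ofReal_mul (by norm_num), mul_pow,
      ENNReal.ofReal_ofNat]
    simp only [div_eq_mul_inv]
    ring
  have hs : ∀ s, volume (⋃ p ∈ u s, Z s p) ≤
      ENNReal.ofReal ((1 + C1) * C4 * 10 ^ n * 2 / v * I / a) * ENNReal.ofReal ((1 / 2) ^ s) := by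
    intro s
    have : Countable (u s) := (huc s).to_subtype
    calc volume (⋃ p ∈ u s, Z s p) ≤ ∑' p : u s, volume (Z s p.1) :=
          measure_biUnion_le volume (huc s) _
      _ ≤ ∑' p : u s, (1 + C1) * C4 * 10 ^ n / 8 ^ s * ENNReal.ofReal p.1.2 ^ n :=
          ENNReal.tsum_le_tsum fun p => hZv s p.1 p.2
      _ ≤ (1 + C1) * C4 * 10 ^ n / 8 ^ s * (ENNReal.ofReal I / t (s + 1)) := by
          rw [ENNReal.tsum_mul_left]
          gcongr
          exact (husum s).trans (ENNReal.div_le_div_right hgI _)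
      _ = ENNReal.ofReal ((1 + C1) * C4 * 10 ^ n / 8 ^ s * (I / (a * v * (1 / 2) ^ (s + 1)))) := by
          rw [ENNReal.ofReal_mul (by positivity), ENNReal.ofReal_div_of_pos (by positivity),
            ENNReal.ofReal_div_of_pos (by positivity),
            ENNReal.ofReal_mul (p := (1 + (C1 : ℝ)) * C4) (by positivity),
            ENNReal.ofReal_mul (p := 1 + (C1 : ℝ)) (by positivity),
            ENNReal.ofReal_add zero_le_one (by positivity), ENNReal.ofReal_one,
            ENNReal.ofReal_coe_nnreal, ENNReal.ofReal_coe_nnreal,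
            ENNReal.ofReal_pow (by norm_num), ENNReal.ofReal_pow (by norm_num),
            ENNReal.ofReal_ofNat, ENNReal.ofReal_ofNat]
      _ ≤ _ := by
          rw [← ENNReal.ofReal_mul (by positivity)]
          apply ENNReal.ofReal_le_ofReal
          have e1 : (1 + C1) * C4 * 10 ^ n / 8 ^ s * (I / (a * v * (1 / 2) ^ (s + 1))) =
              (1 + C1) * C4 * 10 ^ n * 2 / v * I / a * (1 / 4) ^ s := by
            have e2 : (8 : ℝ) ^ s = 4 ^ s * 2 ^ s := by rw [← mul_pow]; norm_num
            rw [e2, pow_succ]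
            simp only [one_div, inv_pow]
            field_simp
          rw [e1]
          gcongr
          norm_num
  calc volume (commMaxSet b g (ENNReal.ofReal ((2 * v + 1 + C') * a)))
      ≤ ∑' s, volume (⋃ p ∈ u s, Z s p) := (measure_mono hcover).trans (measure_iUnion_le _)
    _ ≤ ∑' s, ENNReal.ofReal ((1 + C1) * C4 * 10 ^ n * 2 / v * I / a) *
          ENNReal.ofReal ((1 / 2) ^ s) := ENNReal.tsum_le_tsum hs
    _ = ENNReal.ofReal (C' * I / a) := by
        rw [ENNReal.tsum_mul_left, ← ENNReal.ofReal_tsum_of_nonneg (fun k => by positivity)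
          summable_geometric_two, tsum_geometric_two, ← ENNReal.ofReal_mul (by positivity), hC']
        congr 1
        ring
    _ ≤ _ := by
        apply ENNReal.ofReal_le_ofReal
        gcongr
        linarith

/-! ### Kernel estimates for inputs with cancellation -/

lemma integral_update_mul_prod_eq_zero {n m : ℕ} (F : (Fin m → Rn n) → ℝ) {g : Fin m → Rn n → ℝ}
    {i : Fin m} (c : Rn n) (hi : ∫ y, g i y = 0) :
    ∫ y : Fin m → Rn n, F (Function.update y i c) * ∏ j, g j (y j) = 0 := by
  obtain ⟨k, rfl⟩ : ∃ k, m = k + 1 := ⟨m - 1, by have := i.pos; omega⟩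
  have h := (volume_preserving_piFinSuccAbove (fun _ : Fin (k + 1) => Rn n) i).symm
  rw [← h.integral_comp (MeasurableEquiv.measurableEmbedding _)]
  have e : ∀ z : Rn n × (Fin k → Rn n),
      F (Function.update ((MeasurableEquiv.piFinSuccAbove (fun _ => Rn n) i).symm z) i c) *
        ∏ j, g j ((MeasurableEquiv.piFinSuccAbove (fun _ => Rn n) i).symm z j) =
      g i z.1 * (F (i.insertNth c z.2) * ∏ j, g (i.succAbove j) (z.2 j)) := fun z => by
    have e1 : (MeasurableEquiv.piFinSuccAbove (fun _ => Rn n) i).symm z = i.insertNth z.1 z.2 := rfl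
    rw [e1, Fin.update_insertNth, Fin.prod_univ_succAbove _ i]
    simp only [Fin.insertNth_apply_same, Fin.insertNth_apply_succAbove]
    ring
  simp only [e]
  rw [Measure.volume_eq_prod, integral_prod_mul (f := g i)
    (g := fun y : Fin k → Rn n => F (i.insertNth c y) * ∏ j, g (i.succAbove j) (y j)), hi, zero_mul]

section CZ

variable {n m : ℕ} {A : ℝ} {ω : ℝ → ℝ} {K : Rn n → (Fin m → Rn n) → ℝ}
  {T : (Fin m → Rn n → ℝ) → Rn n → ℝ}

lemma CZ.integrable_ker_update_mul (h : CZ A ω K T) {g : Fin m → Rn n → ℝ}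
    (hg : ∀ j, Integrable (g j)) {x c : Rn n} {i : Fin m} (hc : x ≠ c) :
    Integrable fun y : Fin m → Rn n => K x (Function.update y i c) * ∏ j, g j (y j) := by
  have h1 : Integrable fun y : Fin m → Rn n => ∏ j, g j (y j) := Integrable.fintype_prod hg
  have hc' : 0 < ‖x - c‖ := norm_pos_iff.2 (sub_ne_zero.2 hc)
  have hcont : Continuous fun y : Fin m → Rn n => K x (Function.update y i c) :=
    (h.continuousOn_ker x).comp_continuous (continuous_id.update i continuous_const) fun y hy => by
      have := congrFun (mem_singleton_iff.1 hy) i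
      exact hc (by simpa using this.symm)
  refine (h1.norm.const_mul (A / ‖x - c‖ ^ (m * n))).mono'
    (hcont.aestronglyMeasurable.mul h1.aestronglyMeasurable) (Eventually.of_forall fun y => ?_)
  rw [norm_mul]
  gcongr
  exact h.abs_ker_le hc' (j := i) (by simp)

set_option maxHeartbeats 2000000 in
/-- Kernel bound when the inputs with index in `Bd` are localised and have mean zero. -/
lemma CZ.enorm_integral_ker_le_of_mean_zero (h : CZ A ω K T) {g : Fin m → Rn n → ℝ}
    (hg : ∀ j, Integrable (g j)) {Bd : Finset (Fin m)} (hBd : Bd.Nonempty) {x : Rn n}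
    {c : Fin m → Rn n} {ρ : Fin m → ℝ} (hρ : ∀ j ∈ Bd, 0 < ρ j)
    (hsupp : ∀ j ∈ Bd, ∀ y, g j y ≠ 0 → ‖y - c j‖ ≤ ρ j / 2)
    (hmean : ∀ j ∈ Bd, ∫ y, g j y = 0) (hfar : ∀ j ∈ Bd, 2 * ρ j ≤ ‖x - c j‖)
    {Y : Fin m → ℝ≥0∞}
    (hY : ∀ j ∉ Bd, ∀ R > 0, ∫⁻ y in closedBall x R, ‖g j y‖ₑ ≤ Y j * ENNReal.ofReal R ^ n) :
    (∃ d > 0, ∃ j, ∀ y, g j y ≠ 0 → d ≤ ‖x - y‖) ∧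
    ‖∫ y : Fin m → Rn n, K x y * ∏ j, g j (y j)‖ₑ ≤
      ENNReal.ofReal (A * (2 * 2 ^ (m * n))) * ∏ j, if j ∈ Bd then
        ENNReal.ofReal ((‖x - c j‖ ^ n)⁻¹ * ω (ρ j / ‖x - c j‖) ^ ((1:ℝ) / m)) *
          ∫⁻ y, ‖g j y‖ₑ else ENNReal.ofReal (ω 1 ^ ((1:ℝ) / m)) * Y j := by
  have hA := h.pos
  have hn := h.dim_pos
  have hm0 : (m : ℝ) ≠ 0 := by have := h.arity_pos; positivity
  obtain ⟨j₀, hj₀, hmin⟩ := Bd.exists_min_image ρ hBd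
  obtain ⟨j₁, hj₁, hmax⟩ := Bd.exists_max_image (fun j => ‖x - c j‖) hBd
  set r : Fin m → ℝ := fun j => ‖x - c j‖ with hr
  have hr0 : ∀ j ∈ Bd, 0 < r j := fun j hj => by
    have h1 := hfar j hj
    have h2 := hρ j hj
    simp only [hr]
    linarith
  have hdist : ∀ j ∈ Bd, ∀ y, g j y ≠ 0 → 3 / 4 * r j ≤ ‖x - y‖ := fun j hj y hy => by
    have h1 := hfar j hj
    have h2 := hsupp j hj y hy
    have h3 := norm_sub_le_norm_sub_add_norm_sub x y (c j)
    simp only [hr]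
    linarith
  have hL : 0 < r j₁ / 2 := half_pos (hr0 j₁ hj₁)
  have hd0 : 0 < 3 / 4 * r j₁ := by have := hr0 j₁ hj₁; positivity
  refine ⟨⟨_, hd0, j₁, hdist j₁ hj₁⟩, ?_⟩
  set L := r j₁ / 2 with hLdef
  set Ω := ω (ρ j₀ / r j₁) with hΩ
  have hΩarg : 0 < ρ j₀ / r j₁ := div_pos (hρ _ hj₀) (hr0 _ hj₁)
  have hΩ0 : 0 ≤ Ω := h.nonneg _ hΩarg
  have hΩ1 : Ω ≤ ω 1 := by
    refine h.mono _ _ hΩarg ?_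
    rw [div_le_one (hr0 _ hj₁)]
    have h1 := hfar j₁ hj₁
    have h2 := hmin j₁ hj₁
    have h3 := hρ j₁ hj₁
    simp only [hr]
    linarith
  have hΩj : ∀ j ∈ Bd, Ω ≤ ω (ρ j / r j) := fun j hj => by
    refine h.mono _ _ hΩarg ?_
    have h1 := hmin j hj
    have h2 := hmax j hj
    have h3 := hr0 j hj
    have h4 := hρ j hj
    exact div_le_div₀ h4.le h1 h3 h2
  have hxc : x ≠ c j₀ := fun hh => by
    have h1 := hr0 j₀ hj₀
    simp only [hr, hh, sub_self, norm_zero, lt_irrefl] at h1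
  have hmz := integral_update_mul_prod_eq_zero (fun y => K x y) (c j₀) (hmean j₀ hj₀)
  rw [← sub_zero (∫ y : Fin m → Rn n, K x y * ∏ j, g j (y j)), ← hmz,
    ← integral_sub (h.integrable_ker_mul hg hd0 (hdist j₁ hj₁))
      (h.integrable_ker_update_mul hg hxc)]
  refine (enorm_integral_le_lintegral_enorm _).trans ?_
  set Φ : ℝ → ℝ≥0∞ := fun s => ENNReal.ofReal (A / s ^ (m * n) * Ω) with hΦ
  have hms : MeasurableSet {y : Fin m → Rn n | L ≤ ∑ j, ‖x - y j‖} :=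
    measurableSet_le measurable_const (by fun_prop)
  set Z : Fin m → ℝ≥0∞ := fun j => if j ∈ Bd then
        ENNReal.ofReal ((r j ^ n)⁻¹ * ω (ρ j / r j) ^ ((1:ℝ) / m)) *
          ∫⁻ y, ‖g j y‖ₑ else ENNReal.ofReal (ω 1 ^ ((1:ℝ) / m)) * Y j with hZ
  calc ∫⁻ y : Fin m → Rn n, ‖K x y * ∏ j, g j (y j) -
          K x (Function.update y j₀ (c j₀)) * ∏ j, g j (y j)‖ₑ
      ≤ ∫⁻ y in {y : Fin m → Rn n | L ≤ ∑ j, ‖x - y j‖},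
          Φ (∑ j, ‖x - y j‖) * ‖∏ j, g j (y j)‖ₑ := by
        rw [← lintegral_indicator hms]
        refine lintegral_mono fun y => ?_
        by_cases hy : ∏ i, g i (y i) = 0
        · have h1 : ‖K x y * ∏ i, g i (y i) -
              K x (Function.update y j₀ (c j₀)) * ∏ i, g i (y i)‖ₑ = 0 := by
            rw [hy, mul_zero, mul_zero, sub_self, enorm_zero]
          exact h1.le.trans zero_le
        have hy' : ∀ i, g i (y i) ≠ 0 := fun i hi =>
          hy (Finset.prod_eq_zero (Finset.mem_univ i) hi)
        have hS34 := (hdist j₁ hj₁ _ (hy' j₁)).trans (norm_le_sum_norm x y j₁)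
        have hLS : L ≤ ∑ j, ‖x - y j‖ := by
          have := hr0 j₁ hj₁
          rw [hLdef]
          linarith
        rw [indicator_of_mem (show y ∈ {y : Fin m → Rn n | L ≤ ∑ j, ‖x - y j‖} from hLS),
          ← sub_mul, enorm_mul]
        gcongr
        rw [Real.enorm_eq_ofReal_abs]
        refine ENNReal.ofReal_le_ofReal (q := A / (∑ j, ‖x - y j‖) ^ (m * n) * Ω) ?_
        have hS : 0 < ∑ j, ‖x - y j‖ := hL.trans_le hLS
        rcases eq_or_ne (y j₀) (c j₀) with hyc | hyc
        · rw [← hyc, Function.update_eq_self, sub_self, abs_zero]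
          exact mul_nonneg (div_nonneg hA.le (pow_nonneg hS.le _)) hΩ0
        · have hpos : 0 < ‖y j₀ - c j₀‖ := norm_pos_iff.2 (sub_ne_zero.2 hyc)
          have h1 := hdist j₀ hj₀ _ (hy' j₀)
          have h2 := hsupp j₀ hj₀ _ (hy' j₀)
          have h3 := hfar j₀ hj₀
          have h4 := hρ j₀ hj₀
          have h5 : 2 * ρ j₀ ≤ r j₀ := h3
          refine (h.ker.2.2 x y j₀ (c j₀) (fun hall => ?_) ⟨j₀, by linarith⟩).trans ?_
          · rw [hall j₀, sub_self, norm_zero] at h1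
            linarith
          · refine mul_le_mul_of_nonneg_left (h.mono _ _ (div_pos hpos hS) ?_)
              (div_nonneg hA.le (pow_nonneg hS.le _))
            have h6 := hr0 j₁ hj₁
            rw [div_le_div_iff₀ hS h6]
            nlinarith
    _ ≤ ∑' p : ℕ, Φ (2 ^ p * L) * ∏ j, ∫⁻ y in closedBall x (2 ^ (p + 1) * L), ‖g j y‖ₑ := by
        refine lintegral_shell_le hg x hL Φ fun s t hs hst => ENNReal.ofReal_le_ofReal ?_
        have hs0 : 0 < s := hL.trans_le hs
        have ht0 : 0 < t := hs0.trans_le hst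
        gcongr
    _ ≤ ∑' p : ℕ, ENNReal.ofReal (A * 2 ^ (m * n)) * (∏ j, Z j) * (2 ^ p)⁻¹ := by
        refine ENNReal.tsum_le_tsum fun p => ?_
        have hpL : 0 < 2 ^ p * L := by positivity
        set R := 2 ^ (p + 1) * L with hR
        have hR0 : 0 < R := by positivity
        have hRr : R = 2 ^ p * r j₁ := by rw [hR, hLdef]; ring
        have hΦ1 : Φ (2 ^ p * L) = ENNReal.ofReal (A * 2 ^ (m * n)) *
            ∏ _j : Fin m, ENNReal.ofReal ((R ^ n)⁻¹ * Ω ^ ((1:ℝ) / m)) := by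
          rw [Finset.prod_const, Finset.card_univ, Fintype.card_fin,
            ← ENNReal.ofReal_pow (by positivity),
            ← ENNReal.ofReal_mul (p := A * 2 ^ (m * n)) (by positivity)]
          simp only [hΦ]
          congr 1
          rw [mul_pow (R ^ n)⁻¹, ← Real.rpow_natCast (Ω ^ ((1:ℝ) / m)), ← Real.rpow_mul hΩ0,
            one_div_mul_cancel hm0, Real.rpow_one, inv_pow, ← pow_mul, hR, pow_succ,
            show 2 ^ p * 2 * L = 2 ^ p * L * 2 by ring, mul_pow (2 ^ p * L) 2, mul_comm n m]
          field_simp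
        have hfac : ∀ j, ENNReal.ofReal ((R ^ n)⁻¹ * Ω ^ ((1:ℝ) / m)) *
            ∫⁻ y in closedBall x R, ‖g j y‖ₑ ≤ (if j = j₁ then (2 ^ p : ℝ≥0∞)⁻¹ else 1) * Z j := by
          intro j
          by_cases hj : j ∈ Bd
          · have hrj := hr0 j hj
            have hrR : 2 ^ p * r j ≤ R := by
              rw [hRr]
              have := hmax j hj
              gcongr
            have h1 : Ω ^ ((1:ℝ) / m) ≤ ω (ρ j / r j) ^ ((1:ℝ) / m) :=
              Real.rpow_le_rpow hΩ0 (hΩj j hj) (by positivity)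
            have h2 : (R ^ n)⁻¹ ≤ (2 ^ p)⁻¹ * (r j ^ n)⁻¹ := by
              rw [← mul_inv]
              refine inv_anti₀ (by positivity) ?_
              calc 2 ^ p * r j ^ n ≤ (2 ^ p) ^ n * r j ^ n := by
                    gcongr
                    exact le_self_pow₀ (one_le_pow₀ (by norm_num)) (by omega)
                _ ≤ R ^ n := by
                    rw [← mul_pow]
                    gcongr
            have h3 : ENNReal.ofReal ((R ^ n)⁻¹ * Ω ^ ((1:ℝ) / m)) ≤
                (2 ^ p)⁻¹ * ENNReal.ofReal ((r j ^ n)⁻¹ * ω (ρ j / r j) ^ ((1:ℝ) / m)) := by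
              have h4 : (2 ^ p : ℝ≥0∞)⁻¹ = ENNReal.ofReal (2 ^ p)⁻¹ := by
                rw [ENNReal.ofReal_inv_of_pos (by positivity),
                  ENNReal.ofReal_pow (by norm_num), ENNReal.ofReal_ofNat]
              rw [h4, ← ENNReal.ofReal_mul (by positivity)]
              apply ENNReal.ofReal_le_ofReal
              rw [← mul_assoc]
              gcongr
            have h5 : (2 ^ p : ℝ≥0∞)⁻¹ ≤ if j = j₁ then (2 ^ p : ℝ≥0∞)⁻¹ else 1 := by
              split_ifs
              · exact le_rfl
              · exact ENNReal.inv_le_one.2 (one_le_pow₀ (by norm_num))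
            simp only [hZ, if_pos hj]
            calc _ ≤ ((2 ^ p)⁻¹ * ENNReal.ofReal ((r j ^ n)⁻¹ * ω (ρ j / r j) ^ ((1:ℝ) / m))) *
                  ∫⁻ y, ‖g j y‖ₑ := by
                  gcongr
                  exact Measure.restrict_le_self
              _ ≤ _ := by
                  rw [mul_assoc]
                  gcongr
          · have hjj : j ≠ j₁ := fun hh => hj (hh ▸ hj₁)
            simp only [hZ, if_neg hj, if_neg hjj, one_mul]
            have h1 : Ω ^ ((1:ℝ) / m) ≤ ω 1 ^ ((1:ℝ) / m) :=
              Real.rpow_le_rpow hΩ0 hΩ1 (by positivity)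
            calc _ ≤ ENNReal.ofReal ((R ^ n)⁻¹ * Ω ^ ((1:ℝ) / m)) *
                  (Y j * ENNReal.ofReal R ^ n) := by
                  gcongr
                  exact hY j hj R hR0
              _ = ENNReal.ofReal (Ω ^ ((1:ℝ) / m)) * Y j *
                  ((ENNReal.ofReal R ^ n)⁻¹ * ENNReal.ofReal R ^ n) := by
                  rw [ENNReal.ofReal_mul (p := (R ^ n)⁻¹) (by positivity),
                    ENNReal.ofReal_inv_of_pos (by positivity), ENNReal.ofReal_pow hR0.le]
                  ring
              _ ≤ _ := by
                  rw [ENNReal.inv_mul_cancel (by positivity) (by finiteness), mul_one]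
                  gcongr
        calc Φ (2 ^ p * L) * ∏ j, ∫⁻ y in closedBall x R, ‖g j y‖ₑ
            = ENNReal.ofReal (A * 2 ^ (m * n)) *
              ∏ j, (ENNReal.ofReal ((R ^ n)⁻¹ * Ω ^ ((1:ℝ) / m)) *
                ∫⁻ y in closedBall x R, ‖g j y‖ₑ) := by
              rw [hΦ1, Finset.prod_mul_distrib, mul_assoc]
          _ ≤ ENNReal.ofReal (A * 2 ^ (m * n)) *
              ∏ j, ((if j = j₁ then (2 ^ p : ℝ≥0∞)⁻¹ else 1) * Z j) := by
              exact mul_le_mul_right (Finset.prod_le_prod (fun _ _ => zero_le) fun j _ => hfac j) _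
          _ = _ := by
              rw [Finset.prod_mul_distrib, Finset.prod_ite_eq' Finset.univ j₁
                (fun _ => (2 ^ p : ℝ≥0∞)⁻¹), if_pos (Finset.mem_univ _)]
              ring
    _ = _ := by
        rw [ENNReal.tsum_mul_left]
        have h1 : ∑' p : ℕ, ((2 : ℝ≥0∞) ^ p)⁻¹ = 2 := by
          simp only [ENNReal.inv_pow, ENNReal.tsum_geometric, ENNReal.one_sub_inv_two, inv_inv]
        rw [h1, show A * (2 * 2 ^ (m * n)) = A * 2 ^ (m * n) * 2 by ring,
          ENNReal.ofReal_mul (p := A * 2 ^ (m * n)) (by positivity), ENNReal.ofReal_ofNat]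
        ring

end CZ

/-- A majorant for the kernel factor `|x - c|⁻ⁿ ω(ρ / |x - c|)^{1/m}` off a ball. -/
def xiMaj {n : ℕ} (m : ℕ) (ω : ℝ → ℝ) (c : Rn n) (ρ : ℝ) (x : Rn n) : ℝ≥0∞ :=
  ∑' p : ℕ, (closedBall c (2 ^ (p + 1) * ρ)).indicator
    (fun _ => ENNReal.ofReal (((2 ^ p * ρ) ^ n)⁻¹ * ω ((1 / 2) ^ p) ^ ((1:ℝ) / m))) x

section CZ

variable {n m : ℕ} {A : ℝ} {ω : ℝ → ℝ} {K : Rn n → (Fin m → Rn n) → ℝ}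
  {T : (Fin m → Rn n → ℝ) → Rn n → ℝ}

lemma CZ.le_xiMaj (h : CZ A ω K T) {c x : Rn n} {ρ : ℝ} (hρ : 0 < ρ) (hx : 2 * ρ ≤ ‖x - c‖) :
    ENNReal.ofReal ((‖x - c‖ ^ n)⁻¹ * ω (ρ / ‖x - c‖) ^ ((1:ℝ) / m)) ≤ xiMaj m ω c ρ x := by
  have hr : 0 < ‖x - c‖ := by linarith
  obtain ⟨p, hp1, hp2⟩ := exists_nat_pow_near (x := ‖x - c‖ / ρ) (y := 2)
    (by rw [le_div_iff₀ hρ]; linarith) (by norm_num)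
  rw [le_div_iff₀ hρ] at hp1
  rw [div_lt_iff₀ hρ] at hp2
  refine le_trans ?_ (ENNReal.le_tsum p)
  rw [indicator_of_mem (by rw [mem_closedBall_iff_norm]; exact hp2.le)]
  apply ENNReal.ofReal_le_ofReal
  have h0 : 0 ≤ ω (ρ / ‖x - c‖) := h.nonneg _ (by positivity)
  have h1 : ω (ρ / ‖x - c‖) ≤ ω ((1 / 2) ^ p) := by
    refine h.mono _ _ (by positivity) ?_
    rw [div_le_iff₀ hr, one_div, inv_pow, ← div_eq_inv_mul, le_div_iff₀ (by positivity)]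
    linarith
  gcongr

lemma CZ.apply_affine_eq_integral_ker (h : CZ A ω K T) {p q : Fin m → Rn n → ℝ} (r : Fin m → ℝ)
    (hp : ∀ j, Integrable (p j)) (hq : ∀ j, Integrable (q j)) {x : Rn n} {d : ℝ} (hd : 0 < d)
    {i : Fin m} (hpi : ∀ y, p i y ≠ 0 → d ≤ ‖x - y‖) (hqi : ∀ y, q i y ≠ 0 → d ≤ ‖x - y‖)
    (hrep : ∀ S : Finset (Fin m), T (fun j => if j ∈ S then p j else q j) x =
      ∫ y : Fin m → Rn n, K x y * ∏ j, (if j ∈ S then p j else q j) (y j)) :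
    T (fun j y => r j * p j y + q j y) x =
      ∫ y : Fin m → Rn n, K x y * ∏ j, (r j * p j (y j) + q j (y j)) := by
  have hint : ∀ S : Finset (Fin m), Integrable fun y : Fin m → Rn n =>
      K x y * ∏ j, (if j ∈ S then p j else q j) (y j) := fun S =>
    h.integrable_ker_mul (g := fun j => if j ∈ S then p j else q j)
      (fun j => by split_ifs; exacts [hp j, hq j]) hd (j := i) fun y hy => by
        split_ifs at hy
        exacts [hpi y hy, hqi y hy]
  rw [h.lin.affine r hp hq x]
  simp only [hrep]
  simp_rw [← integral_const_mul]
  rw [← integral_finsetSum _ fun S _ => (hint S).const_mul _]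
  congr 1
  ext y
  rw [Finset.prod_add, Finset.mul_sum, Finset.powerset_univ]
  refine Finset.sum_congr rfl fun S _ => ?_
  have e1 : ∏ j, (if j ∈ S then p j else q j) (y j) =
      (∏ j ∈ S, p j (y j)) * ∏ j ∈ Finset.univ \ S, q j (y j) := by
    rw [← Finset.prod_sdiff (Finset.subset_univ S), mul_comm]
    congr 1
    · exact Finset.prod_congr rfl fun j hj => by rw [if_pos hj]
    · exact Finset.prod_congr rfl fun j hj => by rw [if_neg (Finset.mem_sdiff.1 hj).2]
  rw [e1, Finset.prod_mul_distrib]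
  ring

set_option maxHeartbeats 1000000 in
/-- Pointwise bound when some slots are superpositions of localised functions with mean zero. -/
lemma CZ.ae_enorm_le_of_mean_zero (h : CZ A ω K T) {Bd : Finset (Fin m)} (hBd : Bd.Nonempty)
    (s : Fin m → Finset ℕ) {c : Fin m → ℕ → Rn n} {ρ : Fin m → ℕ → ℝ} (hρ : ∀ j k, 0 < ρ j k)
    (φ : Fin m → ℕ → Rn n → ℝ) {ψ : Fin m → ℕ → Rn n → ℝ} (hψ : ∀ j k, Integrable (ψ j k))
    (hsupp : ∀ j k y, ψ j k y ≠ 0 → ‖y - c j k‖ ≤ ρ j k / 2)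
    (hmean : ∀ j k, ∫ y, ψ j k y = 0) (r : Fin m → Rn n → ℝ) {p q : Fin m → Rn n → ℝ}
    (hp : ∀ j, Integrable (p j)) (hq : ∀ j, Integrable (q j))
    (hpc : ∀ j, HasCompactSupport (p j)) (hqc : ∀ j, HasCompactSupport (q j)) :
    ∀ᵐ x, (∀ j ∈ Bd, ∀ k ∈ s j, 2 * ρ j k ≤ ‖x - c j k‖) → ∀ Y : Fin m → ℝ≥0∞,
      (∀ j ∉ Bd, ∀ R > 0, ∫⁻ y in closedBall x R, ‖r j x * p j y + q j y‖ₑ ≤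
        Y j * ENNReal.ofReal R ^ n) →
      ‖T (fun j y => if j ∈ Bd then ∑ k ∈ s j, φ j k x * ψ j k y else
          r j x * p j y + q j y) x‖ₑ ≤
        ENNReal.ofReal (A * (2 * 2 ^ (m * n))) * ∏ j, if j ∈ Bd then
          ∑ k ∈ s j, ‖φ j k x‖ₑ * (∫⁻ y, ‖ψ j k y‖ₑ) * xiMaj m ω (c j k) (ρ j k) x
          else ENNReal.ofReal (ω 1 ^ ((1:ℝ) / m)) * Y j := by
  have hts : ∀ j k, tsupport (ψ j k) ⊆ closedBall (c j k) (ρ j k / 2) := fun j k =>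
    closure_minimal (fun y hy => by
      rw [mem_closedBall_iff_norm]; exact hsupp j k y hy) isClosed_closedBall
  set P : (Fin m → ℕ) → Fin m → Rn n → ℝ := fun κ j => if j ∈ Bd then ψ j (κ j) else p j with hP
  set Q : Fin m → Rn n → ℝ := fun j => if j ∈ Bd then fun _ => 0 else q j with hQ
  have hPi : ∀ κ j, Integrable (P κ j) := fun κ j => by
    simp only [hP]; split_ifs; exacts [hψ _ _, hp j]
  have hQi : ∀ j, Integrable (Q j) := fun j => by
    simp only [hQ]; split_ifs; exacts [integrable_zero _ _ _, hq j]
  have hrep : ∀ᵐ x, ∀ (κ : Fin m → ℕ) (S : Finset (Fin m)),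
      x ∉ ⋂ j, tsupport ((fun j => if j ∈ S then P κ j else Q j) j) →
      T (fun j => if j ∈ S then P κ j else Q j) x =
      ∫ y : Fin m → Rn n, K x y * ∏ j, (if j ∈ S then P κ j else Q j) (y j) := by
    rw [ae_all_iff]
    intro κ
    rw [ae_all_iff]
    intro S
    refine h.rep (fun j => if j ∈ S then P κ j else Q j) (fun j => ?_) fun j => ?_
    · split_ifs; exacts [hPi κ j, hQi j]
    · simp only [hP, hQ]
      split_ifs
      · exact (isCompact_closedBall _ _).of_isClosed_subset (isClosed_tsupport _) (hts _ _)
      · exact hpc j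
      · exact HasCompactSupport.zero
      · exact hqc j
  filter_upwards [hrep] with x hx hfar Y hY
  set s' : Fin m → Finset ℕ := fun j => if j ∈ Bd then s j else {0} with hs'
  set G : Fin m → ℕ → Rn n → ℝ := fun j k y =>
    if j ∈ Bd then φ j k x * ψ j k y else r j x * p j y + q j y with hG
  have hGi : ∀ j k, Integrable (G j k) := fun j k => by
    simp only [hG]
    split_ifs
    exacts [(hψ _ _).const_mul _, ((hp j).const_mul _).add (hq j)]
  have e1 : (fun j y => if j ∈ Bd then ∑ k ∈ s j, φ j k x * ψ j k y else
      r j x * p j y + q j y) = fun j y => ∑ k ∈ s' j, G j k y := by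
    ext j y
    by_cases hj : j ∈ Bd
    · simp only [hs', hG, if_pos hj]
    · simp only [hs', hG, if_neg hj, Finset.sum_singleton]
  rw [e1, h.lin.sum s' hGi x]
  obtain ⟨i, hi⟩ := hBd
  have hκ : ∀ κ ∈ Fintype.piFinset s', ‖T (fun j => G j (κ j)) x‖ₑ ≤
      ENNReal.ofReal (A * (2 * 2 ^ (m * n))) * ∏ j, if j ∈ Bd then
        ‖φ j (κ j) x‖ₑ * (∫⁻ y, ‖ψ j (κ j) y‖ₑ) * xiMaj m ω (c j (κ j)) (ρ j (κ j)) x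
        else ENNReal.ofReal (ω 1 ^ ((1:ℝ) / m)) * Y j := by
    intro κ hκ
    have hκs : ∀ j ∈ Bd, κ j ∈ s j := fun j hj => by
      have := Fintype.mem_piFinset.1 hκ j
      simpa only [hs', if_pos hj] using this
    have hfar' : ∀ j ∈ Bd, 2 * ρ j (κ j) ≤ ‖x - c j (κ j)‖ := fun j hj => hfar j hj _ (hκs j hj)
    have hd : ∀ y, ψ i (κ i) y ≠ 0 → ρ i (κ i) ≤ ‖x - y‖ := fun y hy => by
      have h1 := hfar' i hi
      have h2 := hsupp i _ y hy
      have h3 := norm_sub_le_norm_sub_add_norm_sub x y (c i (κ i))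
      have h4 := hρ i (κ i)
      linarith
    have hnot : ∀ S : Finset (Fin m),
        x ∉ ⋂ j, tsupport ((fun j => if j ∈ S then P κ j else Q j) j) := fun S hS => by
      have h1 := mem_iInter.1 hS i
      simp only [hP, hQ, if_pos hi] at h1
      split_ifs at h1
      · have h2 := hts _ _ h1
        rw [mem_closedBall_iff_norm] at h2
        have h3 := hfar' i hi
        have h4 := hρ i (κ i)
        linarith
      · simp [tsupport, Function.support] at h1
    set r' : Fin m → ℝ := fun j => if j ∈ Bd then φ j (κ j) x else r j x with hr'
    have e2 : ∀ j y, G j (κ j) y = r' j * P κ j y + Q j y := fun j y => by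
      by_cases hj : j ∈ Bd
      · simp only [hG, hr', hP, hQ, if_pos hj, add_zero]
      · simp only [hG, hr', hP, hQ, if_neg hj]
    have e3 : T (fun j => G j (κ j)) x = ∫ y : Fin m → Rn n, K x y * ∏ j, G j (κ j) (y j) := by
      have e4 : (fun j => G j (κ j)) = fun j y => r' j * P κ j y + Q j y := by
        ext j y; exact e2 j y
      rw [e4]
      simp only [e2]
      refine h.apply_affine_eq_integral_ker r' (hPi κ) hQi (hρ i (κ i)) (i := i) ?_ ?_
        fun S => hx κ S (hnot S)
      · simpa only [hP, if_pos hi] using hd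
      · intro y hy
        simp only [hQ, if_pos hi, ne_eq, not_true_eq_false] at hy
    rw [e3]
    refine (h.enorm_integral_ker_le_of_mean_zero (fun j => hGi j (κ j)) ⟨i, hi⟩
      (x := x) (c := fun j => c j (κ j)) (ρ := fun j => ρ j (κ j)) (Y := Y)
      (fun j _ => hρ _ _) ?_ ?_ hfar' ?_).2.trans ?_
    · intro j hj y hy
      simp only [hG, if_pos hj] at hy
      exact hsupp _ _ _ (right_ne_zero_of_mul hy)
    · intro j hj
      simp only [hG, if_pos hj]
      rw [integral_const_mul, hmean, mul_zero]
    · intro j hj R hR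
      simp only [hG, if_neg hj]
      exact hY j hj R hR
    · refine mul_le_mul_right (Finset.prod_le_prod (fun _ _ => zero_le) fun j _ => ?_) _
      by_cases hj : j ∈ Bd
      · simp only [if_pos hj, hG]
        have e5 : ∫⁻ y, ‖φ j (κ j) x * ψ j (κ j) y‖ₑ = ‖φ j (κ j) x‖ₑ * ∫⁻ y, ‖ψ j (κ j) y‖ₑ := by
          simp only [enorm_mul]
          rw [lintegral_const_mul'' _ (hψ _ _).aestronglyMeasurable.enorm]
        rw [e5, mul_comm]
        exact mul_le_mul_right (h.le_xiMaj (hρ _ _) (hfar' j hj)) _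
      · simp only [if_neg hj, le_refl]
  calc ‖∑ κ ∈ Fintype.piFinset s', T (fun j => G j (κ j)) x‖ₑ
      ≤ ∑ κ ∈ Fintype.piFinset s', ‖T (fun j => G j (κ j)) x‖ₑ := enorm_sum_le _ _
    _ ≤ _ := Finset.sum_le_sum hκ
    _ = ENNReal.ofReal (A * (2 * 2 ^ (m * n))) * ∏ j, ∑ k ∈ s' j, if j ∈ Bd then
        ‖φ j k x‖ₑ * (∫⁻ y, ‖ψ j k y‖ₑ) * xiMaj m ω (c j k) (ρ j k) x
        else ENNReal.ofReal (ω 1 ^ ((1:ℝ) / m)) * Y j := by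
        rw [← Finset.mul_sum, Finset.prod_univ_sum]
    _ = _ := by
        congr 1
        refine Finset.prod_congr rfl fun j _ => ?_
        by_cases hj : j ∈ Bd
        · simp only [hs', if_pos hj]
        · simp only [hs', if_neg hj, Finset.sum_singleton]

end CZ

lemma measurable_xiMaj {n : ℕ} (m : ℕ) (ω : ℝ → ℝ) (c : Rn n) (ρ : ℝ) :
    Measurable (xiMaj m ω c ρ) :=
  Measurable.tsum fun _ => measurable_const.indicator measurableSet_closedBall

lemma lintegral_mul_xiMaj_le {n : ℕ} (m : ℕ) {ω : ℝ → ℝ} (c : Rn n) {ρ : ℝ} (hρ : 0 < ρ)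
    {F : Rn n → ℝ≥0∞} (hF : AEMeasurable F) (C : ℝ≥0∞)
    (hC : ∀ p : ℕ, ∫⁻ x in closedBall c (2 ^ (p + 1) * ρ), F x ≤
      C * (1 + p) * ENNReal.ofReal (2 ^ p * ρ) ^ n) :
    ∫⁻ x, F x * xiMaj m ω c ρ x ≤
      C * ∑' p : ℕ, (1 + p) * ENNReal.ofReal (ω ((1 / 2) ^ p) ^ ((1:ℝ) / m)) := by
  simp only [xiMaj, ← ENNReal.tsum_mul_left]
  rw [lintegral_tsum]
  swap
  · exact fun p => hF.mul (measurable_const.indicator measurableSet_closedBall).aemeasurable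
  refine ENNReal.tsum_le_tsum fun p => ?_
  have hpρ : 0 < 2 ^ p * ρ := by positivity
  set t : ℝ≥0∞ := ENNReal.ofReal (((2 ^ p * ρ) ^ n)⁻¹ * ω ((1 / 2) ^ p) ^ ((1:ℝ) / m)) with ht
  calc ∫⁻ x, F x * (closedBall c (2 ^ (p + 1) * ρ)).indicator (fun _ => t) x
      = ∫⁻ x, (closedBall c (2 ^ (p + 1) * ρ)).indicator (fun x => F x * t) x := by
        congr 1
        ext x
        by_cases hx : x ∈ closedBall c (2 ^ (p + 1) * ρ)
        · rw [indicator_of_mem hx, indicator_of_mem hx]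
        · rw [indicator_of_notMem hx, indicator_of_notMem hx, mul_zero]
    _ = (∫⁻ x in closedBall c (2 ^ (p + 1) * ρ), F x) * t := by
        rw [lintegral_indicator measurableSet_closedBall, lintegral_mul_const'' _ hF.restrict]
    _ ≤ (C * (1 + p) * ENNReal.ofReal (2 ^ p * ρ) ^ n) * t := by
        gcongr
        exact hC p
    _ = C * ((1 + p) * ENNReal.ofReal (ω ((1 / 2) ^ p) ^ ((1:ℝ) / m))) *
        (ENNReal.ofReal (2 ^ p * ρ) ^ n * (ENNReal.ofReal (2 ^ p * ρ) ^ n)⁻¹) := by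
        rw [ht, ENNReal.ofReal_mul (p := ((2 ^ p * ρ) ^ n)⁻¹) (by positivity),
          ENNReal.ofReal_inv_of_pos (by positivity), ENNReal.ofReal_pow hpρ.le]
        ring
    _ = _ := by
        rw [ENNReal.mul_inv_cancel (by positivity) (by finiteness), mul_one]

lemma lintegral_xiMaj_le {n : ℕ} (m : ℕ) {ω : ℝ → ℝ} (c : Rn n) {ρ : ℝ} (hρ : 0 < ρ) :
    ∫⁻ x, xiMaj m ω c ρ x ≤ (2 ^ n * volume (ball (0 : Rn n) 1)) *
      ∑' p : ℕ, (1 + p) * ENNReal.ofReal (ω ((1 / 2) ^ p) ^ ((1:ℝ) / m)) := by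
  have h := lintegral_mul_xiMaj_le m (ω := ω) c hρ (F := fun _ => 1) aemeasurable_const
    (2 ^ n * volume (ball (0 : Rn n) 1)) fun p => ?_
  · simpa only [one_mul] using h
  rw [setLIntegral_one, volume_closedBall_Rn c (by positivity), pow_succ, mul_assoc, mul_comm 2 ρ,
    ← mul_assoc, ENNReal.ofReal_mul (by positivity), ENNReal.ofReal_ofNat, mul_pow]
  calc _ = 2 ^ n * volume (ball (0 : Rn n) 1) * 1 * ENNReal.ofReal (2 ^ p * ρ) ^ n := by ring
    _ ≤ _ := by
      gcongr
      exact le_self_add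

lemma lintegral_osc_mul_xiMaj_le {n : ℕ} (hn : 1 ≤ n) (m : ℕ) (ω : ℝ → ℝ) {M : ℝ} (hM : 0 < M) :
    ∃ C : ℝ≥0, ∀ b : Rn n → ℝ, LocallyIntegrable b volume → OscBound b M →
      ∀ (c : Rn n) (l : ℝ), 0 < l →
        ∫⁻ x, ‖b x - avgOn b (cube c l)‖ₑ * xiMaj m ω c (n * l) x ≤
          C * ∑' p : ℕ, (1 + p) * ENNReal.ofReal (ω ((1 / 2) ^ p) ^ ((1:ℝ) / m)) := by
  obtain ⟨C, hC⟩ := lintegral_cube_osc_pow_le hn hM 1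
  refine ⟨C * (3 + n) * (2 ^ (2 + n)) ^ n, fun b hb hbM c l hl => ?_⟩
  have hn0 : (1 : ℝ) ≤ n := by exact_mod_cast hn
  have hbm : AEMeasurable fun x => ‖b x - avgOn b (cube c l)‖ₑ :=
    (hb.aestronglyMeasurable.sub aestronglyMeasurable_const).enorm
  refine lintegral_mul_xiMaj_le m c (by positivity) hbm _ fun p => ?_
  have h2n : (n : ℝ) ≤ 2 ^ n := by exact_mod_cast Nat.lt_two_pow_self.le
  have hsub : closedBall c (2 ^ (p + 1) * (n * l)) ⊆ cube c (2 ^ (p + (2 + n)) * l) := by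
    refine (closedBall_subset_cube c _).trans (cube_subset_cube c ?_)
    calc 2 * (2 ^ (p + 1) * (n * l)) = 2 ^ p * 4 * l * n := by ring
      _ ≤ 2 ^ p * 4 * l * 2 ^ n := by gcongr
      _ = _ := by ring
  calc ∫⁻ x in closedBall c (2 ^ (p + 1) * (n * l)), ‖b x - avgOn b (cube c l)‖ₑ
      ≤ ∫⁻ x in cube c (2 ^ (p + (2 + n)) * l), ‖b x - avgOn b (cube c l)‖ₑ :=
        lintegral_mono_set hsub
    _ ≤ C * (1 + (p + (2 + n) : ℕ)) * ENNReal.ofReal (2 ^ (p + (2 + n)) * l) ^ n := by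
        simpa only [pow_one] using hC b hb hbM c l hl (p + (2 + n))
    _ ≤ C * ((3 + n) * (1 + p)) * (2 ^ (2 + n) * ENNReal.ofReal (2 ^ p * (n * l))) ^ n := by
        gcongr
        · push_cast
          calc (1 : ℝ≥0∞) + (p + (2 + n)) = (3 + n) * 1 + 1 * p := by ring
            _ ≤ (3 + n) * 1 + (3 + n) * p := by
              gcongr
              exact le_add_right (by norm_num)
            _ = _ := by ring
        · have e : (2 : ℝ≥0∞) ^ (2 + n) = ENNReal.ofReal (2 ^ (2 + n)) := by
            rw [ENNReal.ofReal_pow (by norm_num), ENNReal.ofReal_ofNat]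
          rw [e, ← ENNReal.ofReal_mul (by positivity)]
          apply ENNReal.ofReal_le_ofReal
          calc (2 : ℝ) ^ (p + (2 + n)) * l = 2 ^ (2 + n) * (2 ^ p * (1 * l)) := by ring
            _ ≤ _ := by gcongr
    _ = _ := by
        rw [mul_pow]
        push_cast
        ring

/-- Selection of the cubes with too much mass nearby. -/
lemma exists_bad_split {n : ℕ} (hn : 1 ≤ n) (s : Finset ℕ) (w : ℕ → ℝ≥0∞)
    (hw : ∑ k ∈ s, w k ≤ 1) (q : ℕ → ℤ × (Fin n → ℤ)) {α : ℝ} (hα : 0 < α) :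
    ∃ bad ⊆ s, ∃ p : ℕ → ℤ × (Fin n → ℤ),
      (∀ k, cell (0 : Rn n) 1 (q k).1 (q k).2 ⊆ cell 0 1 (p k).1 (p k).2 ∧
        (q k).1 ≤ (p k).1) ∧
      (∀ x, ∑ k ∈ s \ bad, (cell (0 : Rn n) 1 (q k).1 (q k).2).indicator
        (fun _ => w k / volume (cell (0 : Rn n) 1 (q k).1 (q k).2)) x ≤ ENNReal.ofReal α) ∧
      (∀ x, ∑ k ∈ bad, (cell (0 : Rn n) 1 (p k).1 (p k).2).indicator
        (fun _ => w k / volume (cell (0 : Rn n) 1 (p k).1 (p k).2)) x ≤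
          2 ^ n * ENNReal.ofReal α) ∧
      ∑ P ∈ bad.image p, volume (cell (0 : Rn n) 1 P.1 P.2) ≤ (ENNReal.ofReal α)⁻¹ := by
  classical
  set Q : ℤ × (Fin n → ℤ) → Set (Rn n) := fun P => cell 0 1 P.1 P.2 with hQ
  have hvol : ∀ P, volume (Q P) = ENNReal.ofReal (2 ^ P.1) ^ n := fun P => by
    simp only [hQ, cell, volume_hcube, mul_one]
  have hvol0 : ∀ P, volume (Q P) ≠ 0 := fun P => by rw [hvol]; positivity
  have hvolt : ∀ P, volume (Q P) ≠ ∞ := fun P => by rw [hvol]; finiteness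
  have hα0 : ENNReal.ofReal α ≠ 0 := by positivity
  set μ : Set (Rn n) → ℝ≥0∞ := fun S => ∑ k ∈ s, w k * (volume (Q (q k) ∩ S) / volume (Q (q k)))
    with hμ
  have hμ1 : ∀ S, μ S ≤ 1 := fun S => by
    refine le_trans (Finset.sum_le_sum fun k _ => ?_) hw
    refine mul_le_of_le_one_right' ?_
    exact ENNReal.div_le_of_le_mul (by rw [one_mul]; exact measure_mono inter_subset_left)
  obtain ⟨N, hN⟩ := pow_unbounded_of_one_lt (1 / α) (one_lt_two : (1 : ℝ) < 2)
  obtain ⟨S, hS1, hS2, hS3, hS4⟩ := exists_stopping (0 : Rn n) one_pos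
    (fun k v => ENNReal.ofReal α * volume (Q (k, v)) < μ (Q (k, v))) N (by
      intro k v hs
      by_contra hk
      have hk0 : (N : ℤ) ≤ k := by omega
      have h1 : (2 : ℝ) ^ N ≤ 2 ^ k := by
        rw [← zpow_natCast]
        exact zpow_le_zpow_right₀ (by norm_num) hk0
      have h2 : (1 : ℝ) ≤ 2 ^ k := le_trans (one_le_pow₀ (by norm_num)) h1
      have h3 : 1 ≤ ENNReal.ofReal α * volume (Q (k, v)) := by
        rw [hvol, ← ENNReal.ofReal_pow (by positivity), ← ENNReal.ofReal_mul hα.le,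
          ENNReal.one_le_ofReal]
        rw [div_lt_iff₀ hα] at hN
        have h4 : (2 : ℝ) ^ k ≤ (2 ^ k) ^ n := le_self_pow₀ h2 (by omega)
        nlinarith
      exact absurd (hs.trans_le (hμ1 _)) (not_lt.2 h3))
  set R : ℕ → ℤ × (Fin n → ℤ) → Prop := fun k P => P ∈ S ∧ Q (q k) ⊆ Q P ∧ (q k).1 ≤ P.1 with hR
  set bad : Finset ℕ := s.filter fun k => ∃ P, R k P with hbad
  have hp : ∀ k, ∃ P, (k ∈ bad → R k P) ∧ Q (q k) ⊆ Q P ∧ (q k).1 ≤ P.1 := fun k => by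
    by_cases hk : k ∈ bad
    · obtain ⟨P, hP⟩ := (Finset.mem_filter.1 hk).2
      exact ⟨P, fun _ => hP, hP.2⟩
    · exact ⟨q k, fun h => absurd h hk, subset_rfl, le_rfl⟩
  choose p hp hpq using hp
  refine ⟨bad, Finset.filter_subset _ _, p, hpq, fun x => ?_, fun x => ?_, ?_⟩
  · change ∑ k ∈ s \ bad, (Q (q k)).indicator (fun _ => w k / volume (Q (q k))) x ≤ _
    rcases ((s \ bad).filter fun k => x ∈ Q (q k)).eq_empty_or_nonempty with he | hne
    · rw [Finset.sum_eq_zero fun k hk => indicator_of_notMem (fun hx => ?_) _]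
      · exact zero_le
      · exact Finset.notMem_empty k (he ▸ Finset.mem_filter.2 ⟨hk, hx⟩)
    obtain ⟨i, hi, hmin⟩ := Finset.exists_min_image _ (fun k => (q k).1) hne
    obtain ⟨hi1, hix⟩ := Finset.mem_filter.1 hi
    obtain ⟨his, hib⟩ := Finset.mem_sdiff.1 hi1
    have hnot : μ (Q (q i)) ≤ ENNReal.ofReal α * volume (Q (q i)) := by
      by_contra hlt
      rw [not_le] at hlt
      have hg := (mem_cell_iff one_pos).1 hix
      obtain ⟨P, hP, hxP, hle⟩ := hS3 (q i).1 x (by rw [hg]; exact hlt)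
      exact hib (Finset.mem_filter.2 ⟨his, P, hP, cell_subset_cell one_pos hle hix hxP, hle⟩)
    rw [← ENNReal.mul_le_mul_iff_left (hvol0 (q i)) (hvolt (q i))]
    refine le_trans ?_ hnot
    rw [Finset.sum_mul]
    refine le_trans (Finset.sum_le_sum fun k hk => ?_)
      (Finset.sum_le_sum_of_subset (Finset.sdiff_subset (s := s) (t := bad)))
    by_cases hx : x ∈ Q (q k)
    · have hsub : Q (q i) ⊆ Q (q k) :=
        cell_subset_cell one_pos (hmin k (Finset.mem_filter.2 ⟨hk, hx⟩)) hix hx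
      rw [indicator_of_mem hx, inter_eq_self_of_subset_right hsub, ENNReal.div_eq_inv_mul,
        ENNReal.div_eq_inv_mul]
      exact le_of_eq (by ring)
    · rw [indicator_of_notMem hx, zero_mul]
      exact zero_le
  · change ∑ k ∈ bad, (Q (p k)).indicator (fun _ => w k / volume (Q (p k))) x ≤ _
    rcases (bad.filter fun k => x ∈ Q (p k)).eq_empty_or_nonempty with he | hne
    · rw [Finset.sum_eq_zero fun k hk => indicator_of_notMem (fun hx => ?_) _]
      · exact zero_le
      · exact Finset.notMem_empty k (he ▸ Finset.mem_filter.2 ⟨hk, hx⟩)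
    obtain ⟨i, hi⟩ := hne
    obtain ⟨hib, hix⟩ := Finset.mem_filter.1 hi
    set P' : ℤ × (Fin n → ℤ) := ((p i).1 + 1, gridIdx 0 1 ((p i).1 + 1) x) with hP'
    have hxP' : x ∈ Q P' := (mem_cell_iff one_pos).2 rfl
    have hnot : μ (Q P') ≤ ENNReal.ofReal α * volume (Q P') :=
      not_lt.1 (hS4 (p i) (hp i hib).1 x hix _ (lt_add_one _))
    have hsub : Q (p i) ⊆ Q P' := cell_subset_cell one_pos (lt_add_one _).le hix hxP'
    have hvP : volume (Q P') = 2 ^ n * volume (Q (p i)) := by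
      rw [hvol, hvol, ← mul_pow]
      congr 1
      rw [← ENNReal.ofReal_ofNat, ← ENNReal.ofReal_mul (by norm_num)]
      congr 1
      simp only [hP']
      rw [zpow_add_one₀ (by norm_num), mul_comm]
    rw [← ENNReal.mul_le_mul_iff_left (hvol0 (p i)) (hvolt (p i))]
    calc _ ≤ μ (Q P') := by
          rw [Finset.sum_mul]
          refine le_trans (Finset.sum_le_sum fun k hk => ?_)
            (Finset.sum_le_sum_of_subset (Finset.filter_subset _ s))
          by_cases hx : x ∈ Q (p k)
          · have hpk : p k = p i := by
              by_contra hne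
              exact Set.disjoint_left.1 (hS2 (hp k hk).1 (hp i hib).1 hne) hx hix
            have hsub' : Q (q k) ⊆ Q P' := (hp k hk).2.1.trans (hpk ▸ hsub)
            rw [indicator_of_mem hx, hpk, inter_eq_self_of_subset_left hsub',
              ENNReal.div_mul_cancel (hvol0 _) (hvolt _), ENNReal.div_self (hvol0 _) (hvolt _),
              mul_one]
          · rw [indicator_of_notMem hx, zero_mul]
            exact zero_le
      _ ≤ _ := hnot
      _ = _ := by rw [hvP]; ring
  · rw [ENNReal.le_inv_iff_mul_le, Finset.sum_mul]
    have hdisj : ((bad.image p : Finset _) : Set (ℤ × (Fin n → ℤ))).PairwiseDisjoint Q := by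
      refine hS2.subset fun P hP => ?_
      obtain ⟨k, hk, rfl⟩ := Finset.mem_image.1 hP
      exact (hp k hk).1
    calc ∑ P ∈ bad.image p, volume (Q P) * ENNReal.ofReal α
        ≤ ∑ P ∈ bad.image p, μ (Q P) := by
          refine Finset.sum_le_sum fun P hP => ?_
          obtain ⟨k, hk, rfl⟩ := Finset.mem_image.1 hP
          rw [mul_comm]
          exact (hS1 _ (hp k hk).1).le
      _ = ∑ k ∈ s, ∑ P ∈ bad.image p, w k * (volume (Q (q k) ∩ Q P) / volume (Q (q k))) :=
          Finset.sum_comm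
      _ ≤ ∑ k ∈ s, w k := by
          refine Finset.sum_le_sum fun k _ => ?_
          rw [← Finset.mul_sum]
          refine mul_le_of_le_one_right' ?_
          simp only [ENNReal.div_eq_inv_mul]
          rw [← Finset.mul_sum, ← ENNReal.div_eq_inv_mul]
          refine ENNReal.div_le_of_le_mul ?_
          rw [one_mul, ← measure_biUnion_finset]
          · exact measure_mono (iUnion₂_subset fun _ _ => inter_subset_left)
          · exact hdisj.mono fun _ => inter_subset_right
          · exact fun P _ => (measurableSet_cell _ _ _ _).inter (measurableSet_cell _ _ _ _)
      _ ≤ 1 := hw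

lemma integrable_mul_of_bounded {n : ℕ} {b g : Rn n → ℝ} (hb : LocallyIntegrable b volume)
    (hg : AEStronglyMeasurable g) {a : ℝ} (hga : ∀ᵐ x, |g x| ≤ a) (hgc : HasCompactSupport g) :
    Integrable fun y => b y * g y := by
  have h1 : IntegrableOn (fun y => b y * g y) (tsupport g) := by
    exact Integrable.mul_bdd (c := a) (hb.integrableOn_isCompact hgc) hg.restrict
      (ae_restrict_of_ae hga)
  rwa [integrableOn_iff_integrable_of_support_subset] at h1
  exact fun y hy => subset_tsupport g (right_ne_zero_of_mul hy)

lemma FiniteAtomicSum.exists_nat {n : ℕ} {f : Rn n → ℝ} (hf : FiniteAtomicSum f) :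
    ∃ (s : Finset ℕ) (q : ℕ → ℤ × (Fin n → ℤ)) (a : ℕ → Rn n → ℝ) (lam : ℕ → ℝ),
      (∀ k, Measurable (a k)) ∧ (∀ k x, x ∉ cell 0 1 (q k).1 (q k).2 → a k x = 0) ∧
      (∀ k, ∀ᵐ x, |a k x| ≤ ((2 ^ (q k).1) ^ n)⁻¹) ∧ (∀ k, ∫ x, a k x = 0) ∧
      ∑ k ∈ s, ‖lam k‖ₑ ≤ 1 ∧ ∀ x, f x = ∑ k ∈ s, lam k * a k x := by
  obtain ⟨N, Q, a, lam, hQ, ha, hlam, hfx⟩ := hf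
  choose κ v hv using hQ
  have hQc : ∀ k, Q k = cell 0 1 (κ k) (v k) := fun k => by
    rw [hv k]
    ext x
    refine forall_congr' fun i => ?_
    simp only [cellCtr, PiLp.zero_apply, mul_one, zero_add]
    constructor
    · rintro ⟨h1, h2⟩; constructor <;> nlinarith
    · rintro ⟨h1, h2⟩; constructor <;> nlinarith
  refine ⟨Finset.range N, fun k => if h : k < N then (κ ⟨k, h⟩, v ⟨k, h⟩) else 0,
    fun k => if h : k < N then a ⟨k, h⟩ else 0, fun k => if h : k < N then lam ⟨k, h⟩ else 0,
    fun k => ?_, fun k x hx => ?_, fun k => ?_, fun k => ?_, ?_, fun x => ?_⟩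
  · by_cases h : k < N
    · simp only [dif_pos h, (ha _).1]
    · simp only [dif_neg h, measurable_zero]
  · by_cases h : k < N
    · simp only [dif_pos h] at hx ⊢
      exact (ha _).2.1 x (by rwa [hQc])
    · simp only [dif_neg h, Pi.zero_apply]
  · by_cases h : k < N
    · have h1 := (ha ⟨k, h⟩).2.2.1
      rw [hQc, cell, volume_hcube, mul_one, ← ENNReal.ofReal_pow (by positivity),
        ENNReal.toReal_ofReal (by positivity)] at h1
      simpa only [dif_pos h] using h1
    · filter_upwards with x
      simp only [dif_neg h, Pi.zero_apply, abs_zero]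
      positivity
  · by_cases h : k < N
    · simpa only [dif_pos h] using (ha ⟨k, h⟩).2.2.2
    · simp only [dif_neg h, Pi.zero_apply, integral_zero]
  · rw [Finset.sum_range]
    simp only [Fin.is_lt, dif_pos, Fin.eta]
    simp only [Real.enorm_eq_ofReal_abs]
    rw [← ENNReal.ofReal_sum_of_nonneg fun _ _ => abs_nonneg _]
    exact ENNReal.ofReal_le_one.2 hlam
  · rw [Finset.sum_range, hfx]
    simp only [Fin.is_lt, dif_pos, Fin.eta]

section Atom

variable {n : ℕ} {a : Rn n → ℝ} {c : Rn n} {l : ℝ}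

lemma ae_enorm_le_of_atom (hl : 0 < l) (h0 : ∀ x, x ∉ hcube c l → a x = 0)
    (hb : ∀ᵐ x, |a x| ≤ (l ^ n)⁻¹) :
    ∀ᵐ x, ‖a x‖ₑ ≤ (hcube c l).indicator (fun _ => (volume (hcube c l))⁻¹) x := by
  filter_upwards [hb] with x hx
  by_cases hxc : x ∈ hcube c l
  · rw [indicator_of_mem hxc, volume_hcube, ← ENNReal.ofReal_pow hl.le,
      ← ENNReal.ofReal_inv_of_pos (by positivity), Real.enorm_eq_ofReal_abs]
    exact ENNReal.ofReal_le_ofReal hx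
  · rw [h0 x hxc, enorm_zero]
    exact zero_le

lemma lintegral_mul_atom_le (hl : 0 < l) (h0 : ∀ x, x ∉ hcube c l → a x = 0)
    (hb : ∀ᵐ x, |a x| ≤ (l ^ n)⁻¹) (F : Rn n → ℝ≥0∞) :
    ∫⁻ x, F x * ‖a x‖ₑ ≤ (∫⁻ x in hcube c l, F x) / ENNReal.ofReal l ^ n := by
  calc ∫⁻ x, F x * ‖a x‖ₑ
      ≤ ∫⁻ x, (hcube c l).indicator (fun x => F x * (volume (hcube c l))⁻¹) x := by
        refine lintegral_mono_ae ?_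
        filter_upwards [ae_enorm_le_of_atom hl h0 hb] with x hx
        by_cases hxc : x ∈ hcube c l
        · rw [indicator_of_mem hxc] at hx ⊢
          gcongr
        · rw [h0 x hxc, enorm_zero, mul_zero]
          exact zero_le
    _ = _ := by
        rw [lintegral_indicator (measurableSet_hcube _ _), volume_hcube,
          lintegral_mul_const' _ _ (by simp only [ne_eq, ENNReal.inv_eq_top]; positivity),
          div_eq_mul_inv]

lemma lintegral_atom_le (hl : 0 < l) (h0 : ∀ x, x ∉ hcube c l → a x = 0)
    (hb : ∀ᵐ x, |a x| ≤ (l ^ n)⁻¹) : ∫⁻ x, ‖a x‖ₑ ≤ 1 := by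
  have h := lintegral_mul_atom_le hl h0 hb fun _ => 1
  simp only [one_mul, setLIntegral_one, volume_hcube] at h
  exact h.trans ENNReal.div_self_le_one

lemma integrable_of_atom (hl : 0 < l) (hm : Measurable a) (h0 : ∀ x, x ∉ hcube c l → a x = 0)
    (hb : ∀ᵐ x, |a x| ≤ (l ^ n)⁻¹) : Integrable a :=
  ⟨hm.aestronglyMeasurable, (lintegral_atom_le hl h0 hb).trans_lt ENNReal.one_lt_top⟩

lemma hasCompactSupport_of_hcube (h0 : ∀ x, x ∉ hcube c l → a x = 0) : HasCompactSupport a := by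
  refine HasCompactSupport.of_support_subset_isCompact (isCompact_closedBall c (n * (l / 2)))
    fun x hx => cube_subset_closedBall c l (hcube_subset_cube c l ?_)
  by_contra h
  exact hx (h0 x h)

lemma lintegral_osc_atom_le (hl : 0 < l) (h0 : ∀ x, x ∉ hcube c l → a x = 0)
    (hab : ∀ᵐ x, |a x| ≤ (l ^ n)⁻¹) {b : Rn n → ℝ} (hb : LocallyIntegrable b volume) {M : ℝ}
    (hM : OscBound b M) :
    ∫⁻ x, ‖(b x - avgOn b (cube c l)) * a x‖ₑ ≤ ENNReal.ofReal M := by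
  simp only [enorm_mul]
  refine (lintegral_mul_atom_le hl h0 hab fun x => ‖b x - avgOn b (cube c l)‖ₑ).trans ?_
  refine ENNReal.div_le_of_le_mul ?_
  exact (lintegral_mono_set (hcube_subset_cube c l)).trans (lintegral_cube_sub_avgOn_le hb hM c hl)

/-- The normalised indicator of a cube. -/
def avgBump {n : ℕ} (z : Rn n) (L : ℝ) (x : Rn n) : ℝ :=
  (hcube z L).indicator (fun _ => (L ^ n)⁻¹) x

lemma enorm_avgBump (z : Rn n) {L : ℝ} (hL : 0 < L) (x : Rn n) :
    ‖avgBump z L x‖ₑ = (hcube z L).indicator (fun _ => (volume (hcube z L))⁻¹) x := by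
  rw [avgBump, enorm_indicator_eq_indicator_enorm]
  congr 1
  ext y
  rw [volume_hcube, ← ENNReal.ofReal_pow hL.le, ← ENNReal.ofReal_inv_of_pos (by positivity),
    Real.enorm_of_nonneg (by positivity)]

lemma lintegral_enorm_avgBump (z : Rn n) {L : ℝ} (hL : 0 < L) :
    ∫⁻ x, ‖avgBump z L x‖ₑ = 1 := by
  simp only [enorm_avgBump z hL]
  rw [lintegral_indicator_const (measurableSet_hcube _ _), volume_hcube]
  exact ENNReal.inv_mul_cancel (by positivity) (by finiteness)

lemma measurable_avgBump (z : Rn n) (L : ℝ) : Measurable (avgBump z L) :=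
  measurable_const.indicator (measurableSet_hcube _ _)

lemma integrable_avgBump (z : Rn n) {L : ℝ} (hL : 0 < L) : Integrable (avgBump z L) :=
  ⟨(measurable_avgBump z L).aestronglyMeasurable,
    (lintegral_enorm_avgBump z hL).trans_lt ENNReal.one_lt_top⟩

lemma integral_avgBump (z : Rn n) {L : ℝ} (hL : 0 < L) : ∫ x, avgBump z L x = 1 := by
  simp only [avgBump]
  rw [integral_indicator_const _ (measurableSet_hcube _ _), Measure.real, volume_hcube,
    ENNReal.toReal_pow, ENNReal.toReal_ofReal hL.le, smul_eq_mul]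
  exact mul_inv_cancel₀ (by positivity)

/-- Correcting `(b - b_Q) a` to have mean zero, at the scale of a larger cube. -/
lemma exists_atom_correction (hl : 0 < l) (hm : Measurable a)
    (h0 : ∀ x, x ∉ hcube c l → a x = 0) (hab : ∀ᵐ x, |a x| ≤ (l ^ n)⁻¹) {z : Rn n} {L : ℝ}
    (hL : 0 < L) (hsub : hcube c l ⊆ hcube z L)
    {b : Rn n → ℝ} (hb : LocallyIntegrable b volume) {M : ℝ} (hM : OscBound b M) :
    ∃ (γ : ℝ) (β : Rn n → ℝ), ‖γ‖ₑ ≤ ENNReal.ofReal M ∧ Integrable β ∧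
      (∀ y, β y ≠ 0 → ‖y - z‖ ≤ n * L / 2) ∧ ∫ y, β y = 0 ∧ ∫⁻ y, ‖β y‖ₑ ≤ 2 * ENNReal.ofReal M ∧
      ∀ y, (b y - avgOn b (cube c l)) * a y = β y + γ * avgBump z L y := by
  set u : Rn n → ℝ := fun y => (b y - avgOn b (cube c l)) * a y with hu
  have hu1 : ∫⁻ y, ‖u y‖ₑ ≤ ENNReal.ofReal M := lintegral_osc_atom_le hl h0 hab hb hM
  have hui : Integrable u := ⟨(hb.aestronglyMeasurable.sub aestronglyMeasurable_const).mul
    hm.aestronglyMeasurable, hu1.trans_lt ENNReal.ofReal_lt_top⟩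
  have hγ : ‖∫ y, u y‖ₑ ≤ ENNReal.ofReal M := (enorm_integral_le_lintegral_enorm _).trans hu1
  have hbi := (integrable_avgBump z hL).const_mul (∫ y, u y)
  refine ⟨∫ y, u y, fun y => u y - (∫ y, u y) * avgBump z L y, hγ, hui.sub hbi,
    fun y hy => ?_, ?_, ?_, fun y => by ring⟩
  · have hyz : y ∈ hcube z L := by
      by_contra hn
      refine hy ?_
      simp only [hu, avgBump]
      rw [h0 y fun h => hn (hsub h), indicator_of_notMem hn, mul_zero, mul_zero, sub_zero]
    have h1 := cube_subset_closedBall z L (hcube_subset_cube z L hyz)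
    rw [mem_closedBall_iff_norm] at h1
    linarith
  · rw [integral_sub hui hbi, integral_const_mul, integral_avgBump z hL, mul_one, sub_self]
  · calc ∫⁻ y, ‖u y - (∫ y, u y) * avgBump z L y‖ₑ
        ≤ ∫⁻ y, (‖u y‖ₑ + ‖∫ y, u y‖ₑ * ‖avgBump z L y‖ₑ) := by
          refine lintegral_mono fun y => ?_
          rw [← enorm_mul]
          exact enorm_sub_le
      _ = (∫⁻ y, ‖u y‖ₑ) + ‖∫ y, u y‖ₑ * 1 := by
          rw [lintegral_add_left' hui.aestronglyMeasurable.enorm,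
            lintegral_const_mul _ (measurable_avgBump z L).enorm, lintegral_enorm_avgBump z hL]
      _ ≤ _ := by
          rw [mul_one, two_mul]
          exact add_le_add hu1 hγ

end Atom

/-! ### The Christ-type decomposition of one slot -/

lemma hasCompactSupport_sum {n : ℕ} (S : Finset ℕ) {u : ℕ → Rn n → ℝ}
    (hu : ∀ k, HasCompactSupport (u k)) : HasCompactSupport fun x => ∑ k ∈ S, u k x := by
  classical
  induction S using Finset.induction_on with
  | empty => exact HasCompactSupport.zero
  | insert k S hk ih =>
    simp only [Finset.sum_insert hk]
    exact (hu k).add ih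

lemma sum_bump_bounds {n : ℕ} (S : Finset ℕ) {μ : ℕ → ℝ} {u : ℕ → Rn n → ℝ} {z : ℕ → Rn n}
    {L : ℕ → ℝ} (hL : ∀ k, 0 < L k) (hm : ∀ k, Measurable (u k))
    (h0 : ∀ k x, x ∉ hcube (z k) (L k) → u k x = 0)
    (hb : ∀ k, ∀ᵐ x, |u k x| ≤ (L k ^ n)⁻¹) {a I : ℝ}
    (ha : ∀ x, ∑ k ∈ S, (hcube (z k) (L k)).indicator
      (fun _ => ‖μ k‖ₑ / volume (hcube (z k) (L k))) x ≤ ENNReal.ofReal a)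
    (hI : ∑ k ∈ S, ‖μ k‖ₑ ≤ ENNReal.ofReal I) :
    Integrable (fun x => ∑ k ∈ S, μ k * u k x) ∧
      HasCompactSupport (fun x => ∑ k ∈ S, μ k * u k x) ∧
      (∀ᵐ x, |∑ k ∈ S, μ k * u k x| ≤ max a 0) ∧
      ∫⁻ x, ‖∑ k ∈ S, μ k * u k x‖ₑ ≤ ENNReal.ofReal I := by
  have hint : ∀ k, Integrable (u k) := fun k => integrable_of_atom (hL k) (hm k) (h0 k) (hb k)
  refine ⟨integrable_finsetSum _ fun k _ => (hint k).const_mul _,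
    hasCompactSupport_sum S fun k => (hasCompactSupport_of_hcube (h0 k)).mul_left, ?_, ?_⟩
  · filter_upwards [ae_all_iff.2 fun k => ae_enorm_le_of_atom (hL k) (h0 k) (hb k)] with x hx
    have h1 : ‖∑ k ∈ S, μ k * u k x‖ₑ ≤ ENNReal.ofReal a := by
      refine (enorm_sum_le _ _).trans ((Finset.sum_le_sum fun k _ => ?_).trans (ha x))
      rw [enorm_mul]
      refine (mul_le_mul_right (hx k) _).trans ?_
      by_cases h : x ∈ hcube (z k) (L k)
      · simp only [indicator_of_mem h, div_eq_mul_inv, le_refl]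
      · simp only [indicator_of_notMem h, mul_zero, le_refl]
    rw [Real.enorm_eq_ofReal_abs, ENNReal.ofReal_le_ofReal_iff'] at h1
    exact le_max_iff.2 h1
  · calc ∫⁻ x, ‖∑ k ∈ S, μ k * u k x‖ₑ ≤ ∫⁻ x, ∑ k ∈ S, ‖μ k‖ₑ * ‖u k x‖ₑ := by
          refine lintegral_mono fun x => (enorm_sum_le _ _).trans_eq ?_
          simp only [enorm_mul]
      _ = ∑ k ∈ S, ‖μ k‖ₑ * ∫⁻ x, ‖u k x‖ₑ := by
          rw [lintegral_finsetSum _ fun k _ => (hm k).enorm.const_mul _]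
          exact Finset.sum_congr rfl fun k _ => lintegral_const_mul _ (hm k).enorm
      _ ≤ ∑ k ∈ S, ‖μ k‖ₑ := Finset.sum_le_sum fun k _ =>
          mul_le_of_le_one_right' (lintegral_atom_le (hL k) (h0 k) (hb k))
      _ ≤ _ := hI

lemma volume_sum_mul_xiMaj_le {n : ℕ} (m : ℕ) (ω : ℝ → ℝ) (S : Finset ℕ)
    {F : ℕ → Rn n → ℝ≥0∞} (hF : ∀ k, AEMeasurable (F k)) {w : ℕ → ℝ≥0∞} {B I : ℝ≥0∞}
    (hw : ∑ k ∈ S, w k ≤ I) (c : ℕ → Rn n) (ρ : ℕ → ℝ)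
    (hB : ∀ k, ∫⁻ x, F k x * xiMaj m ω (c k) (ρ k) x ≤ w k * B) {α : ℝ} (hα : 0 < α) :
    volume {x | ENNReal.ofReal α < ∑ k ∈ S, F k x * xiMaj m ω (c k) (ρ k) x} ≤
      I * B * (ENNReal.ofReal α)⁻¹ := by
  have hm : ∀ k, AEMeasurable fun x => F k x * xiMaj m ω (c k) (ρ k) x := fun k =>
    (hF k).mul (measurable_xiMaj m ω _ _).aemeasurable
  refine (measure_mono fun x hx => ?_).trans
    ((meas_ge_le_lintegral_div (Finset.aemeasurable_fun_sum S fun k _ => hm k)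
      (ENNReal.ofReal_pos.2 hα).ne' ENNReal.ofReal_ne_top).trans ?_)
  · exact le_of_lt (mem_ofPred.1 hx)
  · rw [div_eq_mul_inv]
    refine mul_le_mul_left ?_ _
    rw [lintegral_finsetSum' _ fun k _ => hm k]
    refine (Finset.sum_le_sum fun k _ => hB k).trans ?_
    rw [← Finset.sum_mul]
    exact mul_le_mul_left hw _

/-- A decomposition of one slot of the iterated commutator at height `α`: a good function `g`, a
good correction `G`, and two families of mean-zero pieces whose contributions are under control
off the exceptional set `E`. -/
structure ChristDecomp {n : ℕ} (m : ℕ) (ω : ℝ → ℝ) (C α : ℝ) (b f : Rn n → ℝ) where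
  g : Rn n → ℝ
  G : Rn n → ℝ
  s : Fin 2 → Finset ℕ
  c : Fin 2 → ℕ → Rn n
  ρ : Fin 2 → ℕ → ℝ
  φ : Fin 2 → ℕ → Rn n → ℝ
  ψ : Fin 2 → ℕ → Rn n → ℝ
  E : Set (Rn n)
  volume_E : volume E ≤ ENNReal.ofReal (C / α)
  integrable_g : Integrable g
  integrable_G : Integrable G
  compact_g : HasCompactSupport g
  compact_G : HasCompactSupport G
  bound_g : ∀ᵐ x, |g x| ≤ C * α
  bound_G : ∀ᵐ x, |G x| ≤ C * α
  mass_g : ∫⁻ x, ‖g x‖ₑ ≤ ENNReal.ofReal C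
  mass_G : ∫⁻ x, ‖G x‖ₑ ≤ ENNReal.ofReal C
  ρ_pos : ∀ t k, 0 < ρ t k
  integrable_ψ : ∀ t k, Integrable (ψ t k)
  supp_ψ : ∀ t k y, ψ t k y ≠ 0 → ‖y - c t k‖ ≤ ρ t k / 2
  mean_ψ : ∀ t k, ∫ y, ψ t k y = 0
  decomp : ∀ x y, b x * f y - b y * f y =
    (b x * g y - b y * g y) + G y + ∑ t, ∑ k ∈ s t, φ t k x * ψ t k y
  far : ∀ x ∉ E, ∀ t, ∀ k ∈ s t, 2 * ρ t k ≤ ‖x - c t k‖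
  small : ∀ x ∉ E, ∀ t,
    ∑ k ∈ s t, ‖φ t k x‖ₑ * (∫⁻ y, ‖ψ t k y‖ₑ) * xiMaj m ω (c t k) (ρ t k) x ≤ ENNReal.ofReal α
  comm : ∀ x ∉ E, ∀ R > 0, ∫⁻ y in closedBall x R, ‖b x * g y - b y * g y‖ₑ ≤
    ENNReal.ofReal (C * α) * ENNReal.ofReal R ^ n

lemma exists_christDecomp {n : ℕ} (hn : 1 ≤ n) (m : ℕ) {ω : ℝ → ℝ}
    (hsum : ∑' p : ℕ, (1 + p : ℝ≥0∞) * ENNReal.ofReal (ω ((1 / 2) ^ p) ^ ((1:ℝ) / m)) ≠ ∞)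
    {M : ℝ} (hM : 0 < M) :
    ∃ C : ℝ, 0 < C ∧ ∀ b : Rn n → ℝ, LocallyIntegrable b volume → OscBound b M →
      ∀ f : Rn n → ℝ, FiniteAtomicSum f → ∀ α > 0, Nonempty (ChristDecomp m ω C α b f) := by
  classical
  obtain ⟨C0, hC0⟩ := lintegral_osc_mul_xiMaj_le hn m ω hM
  obtain ⟨C3, hC3p, hC3⟩ := volume_commMaxSet_le hn hM
  set Sg := ∑' p : ℕ, (1 + p : ℝ≥0∞) * ENNReal.ofReal (ω ((1 / 2) ^ p) ^ ((1:ℝ) / m)) with hSg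
  set v := volume (ball (0 : Rn n) 1) with hv
  have hvt : v ≠ ∞ := measure_ball_lt_top.ne
  set V : ℝ≥0∞ := ENNReal.ofReal (2 * n) ^ n * v + 1 * (C0 * Sg) +
    ENNReal.ofReal M * (2 * (2 ^ n * v * Sg)) + ENNReal.ofReal C3 with hV
  have hVt : V ≠ ∞ := by rw [hV]; finiteness
  set C : ℝ := 1 + C3 + 2 ^ n * M + M + V.toReal with hC
  have h2n : (0 : ℝ) < 2 ^ n := by positivity
  have hVC : V ≤ ENNReal.ofReal C := by
    rw [← ENNReal.ofReal_toReal hVt]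
    exact ENNReal.ofReal_le_ofReal (by rw [hC]; nlinarith [mul_pos h2n hM])
  have hVr := V.toReal_nonneg
  have hCp : 0 < C := by rw [hC]; positivity
  have hC1 : 1 ≤ C := by rw [hC]; nlinarith [mul_pos h2n hM]
  have hCC3 : C3 ≤ C := by rw [hC]; nlinarith [mul_pos h2n hM]
  have hCM : M ≤ C := by rw [hC]; nlinarith [mul_pos h2n hM]
  have hC2M : 2 ^ n * M ≤ C := by rw [hC]; nlinarith [mul_pos h2n hM]
  refine ⟨C, hCp, fun b hb hbM f hf α hα => ?_⟩
  have hn0 : (0 : ℝ) < n := by exact_mod_cast hn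
  obtain ⟨s, q, a, lam, ham, ha0, hab, hamean, hlam, hfx⟩ := hf.exists_nat
  obtain ⟨bad, hbads, p, hqp, hgood, hbad, hvol⟩ :=
    exists_bad_split hn s (fun k => ‖lam k‖ₑ) hlam q hα
  set ctr : ℤ × (Fin n → ℤ) → Rn n := fun P => cellCtr 0 1 P.1 P.2 with hctr
  set sd : ℤ × (Fin n → ℤ) → ℝ := fun P => 2 ^ P.1 * 1 with hsd
  have hsdp : ∀ P, 0 < sd P := fun P => by positivity
  have hcell : ∀ P : ℤ × (Fin n → ℤ), cell 0 1 P.1 P.2 = hcube (ctr P) (sd P) := fun P => rfl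
  simp only [hcell] at ha0 hqp hgood hbad hvol
  have hab' : ∀ k, ∀ᵐ x, |a k x| ≤ (sd (q k) ^ n)⁻¹ := fun k => by
    simpa only [hsd, mul_one] using hab k
  have hsd_le : ∀ k, sd (q k) ≤ sd (p k) := fun k => by
    simp only [hsd, mul_one]
    exact zpow_le_zpow_right₀ (by norm_num) (hqp k).2
  choose γ β hγ hβi hβs hβ0 hβm hβ using fun k => exists_atom_correction (hsdp (q k)) (ham k)
    (ha0 k) (hab' k) (hsdp (p k)) (hqp k).1 hb hbM
  have hbadlam : ∑ k ∈ bad, ‖lam k‖ₑ ≤ 1 :=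
    (Finset.sum_le_sum_of_subset hbads).trans hlam
  obtain ⟨hg1, hg2, hg3, hg4⟩ := sum_bump_bounds (s \ bad) (μ := lam) (u := a)
    (z := fun k => ctr (q k)) (L := fun k => sd (q k)) (fun k => hsdp _) ham ha0 hab' (I := 1)
    hgood (by
      rw [ENNReal.ofReal_one]
      exact (Finset.sum_le_sum_of_subset Finset.sdiff_subset).trans hlam)
  have hμ : ∀ k, ‖-(lam k * γ k)‖ₑ ≤ ENNReal.ofReal M * ‖lam k‖ₑ := fun k => by
    rw [enorm_neg, enorm_mul, mul_comm]
    exact mul_le_mul_left (hγ k) _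
  obtain ⟨hG1, hG2, hG3, hG4⟩ := sum_bump_bounds bad (μ := fun k => -(lam k * γ k))
    (u := fun k => avgBump (ctr (p k)) (sd (p k)))
    (z := fun k => ctr (p k)) (L := fun k => sd (p k)) (fun k => hsdp _)
    (fun k => measurable_avgBump _ _) (fun k x hx => indicator_of_notMem hx _)
    (fun k => by
      filter_upwards with x
      have := hsdp (p k)
      rw [avgBump, abs_of_nonneg (indicator_nonneg (fun _ _ => by positivity) _)]
      exact indicator_le_self' (fun _ _ => by positivity) x)
    (a := M * (2 ^ n * α)) (I := M) (fun x => by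
      rw [ENNReal.ofReal_mul hM.le, ENNReal.ofReal_mul (by positivity),
        ENNReal.ofReal_pow (by positivity), ENNReal.ofReal_ofNat]
      refine le_trans ?_ (mul_le_mul_right (hbad x) _)
      rw [Finset.mul_sum]
      refine Finset.sum_le_sum fun k _ => ?_
      by_cases h : x ∈ hcube (ctr (p k)) (sd (p k))
      · simp only [indicator_of_mem h]
        rw [← mul_div_assoc]
        exact ENNReal.div_le_div_right (hμ k) _
      · simp only [indicator_of_notMem h, mul_zero, le_refl])
    (by
      refine (Finset.sum_le_sum fun k _ => hμ k).trans ?_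
      rw [← Finset.mul_sum]
      exact mul_le_of_le_one_right' hbadlam)
  rw [max_eq_left hα.le] at hg3
  rw [max_eq_left (by positivity)] at hG3
  set g : Rn n → ℝ := fun x => ∑ k ∈ s \ bad, lam k * a k x with hg
  set G : Rn n → ℝ := fun x => ∑ k ∈ bad, -(lam k * γ k) * avgBump (ctr (p k)) (sd (p k)) x with hG
  set bQ : ℕ → ℝ := fun k => avgOn b (cube (ctr (q k)) (sd (q k))) with hbQ
  set X0 : Rn n → ℝ≥0∞ := fun x => ∑ k ∈ bad, ‖lam k * (b x - bQ k)‖ₑ * (∫⁻ y, ‖a k y‖ₑ) *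
    xiMaj m ω (ctr (q k)) (n * sd (q k)) x with hX0
  set X1 : Rn n → ℝ≥0∞ := fun x => ∑ k ∈ bad, ‖-lam k‖ₑ * (∫⁻ y, ‖β k y‖ₑ) *
    xiMaj m ω (ctr (p k)) (n * sd (p k)) x with hX1
  set E0 : Set (Rn n) := ⋃ P ∈ bad.image p, closedBall (ctr P) (2 * n * sd P) with hE0
  have hvE0 : volume E0 ≤ ENNReal.ofReal (2 * n) ^ n * v * (ENNReal.ofReal α)⁻¹ := by
    refine (measure_biUnion_finset_le _ _).trans (le_trans ?_ (mul_le_mul_right hvol _))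
    rw [Finset.mul_sum]
    refine Finset.sum_le_sum fun P _ => ?_
    have := hsdp P
    rw [volume_closedBall_Rn _ (by positivity), volume_hcube,
      ENNReal.ofReal_mul (p := 2 * (n : ℝ)) (by positivity), mul_pow]
    exact (by ring : _ = _).le
  have hv0 : volume {x | ENNReal.ofReal α < X0 x} ≤ 1 * (C0 * Sg) * (ENNReal.ofReal α)⁻¹ := by
    refine volume_sum_mul_xiMaj_le m ω bad (fun k => ?_) hbadlam _ _ (fun k => ?_) hα
    · exact ((hb.aestronglyMeasurable.sub aestronglyMeasurable_const).const_mul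
        (lam k)).enorm.mul_const _
    · calc _ ≤ ∫⁻ x, ‖lam k‖ₑ * (‖b x - bQ k‖ₑ * xiMaj m ω (ctr (q k)) (n * sd (q k)) x) := by
            refine lintegral_mono fun x => ?_
            rw [enorm_mul]
            exact (mul_le_mul_left (mul_le_of_le_one_right'
              (lintegral_atom_le (hsdp _) (ha0 k) (hab' k))) _).trans_eq (mul_assoc _ _ _)
        _ = ‖lam k‖ₑ * ∫⁻ x, ‖b x - bQ k‖ₑ * xiMaj m ω (ctr (q k)) (n * sd (q k)) x :=
            lintegral_const_mul' _ _ (by finiteness)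
        _ ≤ _ := mul_le_mul_right (hC0 b hb hbM _ _ (hsdp _)) _
  have hv1 : volume {x | ENNReal.ofReal α < X1 x} ≤
      ENNReal.ofReal M * (2 * (2 ^ n * v * Sg)) * (ENNReal.ofReal α)⁻¹ := by
    refine volume_sum_mul_xiMaj_le m ω bad (w := fun k => ENNReal.ofReal M * ‖lam k‖ₑ)
      (fun k => aemeasurable_const) (by
        rw [← Finset.mul_sum]
        exact mul_le_of_le_one_right' hbadlam) _ _ (fun k => ?_) hα
    have := hsdp (p k)
    rw [lintegral_const_mul _ (measurable_xiMaj m ω _ _), enorm_neg]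
    calc ‖lam k‖ₑ * (∫⁻ y, ‖β k y‖ₑ) * ∫⁻ x, xiMaj m ω (ctr (p k)) (n * sd (p k)) x
        ≤ ‖lam k‖ₑ * (2 * ENNReal.ofReal M) * (2 ^ n * v * Sg) := by
          gcongr
          · exact hβm k
          · exact lintegral_xiMaj_le m _ (by positivity)
      _ = _ := by ring
  have hv3 : volume (commMaxSet b g (ENNReal.ofReal (C3 * α))) ≤
      ENNReal.ofReal C3 * (ENNReal.ofReal α)⁻¹ := by
    refine (hC3 b g hb hbM hg1 α 1 hα one_pos hg3 hg4).trans_eq ?_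
    rw [mul_one, ENNReal.ofReal_div_of_pos hα, div_eq_mul_inv]
  have hfar0 : ∀ x ∉ E0, ∀ k ∈ bad, 2 * (n * sd (p k)) ≤ ‖x - ctr (p k)‖ := fun x hx k hk => by
    simp only [hE0, mem_iUnion, not_exists] at hx
    have h1 := hx (p k) (Finset.mem_image_of_mem p hk)
    rw [mem_closedBall, dist_eq_norm, not_le] at h1
    linarith
  have hfar1 : ∀ x ∉ E0, ∀ k ∈ bad, 2 * (n * sd (q k)) ≤ ‖x - ctr (q k)‖ := fun x hx k hk => by
    simp only [hE0, mem_iUnion, not_exists] at hx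
    have h1 : ¬ _ := fun h => hx (p k) (Finset.mem_image_of_mem p hk)
      (closedBall_subset_of_hcube_subset (hsdp _) (hqp k).1 (Λ := 2 * n) (by linarith)
        (hsd_le k) h)
    rw [mem_closedBall, dist_eq_norm, not_le] at h1
    linarith
  exact ⟨{
    g := g
    G := G
    s := fun _ => bad
    c := ![fun k => ctr (q k), fun k => ctr (p k)]
    ρ := ![fun k => n * sd (q k), fun k => n * sd (p k)]
    φ := ![fun k x => lam k * (b x - bQ k), fun k _ => -lam k]
    ψ := ![a, β]
    E := E0 ∪ {x | ENNReal.ofReal α < X0 x} ∪ {x | ENNReal.ofReal α < X1 x} ∪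
      commMaxSet b g (ENNReal.ofReal (C3 * α))
    volume_E := by
      rw [ENNReal.ofReal_div_of_pos hα, div_eq_mul_inv]
      refine le_trans ?_ (mul_le_mul_left hVC _)
      rw [hV, add_mul, add_mul, add_mul]
      exact (measure_union_le _ _).trans (add_le_add ((measure_union_le _ _).trans
        (add_le_add ((measure_union_le _ _).trans (add_le_add hvE0 hv0)) hv1)) hv3)
    integrable_g := hg1
    integrable_G := hG1
    compact_g := hg2
    compact_G := hG2
    bound_g := by
      filter_upwards [hg3] with x hx
      exact hx.trans (le_mul_of_one_le_left hα.le hC1)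
    bound_G := by
      filter_upwards [hG3] with x hx
      refine hx.trans ?_
      calc M * (2 ^ n * α) = 2 ^ n * M * α := by ring
        _ ≤ C * α := by gcongr
    mass_g := hg4.trans (ENNReal.ofReal_le_ofReal hC1)
    mass_G := hG4.trans (ENNReal.ofReal_le_ofReal hCM)
    ρ_pos := Fin.forall_fin_two.2 ⟨fun k => mul_pos hn0 (hsdp _), fun k => mul_pos hn0 (hsdp _)⟩
    integrable_ψ := Fin.forall_fin_two.2
      ⟨fun k => integrable_of_atom (hsdp _) (ham k) (ha0 k) (hab' k), hβi⟩
    supp_ψ := Fin.forall_fin_two.2 ⟨fun k y hy => by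
      have h1 : y ∈ hcube (ctr (q k)) (sd (q k)) := by
        by_contra h
        exact hy (ha0 k y h)
      have h2 := cube_subset_closedBall _ _ (hcube_subset_cube _ _ h1)
      rw [mem_closedBall, dist_eq_norm] at h2
      exact h2.trans_eq (mul_div_assoc _ _ _).symm, hβs⟩
    mean_ψ := Fin.forall_fin_two.2 ⟨hamean, hβ0⟩
    decomp := fun x y => by
      simp only [Fin.sum_univ_two, Matrix.cons_val_zero, Matrix.cons_val_one]
      have h1 : f y = g y + ∑ k ∈ bad, lam k * a k y := by
        rw [hfx, hg, Finset.sum_sdiff hbads]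
      have h2 : G y + (∑ k ∈ bad, lam k * (b x - bQ k) * a k y + ∑ k ∈ bad, -lam k * β k y) =
          (b x - b y) * ∑ k ∈ bad, lam k * a k y := by
        simp only [hG, Finset.mul_sum]
        rw [← Finset.sum_add_distrib, ← Finset.sum_add_distrib]
        refine Finset.sum_congr rfl fun k _ => ?_
        linear_combination lam k * hβ k y
      rw [h1]
      linear_combination -h2
    far := fun x hx => by
      have hx0 : x ∉ E0 := fun h => hx (Or.inl (Or.inl (Or.inl h)))
      exact Fin.forall_fin_two.2 ⟨hfar1 x hx0, hfar0 x hx0⟩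
    small := fun x hx => Fin.forall_fin_two.2
      ⟨not_lt.1 fun h => hx (Or.inl (Or.inl (Or.inr h))),
        not_lt.1 fun h => hx (Or.inl (Or.inr h))⟩
    comm := fun x hx R hR => by
      have h1 : ¬ _ := fun h => hx (Or.inr ⟨R, hR, h⟩)
      simp only [← sub_mul, enorm_mul]
      refine (not_lt.1 h1).trans ?_
      gcongr }⟩

section Assembly

variable {n m : ℕ} {ω : ℝ → ℝ} {C α : ℝ}

namespace ChristDecomp

variable {b f : Rn n → ℝ}

/-- The four pieces of a slot: the commutator with the good function, the good correction, and the
two families of mean-zero pieces. -/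
def piece (d : ChristDecomp m ω C α b f) : Fin 2 ⊕ Fin 2 → Rn n → Rn n → ℝ
  | .inl i, x, y => if i = 0 then b x * d.g y - b y * d.g y else d.G y
  | .inr t, x, y => ∑ k ∈ d.s t, d.φ t k x * d.ψ t k y

/-- The good function entering a given piece. -/
def good (d : ChristDecomp m ω C α b f) (i : Fin 2 ⊕ Fin 2) : Rn n → ℝ :=
  if i = .inl 0 then d.g else d.G

lemma sum_piece (d : ChristDecomp m ω C α b f) (x y : Rn n) :
    ∑ i, d.piece i x y = b x * f y - b y * f y := by
  rw [d.decomp, Fintype.sum_sum_type, Fin.sum_univ_two]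
  simp only [piece, if_true, one_ne_zero, if_false]

lemma integrable_good (d : ChristDecomp m ω C α b f) (i : Fin 2 ⊕ Fin 2) :
    Integrable (d.good i) := by
  unfold good; split_ifs; exacts [d.integrable_g, d.integrable_G]

lemma compact_good (d : ChristDecomp m ω C α b f) (i : Fin 2 ⊕ Fin 2) :
    HasCompactSupport (d.good i) := by
  unfold good; split_ifs; exacts [d.compact_g, d.compact_G]

lemma bound_good (d : ChristDecomp m ω C α b f) (i : Fin 2 ⊕ Fin 2) :
    ∀ᵐ x, |d.good i x| ≤ C * α := by
  unfold good; split_ifs; exacts [d.bound_g, d.bound_G]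

lemma mass_good (d : ChristDecomp m ω C α b f) (i : Fin 2 ⊕ Fin 2) :
    ∫⁻ x, ‖d.good i x‖ₑ ≤ ENNReal.ofReal C := by
  unfold good; split_ifs; exacts [d.mass_g, d.mass_G]

lemma integrable_mul_good (d : ChristDecomp m ω C α b f) (hb : LocallyIntegrable b volume)
    (i : Fin 2 ⊕ Fin 2) : Integrable fun y => b y * d.good i y :=
  integrable_mul_of_bounded hb (d.integrable_good i).aestronglyMeasurable (d.bound_good i)
    (d.compact_good i)

lemma integrable_piece (d : ChristDecomp m ω C α b f) (hb : LocallyIntegrable b volume)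
    (i : Fin 2 ⊕ Fin 2) (x : Rn n) : Integrable (d.piece i x) := by
  rcases i with i | t
  · change Integrable fun y => if i = 0 then b x * d.g y - b y * d.g y else d.G y
    split_ifs
    · exact (d.integrable_g.const_mul _).sub (by
        simpa only [good, if_true] using d.integrable_mul_good hb (.inl 0))
    · exact d.integrable_G
  · exact integrable_finsetSum _ fun k _ => (d.integrable_ψ t k).const_mul _

lemma lintegral_piece_le (d : ChristDecomp m ω C α b f) (i : Fin 2) {x : Rn n} (hx : x ∉ d.E)
    {R : ℝ} (hR : 0 < R) :
    ∫⁻ y in closedBall x R, ‖d.piece (.inl i) x y‖ₑ ≤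
      ENNReal.ofReal (C * α) * (1 + volume (ball (0 : Rn n) 1)) * ENNReal.ofReal R ^ n := by
  simp only [piece]
  by_cases hi : i = 0
  · simp only [if_pos hi]
    refine (d.comm x hx R hR).trans (mul_le_mul_left ?_ _)
    exact le_mul_of_one_le_right' le_self_add
  · simp only [if_neg hi]
    calc ∫⁻ y in closedBall x R, ‖d.G y‖ₑ
        ≤ ∫⁻ y in closedBall x R, ENNReal.ofReal (C * α) := by
          refine lintegral_mono_ae (ae_restrict_of_ae ?_)
          filter_upwards [d.bound_G] with y hy
          rw [Real.enorm_eq_ofReal_abs]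
          exact ENNReal.ofReal_le_ofReal hy
      _ = ENNReal.ofReal (C * α) * volume (ball (0 : Rn n) 1) * ENNReal.ofReal R ^ n := by
          rw [setLIntegral_const, volume_closedBall_Rn x hR.le]
          ring
      _ ≤ _ := by
          gcongr
          exact le_add_self

end ChristDecomp

lemma CZ.exists_volume_piece_le (hn : 1 ≤ n) (hm : 1 ≤ m) (ω : ℝ → ℝ) {M : ℝ} (hM : 0 < M)
    (hC : 0 < C) :
    ∃ C' : ℝ, 0 < C' ∧ ∀ (A : ℝ) (K : Rn n → (Fin m → Rn n) → ℝ)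
      (T : (Fin m → Rn n → ℝ) → Rn n → ℝ), CZ A ω K T →
      ∀ (b : Fin m → Rn n → ℝ), (∀ j, LocallyIntegrable (b j) volume) →
      (∀ j, OscBound (b j) M) →
      (∀ f : Fin m → Rn n → ℝ, (∀ j, Measurable (f j)) →
        (∀ j, ∃ A : ℝ, ∀ x, |f j x| ≤ A) → (∀ j, HasCompactSupport (f j)) →
        ∀ lam : ℝ, 0 < lam → volume {x | lam < |iterComm T b f x|} ≤
          ENNReal.ofReal ((A * (∏ j, l2norm (f j)) / lam) ^ ((2:ℝ)/(m:ℝ)))) →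
      ∀ (f : Fin m → Rn n → ℝ) (α : ℝ), 0 < α →
      ∀ (d : ∀ j, ChristDecomp m ω C α (b j) (f j)) (σ : Fin m → Fin 2 ⊕ Fin 2),
      volume {x | (∀ j, x ∉ (d j).E) ∧
        C' * A * α ^ m < |T (fun j => (d j).piece (σ j) x) x|} ≤ ENNReal.ofReal (C' / α) := by
  classical
  obtain ⟨Cg, hCg, hgood⟩ := CZ.exists_volume_commSlot_good hn hm ω hM hC
  set v := volume (ball (0 : Rn n) 1) with hv
  have hvt : v ≠ ∞ := measure_ball_lt_top.ne
  set W : ℝ≥0∞ := 1 + ENNReal.ofReal (ω 1 ^ ((1:ℝ) / m)) * (ENNReal.ofReal C * (1 + v)) with hW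
  have hWt : W ≠ ∞ := by rw [hW]; finiteness
  have hWr := W.toReal_nonneg
  set C' : ℝ := 1 + Cg + 2 * 2 ^ (m * n) * W.toReal ^ m with hC'
  have hC'1 : 1 ≤ C' := by
    have : 0 ≤ 2 * 2 ^ (m * n) * W.toReal ^ m := by positivity
    rw [hC']; linarith
  have hC'g : Cg ≤ C' := by
    have : 0 ≤ 2 * 2 ^ (m * n) * W.toReal ^ m := by positivity
    rw [hC']; linarith
  have hC'W : 2 * 2 ^ (m * n) * W.toReal ^ m ≤ C' := by rw [hC']; linarith
  refine ⟨C', by linarith, fun A K T h b hb hbM h2 f α hα d σ => ?_⟩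
  have hA := h.pos
  set Bd : Finset (Fin m) := Finset.univ.filter fun j => (σ j).isRight with hBd
  rcases Bd.eq_empty_or_nonempty with he | hne
  · refine (measure_mono ?_).trans ((hgood A K T h b hb hbM h2
      (Finset.univ.filter fun j => σ j = .inl 0) (fun j => (d j).good (σ j))
      (fun j => (d j).integrable_good _) (fun j => (d j).compact_good _)
      (fun j => (d j).integrable_mul_good (hb j) _) α hα
      (fun j => (d j).bound_good _) (fun j => (d j).mass_good _)).trans
      (ENNReal.ofReal_le_ofReal (by gcongr)))
    rintro x ⟨-, hx⟩
    have e : (fun j => (d j).piece (σ j) x) = commSlot (Finset.univ.filter fun j => σ j = .inl 0) b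
        (fun j => (d j).good (σ j)) x := by
      ext j y
      simp only [commSlot, Finset.mem_filter, Finset.mem_univ, true_and, ChristDecomp.good]
      rcases hσ : σ j with i | t
      · simp only [ChristDecomp.piece, Sum.inl.injEq]
        by_cases hi : i = 0
        · simp only [if_pos hi]
        · simp only [if_neg hi]
      · have : j ∈ Bd := by simp [hBd, hσ]
        simp [he] at this
    rw [e] at hx
    refine lt_of_le_of_lt ?_ hx
    rw [mul_assoc]
    exact le_mul_of_one_le_left (by positivity) hC'1
  · set t : Fin m → Fin 2 := fun j => (σ j).elim id id with ht
    have hbg : ∀ j, Integrable fun y => b j y * (d j).g y := fun j => by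
      simpa only [ChristDecomp.good, if_true] using (d j).integrable_mul_good (hb j) (.inl 0)
    have key := h.ae_enorm_le_of_mean_zero hne (fun j => (d j).s (t j))
      (c := fun j => (d j).c (t j)) (ρ := fun j => (d j).ρ (t j)) (fun j => (d j).ρ_pos _)
      (fun j => (d j).φ (t j)) (ψ := fun j => (d j).ψ (t j)) (fun j => (d j).integrable_ψ _)
      (fun j => (d j).supp_ψ _) (fun j => (d j).mean_ψ _)
      (fun j x => if σ j = .inl 0 then b j x else 0) (p := fun j => (d j).g)
      (q := fun j y => if σ j = .inl 0 then -(b j y * (d j).g y) else (d j).G y)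
      (fun j => (d j).integrable_g)
      (fun j => by
        by_cases hj : σ j = .inl 0
        · simp only [if_pos hj]; exact (hbg j).neg
        · simp only [if_neg hj]; exact (d j).integrable_G)
      (fun j => (d j).compact_g)
      (fun j => by
        by_cases hj : σ j = .inl 0
        · simp only [if_pos hj]; exact (d j).compact_g.mul_left.neg
        · simp only [if_neg hj]; exact (d j).compact_G)
    refine le_of_eq_of_le ?_ zero_le
    rw [← compl_mem_ae_iff]
    filter_upwards [key] with x hx
    rintro ⟨hxE, hlt⟩
    have e0 : ∀ j ∉ Bd, ∀ y, (if σ j = .inl 0 then b j x else 0) * (d j).g y +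
        (if σ j = .inl 0 then -(b j y * (d j).g y) else (d j).G y) = (d j).piece (σ j) x y := by
      intro j hj y
      rcases hσ : σ j with i | t
      · simp only [ChristDecomp.piece, Sum.inl.injEq]
        by_cases hi : i = 0
        · simp only [if_pos hi, sub_eq_add_neg]
        · simp only [if_neg hi, zero_mul, zero_add]
      · exact absurd (by simp [hBd, hσ]) hj
    have e : (fun (j : Fin m) (y : Rn n) => if j ∈ Bd then
        ∑ k ∈ (d j).s (t j), (d j).φ (t j) k x * (d j).ψ (t j) k y else
        (if σ j = .inl 0 then b j x else 0) * (d j).g y +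
        (if σ j = .inl 0 then -(b j y * (d j).g y) else (d j).G y)) =
        fun j => (d j).piece (σ j) x := by
      ext j y
      by_cases hj : j ∈ Bd
      · rw [if_pos hj]
        rcases hσ : σ j with i | i
        · simp [hBd, hσ] at hj
        · simp only [ChristDecomp.piece, ht, hσ, Sum.elim_inr, id]
      · rw [if_neg hj, e0 j hj]
    have h1 := hx (fun j _ => (d j).far x (hxE j) (t j))
      (fun _ => ENNReal.ofReal (C * α) * (1 + v)) (fun j hj R hR => by
        simp only [e0 j hj]
        rcases hσ : σ j with i | i
        · exact (d j).lintegral_piece_le i (hxE j) hR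
        · exact absurd (by simp [hBd, hσ]) hj)
    rw [e] at h1
    have h2 : ‖T (fun j => (d j).piece (σ j) x) x‖ₑ ≤ ENNReal.ofReal (C' * A * α ^ m) := by
      refine h1.trans ?_
      calc _ ≤ ENNReal.ofReal (A * (2 * 2 ^ (m * n))) * ∏ _j : Fin m, (W * ENNReal.ofReal α) := by
            refine mul_le_mul_right (Finset.prod_le_prod (fun _ _ => zero_le) fun j _ => ?_) _
            split_ifs with hj
            · refine ((d j).small x (hxE j) (t j)).trans ?_
              exact le_mul_of_one_le_left' le_self_add
            · rw [ENNReal.ofReal_mul hC.le, hW, add_mul]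
              refine le_trans (le_of_eq ?_) le_add_self
              ring
        _ = ENNReal.ofReal (A * (2 * 2 ^ (m * n)) * (W.toReal * α) ^ m) := by
            rw [Finset.prod_const, Finset.card_univ, Fintype.card_fin,
              ENNReal.ofReal_mul (p := A * (2 * 2 ^ (m * n))) (by positivity),
              ENNReal.ofReal_pow (by positivity), ENNReal.ofReal_mul hWr,
              ENNReal.ofReal_toReal hWt]
        _ ≤ _ := by
            refine ENNReal.ofReal_le_ofReal ?_
            calc A * (2 * 2 ^ (m * n)) * (W.toReal * α) ^ m
                = 2 * 2 ^ (m * n) * W.toReal ^ m * A * α ^ m := by rw [mul_pow]; ring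
              _ ≤ _ := by gcongr
    rw [Real.enorm_eq_ofReal_abs, ENNReal.ofReal_le_ofReal_iff (by positivity)] at h2
    exact absurd hlt h2.not_gt

lemma FiniteAtomicSum.integrable_mul {f b : Rn n → ℝ} (hf : FiniteAtomicSum f)
    (hb : LocallyIntegrable b volume) : Integrable fun y => b y * f y := by
  obtain ⟨s, q, a, lam, ham, ha0, hab, -, -, hfx⟩ := hf.exists_nat
  simp only [hfx, Finset.mul_sum]
  refine integrable_finsetSum _ fun k _ => ?_
  have h1 := (integrable_mul_of_bounded hb (ham k).aestronglyMeasurable (hab k)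
    (hasCompactSupport_of_hcube (ha0 k))).const_mul (lam k)
  refine h1.congr (Eventually.of_forall fun y => ?_)
  ring

lemma FiniteAtomicSum.integrable {f : Rn n → ℝ} (hf : FiniteAtomicSum f) : Integrable f := by
  simpa only [one_mul] using hf.integrable_mul (b := fun _ => 1) (locallyIntegrable_const 1)

lemma volume_sum_pieces_le {ι : Type*} [Fintype ι] {X : Type*} [MeasurableSpace X] {μ : Measure X}
    (F : ι → X → ℝ) {E : Set X} {t N : ℝ} (hN : Fintype.card ι ≤ N) (ht : 0 ≤ t) {u w : ℝ≥0∞}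
    (hE : μ E ≤ u) (hF : ∀ i, μ {x | x ∉ E ∧ t < |F i x|} ≤ w) :
    μ {x | N * t < |∑ i, F i x|} ≤ u + Fintype.card ι * w := by
  calc μ {x | N * t < |∑ i, F i x|} ≤ μ (E ∪ ⋃ i, {x | x ∉ E ∧ t < |F i x|}) := by
        refine measure_mono fun x hx => ?_
        by_contra hcon
        simp only [mem_union, mem_iUnion, not_or, not_exists, mem_ofPred_eq, not_and, not_lt]
          at hcon hx
        refine absurd hx (not_lt.2 ?_)
        calc |∑ i, F i x| ≤ ∑ i, |F i x| := Finset.abs_sum_le_sum_abs _ _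
          _ ≤ ∑ _i : ι, t := Finset.sum_le_sum fun i _ => hcon.2 i hcon.1
          _ = Fintype.card ι * t := by rw [Finset.sum_const, Finset.card_univ, nsmul_eq_mul]
          _ ≤ _ := by gcongr
    _ ≤ u + ∑ i : ι, w := by
        refine (measure_union_le _ _).trans (add_le_add hE ?_)
        exact (measure_iUnion_fintype_le _ _).trans (Finset.sum_le_sum fun i _ => hF i)
    _ = _ := by rw [Finset.sum_const, Finset.card_univ, nsmul_eq_mul]

lemma IsCZKernelM.mono_const {n m : ℕ} {C A : ℝ} {ω : ℝ → ℝ} {K : Rn n → (Fin m → Rn n) → ℝ}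
    (h : IsCZKernelM C ω K) (hC : 0 < C) (hCA : C ≤ A) : IsCZKernelM A ω K := by
  have hS : ∀ (x : Rn n) (y : Fin m → Rn n), (¬ ∀ j, y j = x) → 0 < ∑ j, ‖x - y j‖ := by
    intro x y hxy
    obtain ⟨i, hi⟩ := not_forall.1 hxy
    exact Finset.sum_pos' (fun _ _ => norm_nonneg _)
      ⟨i, Finset.mem_univ i, norm_pos_iff.2 (sub_ne_zero.2 (Ne.symm hi))⟩
  have hmono : ∀ {S w r : ℝ}, 0 < S → |r| ≤ C / S ^ (m * n) * w → |r| ≤ A / S ^ (m * n) * w := by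
    intro S w r hS hr
    have hw : 0 ≤ w := nonneg_of_mul_nonneg_right ((abs_nonneg r).trans hr) (by positivity)
    exact hr.trans (by gcongr)
  refine ⟨fun x y hxy => ?_, fun x x' y hxy hx => hmono (hS x y hxy) (h.2.1 x x' y hxy hx),
    fun x y i y' hxy hy => hmono (hS x y hxy) (h.2.2 x y i y' hxy hy)⟩
  have := hS x y hxy
  exact (h.1 x y hxy).trans (by gcongr)

end Assembly

end Helpers

/-- The iterated commutator `T_{Πb}` of an `m`-linear Calderón–Zygmund
operator of `ω` type, with `ω` non-decreasing, doubling and satisfying the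
log-Dini(1/(2m)) condition and `b_j ∈ BMO`, maps `m`-tuples of finite atomic sums into weak
`L^{1/m}`, with constant `C·(C₀+C₁'+C₂)^{1/m}` depending only on `n`, `m`, `ω`, the doubling
constant `D` and the BMO bounds. -/
theorem stmt4 (n m : ℕ) (hn : 1 ≤ n) (hm : 1 ≤ m) (ω : ℝ → ℝ)
    (hω0 : ∀ t, 0 < t → 0 ≤ ω t)
    (hωmono : ∀ s t : ℝ, 0 < s → s ≤ t → ω s ≤ ω t)
    (D : ℝ) (hD : 0 < D) (hdoub : ∀ t : ℝ, 0 < t → ω (2 * t) ≤ D * ω t)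
    (hω_logDini : IntegrableOn
      (fun t => ω t ^ ((1:ℝ)/(2*(m:ℝ))) * (1 + Real.log (1 / t)) / t) (Ioo (0:ℝ) 1))
    (M : Fin m → ℝ) (hM0 : ∀ j, 0 ≤ M j) :
    ∃ C : ℝ, 0 < C ∧
      ∀ (C₀ C₁' C₂ : ℝ) (K : Rn n → (Fin m → Rn n) → ℝ)
        (T : (Fin m → Rn n → ℝ) → Rn n → ℝ) (b : Fin m → Rn n → ℝ),
        0 < C₀ → 0 < C₁' → 0 < C₂ →
        IsCZKernelM C₀ ω K →
        (∀ f : Fin m → Rn n → ℝ, (∀ j, Integrable (f j)) → Measurable (T f)) →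
        MultilinM T →
        KernelRepM K T →
        (∀ j, LocallyIntegrable (b j) volume) → (∀ j, OscBound (b j) (M j)) →
        -- weak `L²×⋯×L² → L^{2/m,∞}` bound for the iterated commutator `T_{Πb}`
        (∀ f : Fin m → Rn n → ℝ, (∀ j, Measurable (f j)) →
          (∀ j, ∃ A : ℝ, ∀ x, |f j x| ≤ A) → (∀ j, HasCompactSupport (f j)) →
          ∀ lam : ℝ, 0 < lam →
            volume {x | lam < |iterComm T b f x|} ≤
              ENNReal.ofReal ((C₁' * (∏ j, l2norm (f j)) / lam) ^ ((2:ℝ)/(m:ℝ)))) →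
        -- weak `L¹×⋯×L¹ → L^{1/m,∞}` bound for `T`
        (∀ f : Fin m → Rn n → ℝ, (∀ j, Integrable (f j)) → ∀ lam : ℝ, 0 < lam →
            volume {x | lam < |T f x|} ≤
              ENNReal.ofReal ((C₂ * (∏ j, l1norm (f j)) / lam) ^ ((1:ℝ)/(m:ℝ)))) →
        ∀ f : Fin m → Rn n → ℝ, (∀ j, FiniteAtomicSum (f j)) →
        ∀ lam : ℝ, 0 < lam →
          volume {x | lam < |iterComm T b f x|} ≤
            ENNReal.ofReal (C * (C₀ + C₁' + C₂) ^ ((1:ℝ)/(m:ℝ)) * lam ^ (-(1:ℝ)/(m:ℝ))) := by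
  classical
  have hm0 : (0 : ℝ) < m := by exact_mod_cast hm
  set M₀ : ℝ := 1 + ∑ j, M j with hM₀
  have hM₀p : 0 < M₀ := by
    have := Finset.sum_nonneg fun j (_ : j ∈ Finset.univ) => hM0 j
    linarith
  have hMM : ∀ j, M j ≤ M₀ := fun j => by
    have := Finset.single_le_sum (fun i _ => hM0 i) (Finset.mem_univ j)
    linarith
  have hsum := tsum_omega_ne_top hm hω0 hωmono hω_logDini (e := 1 / m)
    (one_div_le_one_div_of_le hm0 (by linarith))
  have hdini : ∑' p : ℕ, ENNReal.ofReal (ω ((1 / 2) ^ p)) ≠ ∞ := by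
    have h1m : (1 : ℝ) ≤ m := by exact_mod_cast hm
    have h1 := tsum_omega_ne_top hm hω0 hωmono hω_logDini (e := 1)
      ((div_le_one (by positivity)).2 (by linarith))
    refine ne_top_of_le_ne_top h1 (ENNReal.tsum_le_tsum fun p => ?_)
    rw [Real.rpow_one]
    exact le_mul_of_one_le_left' le_self_add
  obtain ⟨Cd, hCd, hdec⟩ := exists_christDecomp hn m hsum hM₀p
  obtain ⟨Cp, hCp, hpiece⟩ := CZ.exists_volume_piece_le hn hm ω hM₀p hCd
  set N : ℝ := ((Fintype.card (Fin m → Fin 2 ⊕ Fin 2) : ℕ) : ℝ) with hN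
  have hNp : 0 < N := by
    rw [hN]
    exact Nat.cast_pos.2 Fintype.card_pos
  refine ⟨(m * Cd + N * Cp) * (N * Cp) ^ ((1:ℝ) / m), by positivity, ?_⟩
  intro C₀ C₁' C₂ K T b hC₀ hC₁ hC₂ hK hmeas hlin hrep hb hbM hw2 hw1 f hf lam hlam
  set A : ℝ := C₀ + C₁' + C₂ with hA
  have hAp : 0 < A := by positivity
  have hC₀A : C₀ ≤ A := by linarith
  have hl1 : ∀ g : Rn n → ℝ, 0 ≤ l1norm g := fun g => integral_nonneg fun _ => abs_nonneg _
  have hl2 : ∀ g : Rn n → ℝ, 0 ≤ l2norm g := fun g =>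
    Real.rpow_nonneg (integral_nonneg fun _ => sq_nonneg _) _
  have hcz : CZ A ω K T :=
    { dim_pos := hn
      arity_pos := hm
      nonneg := hω0
      mono := hωmono
      dini := hdini
      pos := hAp
      ker := hK.mono_const hC₀ hC₀A
      meas := hmeas
      lin := hlin
      rep := hrep
      weak := fun g hg t ht => (hw1 g hg t ht).trans (ENNReal.ofReal_le_ofReal (by
        have := Finset.prod_nonneg fun j (_ : j ∈ Finset.univ) => hl1 (g j)
        gcongr
        linarith)) }
  have hbM' : ∀ j, OscBound (b j) M₀ := fun j c l hl => (hbM j c l hl).trans (hMM j)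
  set α : ℝ := (lam / (N * Cp * A)) ^ ((1:ℝ) / m) with hα
  have hαp : 0 < α := by positivity
  have hαm : α ^ m = lam / (N * Cp * A) := by
    rw [hα, ← Real.rpow_natCast, ← Real.rpow_mul (by positivity), one_div_mul_cancel hm0.ne',
      Real.rpow_one]
  let d : ∀ j, ChristDecomp m ω Cd α (b j) (f j) := fun j =>
    (hdec (b j) (hb j) (hbM' j) (f j) (hf j) α hαp).some
  have hsplit : ∀ x, iterComm T b f x =
      ∑ σ : Fin m → Fin 2 ⊕ Fin 2, T (fun j => (d j).piece (σ j) x) x := fun x => by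
    rw [iterComm_eq hlin (fun j => (hf j).integrable) (fun j => (hf j).integrable_mul (hb j))]
    have h1 := hlin.sum (fun _ => Finset.univ) (g := fun j i => (d j).piece i x)
      (fun j i => (d j).integrable_piece (hb j) i x) x
    simp only [(d _).sum_piece] at h1
    rw [h1, Fintype.piFinset_univ]
  have hvE : volume (⋃ j, (d j).E) ≤ m * ENNReal.ofReal (Cd / α) := by
    refine (measure_iUnion_fintype_le _ _).trans
      ((Finset.sum_le_sum fun j _ => (d j).volume_E).trans_eq ?_)
    rw [Finset.sum_const, Finset.card_univ, Fintype.card_fin, nsmul_eq_mul]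
  have hmain := volume_sum_pieces_le
    (fun (σ : Fin m → Fin 2 ⊕ Fin 2) x => T (fun j => (d j).piece (σ j) x) x) hN.ge
    (t := Cp * A * α ^ m) (by positivity) hvE (w := ENNReal.ofReal (Cp / α)) fun σ => by
      simpa only [mem_iUnion, not_exists] using hpiece A K T hcz b hb hbM'
        (fun g hg hgb hgc t ht => (hw2 g hg hgb hgc t ht).trans (ENNReal.ofReal_le_ofReal (by
          have := Finset.prod_nonneg fun j (_ : j ∈ Finset.univ) => hl2 (g j)
          gcongr
          linarith))) f α hαp d σ
  have ht : N * (Cp * A * α ^ m) = lam := by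
    rw [hαm]
    field_simp
  simp only [← hsplit, ht] at hmain
  refine hmain.trans_eq ?_
  have hαi : α⁻¹ = (N * Cp) ^ ((1:ℝ) / m) * A ^ ((1:ℝ) / m) * lam ^ (-(1:ℝ) / m) := by
    rw [hα, Real.div_rpow hlam.le (by positivity), inv_div, Real.mul_rpow (by positivity) hAp.le,
      div_eq_mul_inv, ← Real.rpow_neg hlam.le, neg_div]
  rw [← ENNReal.ofReal_natCast, ← ENNReal.ofReal_natCast, ← ENNReal.ofReal_mul (by positivity),
    ← ENNReal.ofReal_mul (by positivity), ← ENNReal.ofReal_add (by positivity) (by positivity),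
    ← hN, div_eq_mul_inv, div_eq_mul_inv, hαi]
  congr 1
  ring
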